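/- arXiv:1511.06895 — 3 statements merged into one kernel-verified Lean document; each statement's English description precedes it below -/
import Mathlib

section
/- Let Ω ⊂ ℝ be a bounded closed interval and let M : Ω × [0,∞) → ℝ be such that (x,y) ↦ M(x,√y) is C² on Ω × [0,∞) and such that for all x ∈ Ω and all y > 0 the 2×2 matrix [[M_xx(x,y) + M_y(x,y)/y, M_xy(x,y)], [M_xy(x,y), M_yy(x,y)]] is negative semidefinite. Let R > 0 and let μ = e^{-U(x)} dx be a probability measure on ℝⁿ with U smooth and Hess U(x) ≥ R·Id for all x. Then for every smooth bounded function g : ℝⁿ → Ω with bounded derivatives, ∫_{ℝⁿ} M(g(x), ‖∇g(x)‖/√R) dμ(x) ≤ M(∫_{ℝⁿ} g dμ, 0). -/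
open MeasureTheory Real

/-- Negative semidefiniteness of a real matrix. -/
def Matrix.NegSemidef' {n : Type*} [Fintype n] (A : Matrix n n ℝ) : Prop :=
  (-A).PosSemidef

/-- Partial derivative `M_x`. -/
noncomputable def Mx (M : ℝ → ℝ → ℝ) (x y : ℝ) : ℝ := deriv (fun s => M s y) x

/-- Partial derivative `M_y`. -/
noncomputable def My (M : ℝ → ℝ → ℝ) (x y : ℝ) : ℝ := deriv (fun s => M x s) y

/-- Partial derivative `M_xx`. -/
noncomputable def Mxx (M : ℝ → ℝ → ℝ) (x y : ℝ) : ℝ := deriv (fun s => Mx M s y) x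

/-- Partial derivative `M_xy`. -/
noncomputable def Mxy (M : ℝ → ℝ → ℝ) (x y : ℝ) : ℝ := deriv (fun s => Mx M x s) y

/-- Partial derivative `M_yy`. -/
noncomputable def Myy (M : ℝ → ℝ → ℝ) (x y : ℝ) : ℝ := deriv (fun s => My M x s) y

/-- The matrix `[[M_xx + M_y/y, M_xy], [M_xy, M_yy]]`. -/
noncomputable def Mmat (M : ℝ → ℝ → ℝ) (x y : ℝ) : Matrix (Fin 2) (Fin 2) ℝ :=
  !![Mxx M x y + My M x y / y, Mxy M x y; Mxy M x y, Myy M x y]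

/-- A differentiable function whose derivative is bounded by `L₁` and `L₂`-Lipschitz. -/
structure LipschitzFDeriv {E : Type*} [NormedAddCommGroup E] [NormedSpace ℝ E]
    (L₁ L₂ : ℝ) (φ : E → ℝ) : Prop where
  differentiable : Differentiable ℝ φ
  norm_fderiv_le : ∀ x, ‖fderiv ℝ φ x‖ ≤ L₁
  norm_fderiv_sub_le : ∀ x y, ‖fderiv ℝ φ x - fderiv ℝ φ y‖ ≤ L₂ * ‖x - y‖
  nonneg : 0 ≤ L₂

namespace LipschitzFDeriv

variable {E : Type*} [NormedAddCommGroup E] [NormedSpace ℝ E] {L₁ L₂ : ℝ} {φ : E → ℝ}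

lemma nonneg_left (h : LipschitzFDeriv L₁ L₂ φ) : 0 ≤ L₁ :=
  (norm_nonneg _).trans (h.norm_fderiv_le 0)

lemma abs_sub_le (h : LipschitzFDeriv L₁ L₂ φ) (x y : E) : |φ y - φ x| ≤ L₁ * ‖y - x‖ :=
  convex_univ.norm_image_sub_le_of_norm_fderiv_le (𝕜 := ℝ) (fun z _ => h.differentiable z)
    (fun z _ => h.norm_fderiv_le z) (Set.mem_univ x) (Set.mem_univ y)

lemma abs_taylor_le (h : LipschitzFDeriv L₁ L₂ φ) (x y : E) :
    |φ y - φ x - fderiv ℝ φ x (y - x)| ≤ L₂ * ‖y - x‖ ^ 2 := by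
  have key := (convex_closedBall x ‖y - x‖).norm_image_sub_le_of_norm_fderiv_le' (𝕜 := ℝ) (f := φ)
    (φ := fderiv ℝ φ x) (C := L₂ * ‖y - x‖) (x := x) (y := y) (fun z _ => h.differentiable z)
    (fun z hz => (h.norm_fderiv_sub_le z x).trans
      (mul_le_mul_of_nonneg_left (mem_closedBall_iff_norm.1 hz) h.nonneg))
    (by simp) (by simp [dist_eq_norm])
  rw [Real.norm_eq_abs] at key
  linarith [key, sq ‖y - x‖, mul_assoc L₂ ‖y - x‖ ‖y - x‖, congrArg (L₂ * ·) (sq ‖y - x‖)]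

lemma mono (h : LipschitzFDeriv L₁ L₂ φ) {L₁' L₂' : ℝ} (h₁ : L₁ ≤ L₁') (h₂ : L₂ ≤ L₂') :
    LipschitzFDeriv L₁' L₂' φ where
  differentiable := h.differentiable
  norm_fderiv_le x := (h.norm_fderiv_le x).trans h₁
  norm_fderiv_sub_le x y := (h.norm_fderiv_sub_le x y).trans (by gcongr)
  nonneg := h.nonneg.trans h₂

end LipschitzFDeriv

section Average

variable {ι : Type*} [Fintype ι]

/-- The average of a finite family of vectors. -/
noncomputable def famMean {F : Type*} [AddCommGroup F] [Module ℝ F] (u : ι → F) : F :=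
  (Fintype.card ι : ℝ)⁻¹ • ∑ j, u j

lemma famMean_mono {u v : ι → ℝ} (h : ∀ j, u j ≤ v j) : famMean u ≤ famMean v := by
  unfold famMean
  rw [smul_eq_mul, smul_eq_mul]
  gcongr with j
  exact h j

lemma famMean_const [Nonempty ι] {F : Type*} [AddCommGroup F] [Module ℝ F] (c : F) :
    famMean (fun _ : ι => c) = c := by
  have : (Fintype.card ι : ℝ) ≠ 0 := by exact_mod_cast Fintype.card_ne_zero
  simp only [famMean, Finset.sum_const, Finset.card_univ]
  rw [← Nat.cast_smul_eq_nsmul ℝ, smul_smul, inv_mul_cancel₀ this, one_smul]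

lemma famMean_add {F : Type*} [AddCommGroup F] [Module ℝ F] (u v : ι → F) :
    famMean (fun j => u j + v j) = famMean u + famMean v := by
  simp [famMean, Finset.sum_add_distrib]

lemma famMean_sub {F : Type*} [AddCommGroup F] [Module ℝ F] (u v : ι → F) :
    famMean (fun j => u j - v j) = famMean u - famMean v := by
  simp [famMean, Finset.sum_sub_distrib, smul_sub]

lemma famMean_mul_left (c : ℝ) (u : ι → ℝ) : famMean (fun j => c * u j) = c * famMean u := by
  simp only [famMean, smul_eq_mul, ← Finset.mul_sum]
  ring

lemma norm_famMean_le [Nonempty ι] {F : Type*} [NormedAddCommGroup F] [NormedSpace ℝ F] {u : ι → F}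
    {c : ℝ} (h : ∀ j, ‖u j‖ ≤ c) : ‖famMean u‖ ≤ c := by
  calc ‖famMean u‖ ≤ famMean (fun j => ‖u j‖) := by
        unfold famMean
        rw [norm_smul, smul_eq_mul, Real.norm_of_nonneg (by positivity)]
        gcongr
        exact norm_sum_le _ _
    _ ≤ famMean (fun _ : ι => c) := famMean_mono h
    _ = c := famMean_const c

lemma famMean_mem_Icc [Nonempty ι] {u : ι → ℝ} {a b : ℝ} (h : ∀ j, u j ∈ Set.Icc a b) :
    famMean u ∈ Set.Icc a b := by
  refine ⟨?_, ?_⟩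
  · simpa [famMean_const] using famMean_mono (u := fun _ => a) (fun j => (h j).1)
  · simpa [famMean_const] using famMean_mono (v := fun _ => b) (fun j => (h j).2)

/-- One step of the random walk `x ↦ T x + v j` with `j` uniformly distributed, acting on
functions. -/
noncomputable def walkStep {E : Type*} [AddCommGroup E] (T : E → E) (v : ι → E) (φ : E → ℝ)
    (x : E) : ℝ :=
  famMean fun j => φ (T x + v j)

variable {E : Type*} [NormedAddCommGroup E] [NormedSpace ℝ E]

lemma hasFDerivAt_walkStep {T : E → E} (hT : Differentiable ℝ T) (v : ι → E) {φ : E → ℝ}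
    (hφ : Differentiable ℝ φ) (x : E) :
    HasFDerivAt (walkStep T v φ)
      ((famMean fun j => fderiv ℝ φ (T x + v j)) ∘L fderiv ℝ T x) x := by
  have h : ∀ j, HasFDerivAt (fun x => φ (T x + v j)) (fderiv ℝ φ (T x + v j) ∘L fderiv ℝ T x) x :=
    fun j => (hφ _).hasFDerivAt.comp x ((hT x).hasFDerivAt.add_const (v j))
  refine ((HasFDerivAt.fun_sum (u := Finset.univ) (fun j _ => h j)).const_smul
    ((Fintype.card ι : ℝ)⁻¹)).congr_fderiv ?_
  ext w
  simp [famMean]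

lemma LipschitzFDeriv.walkStep [Nonempty ι] {T : E → E} {κ Λ L₁ L₂ : ℝ} (hT : Differentiable ℝ T)
    (hκ : ∀ x, ‖fderiv ℝ T x‖ ≤ κ) (hκ' : ∀ x y, ‖T x - T y‖ ≤ κ * ‖x - y‖)
    (hΛ : ∀ x y, ‖fderiv ℝ T x - fderiv ℝ T y‖ ≤ Λ * ‖x - y‖) (hΛ0 : 0 ≤ Λ) (v : ι → E) {φ : E → ℝ}
    (hφ : LipschitzFDeriv L₁ L₂ φ) :
    LipschitzFDeriv (κ * L₁) (κ ^ 2 * L₂ + Λ * L₁) (walkStep T v φ) := by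
  have hκ0 : 0 ≤ κ := (norm_nonneg _).trans (hκ 0)
  have hL₁ := hφ.nonneg_left
  have hL₂ := hφ.nonneg
  have hb : ∀ x, ‖famMean fun j => fderiv ℝ φ (T x + v j)‖ ≤ L₁ :=
    fun x => norm_famMean_le fun j => hφ.norm_fderiv_le _
  refine ⟨fun x => (hasFDerivAt_walkStep hT v hφ.differentiable x).differentiableAt, fun x => ?_,
    fun x y => ?_, by positivity⟩
  · rw [(hasFDerivAt_walkStep hT v hφ.differentiable x).fderiv, mul_comm]
    exact (ContinuousLinearMap.opNorm_comp_le _ _).trans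
      (mul_le_mul (hb x) (hκ x) (norm_nonneg _) hL₁)
  · rw [(hasFDerivAt_walkStep hT v hφ.differentiable x).fderiv,
      (hasFDerivAt_walkStep hT v hφ.differentiable y).fderiv]
    set A := famMean fun j => fderiv ℝ φ (T x + v j)
    set B := famMean fun j => fderiv ℝ φ (T y + v j)
    have hAB : ‖A - B‖ ≤ L₂ * (κ * ‖x - y‖) := by
      rw [← famMean_sub]
      refine norm_famMean_le fun j => (hφ.norm_fderiv_sub_le _ _).trans ?_
      rw [add_sub_add_right_eq_sub]
      exact mul_le_mul_of_nonneg_left (hκ' x y) hL₂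
    have : A ∘L fderiv ℝ T x - B ∘L fderiv ℝ T y
        = (A - B) ∘L fderiv ℝ T x + B ∘L (fderiv ℝ T x - fderiv ℝ T y) := by
      ext w; simp
    rw [this]
    refine (norm_add_le _ _).trans ?_
    have h1 : ‖(A - B) ∘L fderiv ℝ T x‖ ≤ (L₂ * (κ * ‖x - y‖)) * κ :=
      (ContinuousLinearMap.opNorm_comp_le _ _).trans
        (mul_le_mul hAB (hκ x) (norm_nonneg _) (by positivity))
    have h2 : ‖B ∘L (fderiv ℝ T x - fderiv ℝ T y)‖ ≤ L₁ * (Λ * ‖x - y‖) :=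
      (ContinuousLinearMap.opNorm_comp_le _ _).trans
        (mul_le_mul (hb y) (hΛ x y) (norm_nonneg _) hL₁)
    linarith

omit [NormedSpace ℝ E] in
lemma walkStep_mono (T : E → E) (v : ι → E) {φ ψ : E → ℝ} (h : ∀ x, φ x ≤ ψ x) (x : E) :
    walkStep T v φ x ≤ walkStep T v ψ x :=
  famMean_mono fun _ => h _

omit [NormedSpace ℝ E] in
lemma walkStep_add_const [Nonempty ι] (T : E → E) (v : ι → E) (φ : E → ℝ) (c : ℝ) (x : E) :
    walkStep T v (fun y => φ y + c) x = walkStep T v φ x + c := by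
  simp [walkStep, famMean_add, famMean_const]

end Average

lemma le_taylor_of_deriv2_le {φ φ' φ'' : ℝ → ℝ} {D : ℝ}
    (h1 : ∀ s ∈ Set.Icc (0 : ℝ) 1, HasDerivAt φ (φ' s) s)
    (h2 : ∀ s ∈ Set.Icc (0 : ℝ) 1, HasDerivAt φ' (φ'' s) s)
    (hD : ∀ s ∈ Set.Icc (0 : ℝ) 1, φ'' s ≤ D) : φ 1 ≤ φ 0 + φ' 0 + D / 2 := by
  have h3 : ∀ s ∈ Set.Icc (0 : ℝ) 1, φ' s ≤ φ' 0 + D * s := by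
    have hd : ∀ s ∈ Set.Icc (0 : ℝ) 1, HasDerivAt (fun s => φ' 0 + D * s - φ' s) (D - φ'' s) s := by
      intro s hs
      exact ((((hasDerivAt_id s).const_mul D).const_add (φ' 0)).sub (h2 s hs)).congr_deriv
        (by simp)
    have hm : MonotoneOn (fun s => φ' 0 + D * s - φ' s) (Set.Icc 0 1) :=
      monotoneOn_of_hasDerivWithinAt_nonneg (convex_Icc 0 1)
        (fun s hs => (hd s hs).continuousAt.continuousWithinAt)
        (fun s hs => (hd s (interior_subset hs)).hasDerivWithinAt)
        (fun s hs => sub_nonneg.2 (hD s (interior_subset hs)))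
    intro s hs
    have := hm (Set.left_mem_Icc.2 zero_le_one) hs hs.1
    simp at this
    linarith
  have hd : ∀ s ∈ Set.Icc (0 : ℝ) 1,
      HasDerivAt (fun s => φ' 0 * s + D / 2 * s ^ 2 - φ s) (φ' 0 + D * s - φ' s) s := by
    intro s hs
    refine ((((hasDerivAt_id s).const_mul (φ' 0)).add
      (((hasDerivAt_id s).pow 2).const_mul (D / 2))).sub (h1 s hs)).congr_deriv ?_
    simp
    ring
  have hm : MonotoneOn (fun s => φ' 0 * s + D / 2 * s ^ 2 - φ s) (Set.Icc 0 1) :=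
    monotoneOn_of_hasDerivWithinAt_nonneg (convex_Icc 0 1)
      (fun s hs => (hd s hs).continuousAt.continuousWithinAt)
      (fun s hs => (hd s (interior_subset hs)).hasDerivWithinAt)
      (fun s hs => sub_nonneg.2 (h3 s (interior_subset hs)))
  have := hm (Set.left_mem_Icc.2 zero_le_one) (Set.right_mem_Icc.2 zero_le_one) zero_le_one
  simp at this
  linarith

lemma HasFDerivAt.hasDerivAt_comp_apply {E F G : Type*} [NormedAddCommGroup E] [NormedSpace ℝ E]
    [NormedAddCommGroup F] [NormedSpace ℝ F] [NormedAddCommGroup G] [NormedSpace ℝ G]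
    {c : E → F →L[ℝ] G} {c' : E →L[ℝ] F →L[ℝ] G} {γ : ℝ → E} {γ' : E} {s : ℝ}
    (hc : HasFDerivAt c c' (γ s)) (hγ : HasDerivAt γ γ' s) (v : F) :
    HasDerivAt (fun t => c (γ t) v) (c' γ' v) s :=
  (ContinuousLinearMap.apply ℝ G v).hasFDerivAt.comp_hasDerivAt s (hc.comp_hasDerivAt s hγ)

lemma le_taylor_of_fderiv2_le {E : Type*} [NormedAddCommGroup E] [NormedSpace ℝ E] {m : E → ℝ}
    {S : Set E} (hS : IsOpen S) (hm : ContDiffOn ℝ 2 m S) {P Q : E} (hPQ : segment ℝ P Q ⊆ S)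
    {D : ℝ} (hD : ∀ z ∈ segment ℝ P Q, fderiv ℝ (fderiv ℝ m) z (Q - P) (Q - P) ≤ D) :
    m Q ≤ m P + fderiv ℝ m P (Q - P) + D / 2 := by
  have hseg : ∀ s ∈ Set.Icc (0 : ℝ) 1, P + s • (Q - P) ∈ segment ℝ P Q := by
    intro s hs
    rw [segment_eq_image']
    exact ⟨s, hs, rfl⟩
  have hγ : ∀ s, HasDerivAt (fun s : ℝ => P + s • (Q - P)) (Q - P) s := by
    intro s
    simpa using ((hasDerivAt_id s).smul_const (Q - P)).const_add P
  have h1 : ∀ s ∈ Set.Icc (0 : ℝ) 1, HasDerivAt (fun s : ℝ => m (P + s • (Q - P)))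
      (fderiv ℝ m (P + s • (Q - P)) (Q - P)) s := by
    intro s hs
    have := (hm.contDiffAt (hS.mem_nhds (hPQ (hseg s hs)))).differentiableAt (by norm_num)
    exact this.hasFDerivAt.comp_hasDerivAt s (hγ s)
  have h2 : ∀ s ∈ Set.Icc (0 : ℝ) 1, HasDerivAt
      (fun s : ℝ => fderiv ℝ m (P + s • (Q - P)) (Q - P))
      (fderiv ℝ (fderiv ℝ m) (P + s • (Q - P)) (Q - P) (Q - P)) s := by
    intro s hs
    have h := ((hm.contDiffAt (hS.mem_nhds (hPQ (hseg s hs)))).fderiv_right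
      (m := 1) (by norm_num)).differentiableAt (by norm_num)
    exact h.hasFDerivAt.hasDerivAt_comp_apply (hγ s) (Q - P)
  simpa using le_taylor_of_deriv2_le h1 h2 (fun s hs => hD _ (hseg s hs))

lemma exists_abs_sub_le_of_contDiffOn {E : Type*} [NormedAddCommGroup E] [NormedSpace ℝ E]
    {m : E → ℝ} {S K : Set E} (hS : IsOpen S) (hm : ContDiffOn ℝ 1 m S) (hK : IsCompact K)
    (hK' : Convex ℝ K) (hKS : K ⊆ S) :
    ∃ C, 0 ≤ C ∧ ∀ x ∈ K, ∀ y ∈ K, |m y - m x| ≤ C * ‖y - x‖ := by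
  obtain ⟨C, hC⟩ := hK.exists_bound_of_continuousOn
    ((hm.continuousOn_fderiv_of_isOpen hS le_rfl).mono hKS)
  refine ⟨max C 0, le_max_right _ _, fun x hx y hy => ?_⟩
  exact hK'.norm_image_sub_le_of_norm_fderiv_le (𝕜 := ℝ)
    (fun z hz => (hm.contDiffAt (hS.mem_nhds (hKS hz))).differentiableAt (by norm_num))
    (fun z hz => (hC z hz).trans (le_max_left _ _)) hx hy

section Partials

variable {M : ℝ → ℝ → ℝ} {S : Set (ℝ × ℝ)}

lemma Mx_eq_fderiv (hS : IsOpen S) (hM : ContDiffOn ℝ 2 (Function.uncurry M) S) {x y : ℝ}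
    (h : (x, y) ∈ S) : Mx M x y = fderiv ℝ (Function.uncurry M) (x, y) (1, 0) := by
  have hd := (hM.contDiffAt (hS.mem_nhds h)).differentiableAt (by norm_num)
  exact (hd.hasFDerivAt.comp_hasDerivAt x
    ((hasDerivAt_id x).prodMk (hasDerivAt_const x y))).deriv

lemma My_eq_fderiv (hS : IsOpen S) (hM : ContDiffOn ℝ 2 (Function.uncurry M) S) {x y : ℝ}
    (h : (x, y) ∈ S) : My M x y = fderiv ℝ (Function.uncurry M) (x, y) (0, 1) := by
  have hd := (hM.contDiffAt (hS.mem_nhds h)).differentiableAt (by norm_num)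
  exact (hd.hasFDerivAt.comp_hasDerivAt y
    ((hasDerivAt_const y x).prodMk (hasDerivAt_id y))).deriv

lemma fderiv_uncurry_apply (hS : IsOpen S) (hM : ContDiffOn ℝ 2 (Function.uncurry M) S) {x y : ℝ}
    (h : (x, y) ∈ S) (α β : ℝ) :
    fderiv ℝ (Function.uncurry M) (x, y) (α, β) = Mx M x y * α + My M x y * β := by
  rw [Mx_eq_fderiv hS hM h, My_eq_fderiv hS hM h]
  have : ((α, β) : ℝ × ℝ) = α • (1, 0) + β • (0, 1) := by simp
  rw [this, map_add, map_smul, map_smul, smul_eq_mul, smul_eq_mul]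
  ring

lemma fderiv2_uncurry_apply (hS : IsOpen S) (hM : ContDiffOn ℝ 2 (Function.uncurry M) S) {x y : ℝ}
    (h : (x, y) ∈ S) (α β : ℝ) :
    fderiv ℝ (fderiv ℝ (Function.uncurry M)) (x, y) (α, β) (α, β)
      = Mxx M x y * α ^ 2 + 2 * Mxy M x y * α * β + Myy M x y * β ^ 2 := by
  have hc := hM.contDiffAt (hS.mem_nhds h)
  have hd : DifferentiableAt ℝ (fderiv ℝ (Function.uncurry M)) (x, y) :=
    (hc.fderiv_right (m := 1) (by norm_num)).differentiableAt (by norm_num)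
  have hx : ∀ᶠ s in nhds x, (s, y) ∈ S :=
    (Continuous.prodMk_left y).continuousAt.eventually (hS.mem_nhds h)
  have hy : ∀ᶠ s in nhds y, (x, s) ∈ S :=
    (Continuous.prodMk_right x).continuousAt.eventually (hS.mem_nhds h)
  have e1 : Mxx M x y = fderiv ℝ (fderiv ℝ (Function.uncurry M)) (x, y) (1, 0) (1, 0) := by
    have : (fun s => Mx M s y) =ᶠ[nhds x] fun s => fderiv ℝ (Function.uncurry M) (s, y) (1, 0) := by
      filter_upwards [hx] with s hs using Mx_eq_fderiv hS hM hs
    rw [Mxx, this.deriv_eq]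
    exact (hd.hasFDerivAt.hasDerivAt_comp_apply (γ := fun s => (s, y))
      ((hasDerivAt_id x).prodMk (hasDerivAt_const x y)) (1, 0)).deriv
  have e2 : Mxy M x y = fderiv ℝ (fderiv ℝ (Function.uncurry M)) (x, y) (0, 1) (1, 0) := by
    have : (fun s => Mx M x s) =ᶠ[nhds y] fun s => fderiv ℝ (Function.uncurry M) (x, s) (1, 0) := by
      filter_upwards [hy] with s hs using Mx_eq_fderiv hS hM hs
    rw [Mxy, this.deriv_eq]
    exact (hd.hasFDerivAt.hasDerivAt_comp_apply
      ((hasDerivAt_const y x).prodMk (hasDerivAt_id y)) (1, 0)).deriv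
  have e3 : Myy M x y = fderiv ℝ (fderiv ℝ (Function.uncurry M)) (x, y) (0, 1) (0, 1) := by
    have : (fun s => My M x s) =ᶠ[nhds y] fun s => fderiv ℝ (Function.uncurry M) (x, s) (0, 1) := by
      filter_upwards [hy] with s hs using My_eq_fderiv hS hM hs
    rw [Myy, this.deriv_eq]
    exact (hd.hasFDerivAt.hasDerivAt_comp_apply
      ((hasDerivAt_const y x).prodMk (hasDerivAt_id y)) (0, 1)).deriv
  have e4 := (hc.isSymmSndFDerivAt (by simp)).eq (1, 0) (0, 1)
  rw [e1, e2, e3]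
  have : ((α, β) : ℝ × ℝ) = α • (1, 0) + β • (0, 1) := by simp
  rw [this]
  simp only [map_add, map_smul, smul_eq_mul, add_apply,
    smul_apply]
  rw [e4]
  ring

lemma Mmat_quadratic_nonpos {x y : ℝ} (h : (Mmat M x y).NegSemidef') (α β : ℝ) :
    Mxx M x y * α ^ 2 + 2 * Mxy M x y * α * β + Myy M x y * β ^ 2 ≤ -(My M x y / y) * α ^ 2 := by
  have := Matrix.PosSemidef.dotProduct_mulVec_nonneg h ![α, β]
  simp [Mmat, Matrix.mulVec, dotProduct, Fin.sum_univ_two] at this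
  linarith

end Partials

section Regularity

variable {M : ℝ → ℝ → ℝ} {a b : ℝ}

lemma contDiffOn_uncurry_of_sqrt
    (hC2 : ContDiffOn ℝ 2 (fun p : ℝ × ℝ => M p.1 (Real.sqrt p.2))
      (Set.Icc a b ×ˢ Set.Ici (0 : ℝ))) :
    ContDiffOn ℝ 2 (Function.uncurry M) (Set.Ioo a b ×ˢ Set.Ioi 0) := by
  have h : ContDiffOn ℝ 2 (fun p : ℝ × ℝ => (p.1, p.2 ^ 2)) (Set.Ioo a b ×ˢ Set.Ioi (0 : ℝ)) := by
    fun_prop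
  refine (hC2.comp h fun p hp => ⟨Set.Ioo_subset_Icc_self hp.1, sq_nonneg p.2⟩).congr
    fun p hp => ?_
  simp [Function.uncurry, Real.sqrt_sq (le_of_lt (show 0 < p.2 from hp.2))]

lemma continuousOn_uncurry_of_sqrt
    (hC2 : ContDiffOn ℝ 2 (fun p : ℝ × ℝ => M p.1 (Real.sqrt p.2))
      (Set.Icc a b ×ˢ Set.Ici (0 : ℝ))) :
    ContinuousOn (Function.uncurry M) (Set.Icc a b ×ˢ Set.Ici 0) := by
  have h : ContinuousOn (fun p : ℝ × ℝ => (p.1, p.2 ^ 2)) (Set.Icc a b ×ˢ Set.Ici (0 : ℝ)) := by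
    fun_prop
  refine (hC2.continuousOn.comp h fun p hp => ⟨hp.1, sq_nonneg p.2⟩).congr fun p hp => ?_
  simp [Function.uncurry, Real.sqrt_sq (show 0 ≤ p.2 from hp.2)]

lemma hasDerivWithinAt_zero_of_sqrt
    (hC2 : ContDiffOn ℝ 2 (fun p : ℝ × ℝ => M p.1 (Real.sqrt p.2))
      (Set.Icc a b ×ˢ Set.Ici (0 : ℝ))) {x : ℝ} (hx : x ∈ Set.Icc a b) :
    HasDerivWithinAt (M x) 0 (Set.Ici 0) 0 := by
  have h0 : DifferentiableWithinAt ℝ (fun p : ℝ × ℝ => M p.1 (Real.sqrt p.2))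
      (Set.Icc a b ×ˢ Set.Ici (0 : ℝ)) (x, (0 : ℝ) ^ 2) :=
    hC2.differentiableOn (by norm_num) _ ⟨hx, by simp⟩
  have h1 : HasDerivWithinAt (fun r : ℝ => (x, r ^ 2)) (0, 0) (Set.Ici 0) 0 := by
    refine (((hasDerivAt_const (0 : ℝ) x).prodMk
      ((hasDerivAt_id (0 : ℝ)).pow 2)).hasDerivWithinAt).congr_deriv ?_
    simp
  have h2 := h0.hasFDerivWithinAt.comp_hasDerivWithinAt (0 : ℝ) h1
    (t := Set.Icc a b ×ˢ Set.Ici (0 : ℝ)) (fun r _ => Set.mk_mem_prod hx (sq_nonneg r))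
  refine (h2.congr (fun r hr => ?_) ?_).congr_deriv ?_
  · simp [Real.sqrt_sq (show 0 ≤ r from hr)]
  · simp
  · exact map_zero _

lemma My_nonpos
    (hC2 : ContDiffOn ℝ 2 (fun p : ℝ × ℝ => M p.1 (Real.sqrt p.2))
      (Set.Icc a b ×ˢ Set.Ici (0 : ℝ)))
    (hNeg : ∀ x ∈ Set.Icc a b, ∀ y : ℝ, 0 < y → (Mmat M x y).NegSemidef')
    {x y : ℝ} (hx : x ∈ Set.Ioo a b) (hy : 0 < y) : My M x y ≤ 0 := by
  have hS : IsOpen (Set.Ioo a b ×ˢ Set.Ioi (0 : ℝ)) := isOpen_Ioo.prod isOpen_Ioi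
  have hM := contDiffOn_uncurry_of_sqrt hC2
  have hd : ∀ r, 0 < r → HasDerivAt (M x) (My M x r) r := by
    intro r hr
    have h := (hM.contDiffAt (hS.mem_nhds (x := (x, r)) ⟨hx, hr⟩)).differentiableAt
      (by norm_num)
    have := h.hasFDerivAt.comp_hasDerivAt r ((hasDerivAt_const r x).prodMk (hasDerivAt_id r))
    exact this.differentiableAt.hasDerivAt
  have hd2 : ∀ r, 0 < r → HasDerivAt (My M x) (Myy M x r) r := by
    intro r hr
    have h := ((hM.contDiffAt (hS.mem_nhds (x := (x, r)) ⟨hx, hr⟩)).fderiv_right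
      (m := 1) (by norm_num)).differentiableAt (by norm_num)
    have := h.hasFDerivAt.hasDerivAt_comp_apply
      ((hasDerivAt_const r x).prodMk (hasDerivAt_id r)) (0, 1)
    have heq : (My M x) =ᶠ[nhds r] fun s => fderiv ℝ (Function.uncurry M) (x, s) (0, 1) := by
      filter_upwards [lt_mem_nhds hr] with s hs using My_eq_fderiv hS hM ⟨hx, hs⟩
    exact (this.congr_of_eventuallyEq heq).differentiableAt.hasDerivAt
  have hanti : AntitoneOn (My M x) (Set.Ioi 0) := by
    refine antitoneOn_of_hasDerivWithinAt_nonpos (f' := Myy M x) (convex_Ioi 0)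
      (fun r hr => (hd2 r hr).continuousAt.continuousWithinAt)
      (fun r hr => (hd2 r (interior_subset hr)).hasDerivWithinAt) (fun r hr => ?_)
    have := Mmat_quadratic_nonpos (hNeg x (Set.Ioo_subset_Icc_self hx) r (interior_subset hr)) 0 1
    simpa using this
  by_contra! hpos
  have hlow : ∀ s ∈ Set.Ioc 0 y, My M x y * s ≤ M x s - M x 0 := by
    intro s hs
    have hc : ContinuousOn (M x) (Set.Icc 0 s) := by
      have : ContinuousOn (fun r : ℝ => (x, r)) (Set.Icc 0 s) := by fun_prop
      exact (continuousOn_uncurry_of_sqrt hC2).comp this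
        (fun r hr => ⟨Set.Ioo_subset_Icc_self hx, hr.1⟩)
    obtain ⟨c, hc, hc'⟩ := exists_hasDerivAt_eq_slope (M x) (My M x) hs.1 hc
      (fun r hr => hd r hr.1)
    have h1 : My M x y ≤ My M x c := hanti hc.1 hy (hc.2.le.trans hs.2)
    rw [hc', sub_zero, le_div_iff₀ hs.1] at h1
    exact h1
  have h0 := hasDerivWithinAt_zero_of_sqrt hC2 (Set.Ioo_subset_Icc_self hx)
  have ht := (hasDerivWithinAt_iff_tendsto_slope' (by simp)).1 (h0.mono Set.Ioi_subset_Ici_self)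
  obtain ⟨s, hs1, hs2⟩ := ((ht.eventually (gt_mem_nhds hpos)).and
    (Ioc_mem_nhdsGT hy)).exists
  have := hlow s hs2
  rw [slope_def_field, sub_zero, div_lt_iff₀ hs2.1] at hs1
  linarith

/-- One-sided second order Taylor bounds for `M` on a rectangle, with `q` playing the role of
`-M_y / y`. -/
structure BellmanTaylor (M p q : ℝ → ℝ → ℝ) (a b r₀ r₁ C : ℝ) : Prop where
  le_taylor : ∀ x ∈ Set.Icc a b, ∀ r ∈ Set.Icc r₀ r₁, ∀ x' ∈ Set.Icc a b, ∀ r' ∈ Set.Icc r₀ r₁,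
    M x' r' ≤ M x r + p x r * (x' - x) - q x r * r * (r' - r) + q x r / 2 * (x' - x) ^ 2
      + C * (x' - x) ^ 2 * (|x' - x| + |r' - r|)
  taylor_le : ∀ x ∈ Set.Icc a b, ∀ r ∈ Set.Icc r₀ r₁, ∀ r' ∈ Set.Icc r₀ r₁,
    M x r - q x r * r * (r' - r) - C * (r' - r) ^ 2 ≤ M x r'
  q_nonneg : ∀ x ∈ Set.Icc a b, ∀ r ∈ Set.Icc r₀ r₁, 0 ≤ q x r
  q_le : ∀ x ∈ Set.Icc a b, ∀ r ∈ Set.Icc r₀ r₁, q x r ≤ C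
  abs_sub_le : ∀ x ∈ Set.Icc a b, ∀ r ∈ Set.Icc r₀ r₁, ∀ x' ∈ Set.Icc a b, ∀ r' ∈ Set.Icc r₀ r₁,
    |M x' r' - M x r| ≤ C * (|x' - x| + |r' - r|)
  antitone : ∀ x ∈ Set.Icc a b, AntitoneOn (M x) (Set.Icc r₀ r₁)
  nonneg : 0 ≤ C

lemma exists_bellmanTaylor
    (hC2 : ContDiffOn ℝ 2 (fun p : ℝ × ℝ => M p.1 (Real.sqrt p.2))
      (Set.Icc a b ×ˢ Set.Ici (0 : ℝ)))
    (hNeg : ∀ x ∈ Set.Icc a b, ∀ y : ℝ, 0 < y → (Mmat M x y).NegSemidef')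
    {a' b' r₀ r₁ : ℝ} (ha : a < a') (hb : b' < b) (hr : 0 < r₀) :
    ∃ p q C, BellmanTaylor M p q a' b' r₀ r₁ C := by
  have hS : IsOpen (Set.Ioo a b ×ˢ Set.Ioi (0 : ℝ)) := isOpen_Ioo.prod isOpen_Ioi
  have hM := contDiffOn_uncurry_of_sqrt hC2
  set S := Set.Ioo a b ×ˢ Set.Ioi (0 : ℝ)
  set m := Function.uncurry M
  have hK : IsCompact (Set.Icc a' b' ×ˢ Set.Icc r₀ r₁) := isCompact_Icc.prod isCompact_Icc
  have hKc : Convex ℝ (Set.Icc a' b' ×ˢ Set.Icc r₀ r₁) := (convex_Icc _ _).prod (convex_Icc _ _)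
  have hKS : Set.Icc a' b' ×ˢ Set.Icc r₀ r₁ ⊆ S := fun z hz =>
    ⟨⟨ha.trans_le hz.1.1, hz.1.2.trans_lt hb⟩, hr.trans_le hz.2.1⟩
  set K := Set.Icc a' b' ×ˢ Set.Icc r₀ r₁
  have hm1 : ContDiffOn ℝ 1 (fderiv ℝ m) S := hM.fderiv_of_isOpen hS (by norm_num)
  set q : ℝ × ℝ → ℝ := fun z => -(fderiv ℝ m z (0, 1)) / z.2 with hq
  have hqd : ContDiffOn ℝ 1 q S :=
    (hm1.clm_apply contDiffOn_const).neg.div contDiffOn_snd fun z hz => ne_of_gt hz.2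
  have hqM : ∀ z ∈ S, q z = -(My M z.1 z.2 / z.2) := by
    rintro ⟨x, y⟩ hz
    simp only [hq, My_eq_fderiv hS hM hz]
    ring
  have hq0 : ∀ z ∈ S, 0 ≤ q z := by
    intro z hz
    rw [hqM z hz, ← neg_div]
    exact div_nonneg (neg_nonneg.2 (My_nonpos hC2 hNeg hz.1 hz.2)) (le_of_lt hz.2)
  obtain ⟨C₁, hC₁0, hC₁⟩ := exists_abs_sub_le_of_contDiffOn hS hqd hK hKc hKS
  obtain ⟨C₂, hC₂0, hC₂⟩ := exists_abs_sub_le_of_contDiffOn hS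
    (hM.of_le (by norm_num)) hK hKc hKS
  obtain ⟨C₃, hC₃⟩ := hK.exists_bound_of_continuousOn (hqd.continuousOn.mono hKS)
  obtain ⟨C₄, hC₄⟩ := hK.exists_bound_of_continuousOn
    ((hm1.continuousOn_fderiv_of_isOpen hS le_rfl).mono hKS)
  have hnorm : ∀ u : ℝ × ℝ, ‖u‖ ≤ |u.1| + |u.2| := fun u =>
    max_le (le_add_of_nonneg_right (abs_nonneg _)) (le_add_of_nonneg_left (abs_nonneg _))
  have hquad : ∀ z ∈ S, ∀ α β : ℝ, fderiv ℝ (fderiv ℝ m) z (α, β) (α, β) ≤ q z * α ^ 2 := by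
    rintro ⟨x, y⟩ hz α β
    rw [fderiv2_uncurry_apply hS hM hz, hqM _ hz]
    exact Mmat_quadratic_nonpos (hNeg x (Set.Ioo_subset_Icc_self hz.1) y hz.2) α β
  have hfd : ∀ z ∈ S, ∀ α β : ℝ, fderiv ℝ m z (α, β) = Mx M z.1 z.2 * α - q z * z.2 * β := by
    rintro ⟨x, y⟩ hz α β
    rw [fderiv_uncurry_apply hS hM hz, hqM _ hz]
    have : y ≠ 0 := ne_of_gt hz.2
    field_simp
    ring
  have hle : ∀ x ∈ Set.Icc a' b', ∀ r ∈ Set.Icc r₀ r₁, C₃ ≥ q (x, r) ∧ 0 ≤ C₃ := fun x hx r hr' =>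
    have h := hC₃ (x, r) ⟨hx, hr'⟩
    ⟨(le_abs_self _).trans h, (abs_nonneg _).trans h⟩
  set C := C₁ + C₂ + |C₃| + |C₄|
  have h1 : C₁ ≤ C := by simp only [C]; linarith [abs_nonneg C₃, abs_nonneg C₄]
  have h2 : C₂ ≤ C := by simp only [C]; linarith [abs_nonneg C₃, abs_nonneg C₄]
  have h3 : C₃ ≤ C := by simp only [C]; linarith [le_abs_self C₃, abs_nonneg C₄]
  have h4 : C₄ ≤ C := by simp only [C]; linarith [abs_nonneg C₃, le_abs_self C₄]
  refine ⟨Mx M, fun x y => q (x, y), C, ?_, ?_, fun x hx r hr' => hq0 _ (hKS ⟨hx, hr'⟩),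
    fun x hx r hr' => (hle x hx r hr').1.le.trans h3, ?_, ?_, by positivity⟩
  · intro x hx r hr' x' hx' r' hr''
    have hP : (x, r) ∈ K := ⟨hx, hr'⟩
    have hQ : (x', r') ∈ K := ⟨hx', hr''⟩
    have hsub := hKc.segment_subset hP hQ
    have hT := le_taylor_of_fderiv2_le hS hM (hsub.trans hKS)
      (D := (q (x, r) + C * (|x' - x| + |r' - r|)) * (x' - x) ^ 2) (fun z hz => by
        refine (hquad z (hKS (hsub hz)) (x' - x) (r' - r)).trans ?_
        refine mul_le_mul_of_nonneg_right ?_ (sq_nonneg _)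
        have h5 := (le_abs_self _).trans (hC₁ _ hP _ (hsub hz))
        have h6 : ‖z - (x, r)‖ ≤ |x' - x| + |r' - r| := by
          rw [segment_eq_image'] at hz
          obtain ⟨s, hs, rfl⟩ := hz
          rw [add_sub_cancel_left, norm_smul, Real.norm_of_nonneg hs.1]
          exact (mul_le_of_le_one_left (norm_nonneg _) hs.2).trans (hnorm _)
        have h7 : C₁ * ‖z - (x, r)‖ ≤ C * (|x' - x| + |r' - r|) := by gcongr
        linarith)
    rw [Prod.mk_sub_mk, hfd _ (hKS hP)] at hT
    change M x' r' ≤ M x r + _ + _ at hT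
    have : 0 ≤ C * (x' - x) ^ 2 * (|x' - x| + |r' - r|) := by positivity
    simp only at hT ⊢
    linarith
  · intro x hx r hr' r' hr''
    have hP : (x, r) ∈ K := ⟨hx, hr'⟩
    have hQ : (x, r') ∈ K := ⟨hx, hr''⟩
    have hsub := hKc.segment_subset hP hQ
    have hT := le_taylor_of_fderiv2_le (m := fun z => -m z) hS hM.neg (hsub.trans hKS)
      (D := C * (r' - r) ^ 2) (fun z hz => by
        have e : fderiv ℝ (fderiv ℝ fun z => -m z) z = -fderiv ℝ (fderiv ℝ m) z := by
          have : (fderiv ℝ fun z => -m z) = fun z => -fderiv ℝ m z := by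
            ext1 z; exact fderiv_neg
          rw [this]; exact fderiv_neg
        rw [e]
        have h5 := (fderiv ℝ (fderiv ℝ m) z).le_opNorm₂ ((x, r') - (x, r)) ((x, r') - (x, r))
        have h6 : ‖((x, r') - (x, r) : ℝ × ℝ)‖ = |r' - r| := by simp [Prod.norm_def]
        rw [h6, mul_assoc, abs_mul_abs_self, ← sq] at h5
        have h7 : ‖fderiv ℝ (fderiv ℝ m) z‖ ≤ C := (hC₄ z (hsub hz)).trans h4
        refine (neg_le_abs _).trans (h5.trans ?_)
        gcongr)
    rw [fderiv_fun_neg, Prod.mk_sub_mk, neg_apply, hfd _ (hKS hP)] at hT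
    change -M x r' ≤ -M x r + _ + _ at hT
    have : 0 ≤ C * (r' - r) ^ 2 := by positivity
    simp only at hT ⊢
    linarith
  · intro x hx r hr' x' hx' r' hr''
    refine (hC₂ (x, r) ⟨hx, hr'⟩ (x', r') ⟨hx', hr''⟩).trans ?_
    have := hnorm ((x', r') - (x, r))
    simp only [Prod.mk_sub_mk] at this ⊢
    gcongr
  · intro x hx
    have hd : ∀ r ∈ Set.Icc r₀ r₁, HasDerivAt (M x) (My M x r) r := by
      intro r hr'
      have h := (hM.contDiffAt (hS.mem_nhds (x := (x, r)) (hKS ⟨hx, hr'⟩))).differentiableAt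
        (by norm_num)
      have := h.hasFDerivAt.comp_hasDerivAt r ((hasDerivAt_const r x).prodMk (hasDerivAt_id r))
      exact this.differentiableAt.hasDerivAt
    exact antitoneOn_of_hasDerivWithinAt_nonpos (convex_Icc _ _)
      (fun r hr => (hd r hr).continuousAt.continuousWithinAt)
      (fun r hr => (hd r (interior_subset hr)).hasDerivWithinAt)
      (fun r hr' => My_nonpos hC2 hNeg ⟨ha.trans_le hx.1, hx.2.trans_lt hb⟩
        (hr.trans_le (interior_subset hr').1))

end Regularity

section Mean

variable {ι : Type*} [Fintype ι]

lemma norm_famMean_le_famMean_norm {F : Type*} [NormedAddCommGroup F] [NormedSpace ℝ F]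
    (u : ι → F) : ‖famMean u‖ ≤ famMean fun j => ‖u j‖ := by
  unfold famMean
  rw [norm_smul, smul_eq_mul, Real.norm_of_nonneg (by positivity)]
  gcongr
  exact norm_sum_le _ _

lemma famMean_sub_sq_le [Nonempty ι] (u : ι → ℝ) (c : ℝ) :
    famMean (fun j => (u j - famMean u) ^ 2) ≤ famMean fun j => (u j - c) ^ 2 := by
  set m := famMean u with hm
  have h : famMean (fun j => (u j - c) ^ 2) = famMean (fun j => (u j - m) ^ 2) + (m - c) ^ 2 := by
    have e : (fun j => (u j - c) ^ 2)
        = fun j => ((u j - m) ^ 2 + (2 * (m - c) * (u j - m) + (m - c) ^ 2)) := by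
      ext j; ring
    rw [e, famMean_add, famMean_add, famMean_mul_left, famMean_sub, famMean_const, famMean_const,
      ← hm]
    ring
  rw [h]
  linarith [sq_nonneg (m - c)]

lemma BellmanTaylor.famMean_le [Nonempty ι] {M p q : ℝ → ℝ → ℝ} {a b r₀ r₁ C : ℝ}
    (h : BellmanTaylor M p q a b r₀ r₁ C) (hr₀ : 0 ≤ r₀) {u s : ι → ℝ}
    (hu : ∀ j, u j ∈ Set.Icc a b) (hs : ∀ j, s j ∈ Set.Icc r₀ r₁) {r d₁ d₂ : ℝ}
    (hr : r ∈ Set.Icc r₀ r₁) (hrs : r ≤ famMean s) (hd₁ : ∀ j, |u j - famMean u| ≤ d₁)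
    (hd₂ : ∀ j, |s j - r| ≤ d₂) :
    famMean (fun j => M (u j) (s j)) ≤ M (famMean u) r
      + q (famMean u) r / 2 * famMean (fun j => (u j - famMean u) ^ 2)
      + C * d₁ ^ 2 * (d₁ + d₂) := by
  have hm : famMean u ∈ Set.Icc a b := famMean_mem_Icc hu
  set m := famMean u with hmdef
  set K := C * d₁ ^ 2 * (d₁ + d₂) with hK
  obtain ⟨K', hK'⟩ : ∃ K', K' = M m r + K := ⟨_, rfl⟩
  have h1 : famMean (fun j => M (u j) (s j)) ≤ famMean fun j =>
      K' + (p m r * (u j - m) + (-(q m r * r) * (s j - r)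
        + q m r / 2 * (u j - m) ^ 2)) := by
    refine famMean_mono fun j => ?_
    have h2 := h.le_taylor m hm r hr (u j) (hu j) (s j) (hs j)
    have h3 : C * (u j - m) ^ 2 * (|u j - m| + |s j - r|) ≤ K := by
      rw [hK]
      have := h.nonneg
      have h4 := hd₁ j
      have h5 := hd₂ j
      rw [← sq_abs (u j - m)]
      gcongr
    linarith
  refine h1.trans ?_
  rw [famMean_add, famMean_const, famMean_add, famMean_add, famMean_mul_left (p m r),
    famMean_mul_left (-(q m r * r)), famMean_mul_left (q m r / 2), famMean_sub, famMean_sub,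
    famMean_const, famMean_const, ← hmdef, hK']
  have h6 : 0 ≤ q m r * r * (famMean s - r) :=
    mul_nonneg (mul_nonneg (h.q_nonneg m hm r hr) (hr₀.trans hr.1)) (sub_nonneg.2 hrs)
  linarith

end Mean

section RegNorm

variable {F : Type*} [NormedAddCommGroup F] [NormedSpace ℝ F]

/-- A smooth regularisation of the norm `‖ℓ‖ / √R`. -/
noncomputable def regNorm (ε R : ℝ) (ℓ : F) : ℝ := √(ε ^ 2 + ‖ℓ‖ ^ 2 / R)

lemma regNorm_eq_norm {R : ℝ} (hR : 0 < R) (ε : ℝ) (ℓ : F) :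
    regNorm ε R ℓ = ‖WithLp.toLp 2 (ε, (√R)⁻¹ • ℓ)‖ := by
  rw [WithLp.prod_norm_eq_of_L2, regNorm]
  simp [norm_smul, mul_pow, Real.sq_sqrt hR.le]
  ring_nf

lemma regNorm_famMean_le {ι : Type*} [Fintype ι] [Nonempty ι] {R : ℝ} (hR : 0 < R) (ε : ℝ)
    (ℓ : ι → F) : regNorm ε R (famMean ℓ) ≤ famMean fun j => regNorm ε R (ℓ j) := by
  simp_rw [regNorm_eq_norm hR]
  have : WithLp.toLp 2 (ε, (√R)⁻¹ • famMean ℓ)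
      = famMean fun j => WithLp.toLp 2 (ε, (√R)⁻¹ • ℓ j) := by
    unfold famMean
    rw [← WithLp.toLp_sum, ← WithLp.toLp_smul]
    congr 1
    ext1
    · rw [Prod.smul_fst, Prod.fst_sum]
      exact (famMean_const (ι := ι) ε).symm
    · rw [Prod.smul_snd, Prod.snd_sum, ← Finset.smul_sum]
      exact smul_comm _ _ _
  rw [this]
  exact norm_famMean_le_famMean_norm _

lemma abs_regNorm_sub_le {R : ℝ} (hR : 0 < R) (ε : ℝ) (ℓ ℓ' : F) :
    |regNorm ε R ℓ - regNorm ε R ℓ'| ≤ (√R)⁻¹ * ‖ℓ - ℓ'‖ := by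
  simp_rw [regNorm_eq_norm hR]
  refine (abs_norm_sub_norm_le _ _).trans (le_of_eq ?_)
  rw [← WithLp.toLp_sub, Prod.mk_sub_mk, sub_self, ← smul_sub, WithLp.prod_norm_eq_of_L2]
  change √(‖(0 : ℝ)‖ ^ 2 + ‖(√R)⁻¹ • (ℓ - ℓ')‖ ^ 2) = _
  rw [norm_zero, norm_smul, Real.norm_of_nonneg (by positivity), zero_pow two_ne_zero, zero_add,
    Real.sqrt_sq (by positivity)]

omit [NormedSpace ℝ F] in
lemma le_regNorm {R ε : ℝ} (hR : 0 < R) (ℓ : F) : ε ≤ regNorm ε R ℓ :=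
  Real.le_sqrt_of_sq_le (le_add_of_nonneg_right (by positivity))

omit [NormedSpace ℝ F] in
lemma regNorm_mem_Icc {R ε L : ℝ} (hR : 0 < R) {ℓ : F} (h : ‖ℓ‖ ≤ L) :
    regNorm ε R ℓ ∈ Set.Icc ε (√(ε ^ 2 + L ^ 2 / R)) :=
  ⟨le_regNorm hR ℓ, Real.sqrt_le_sqrt (by gcongr)⟩

end RegNorm

section Noise

variable {n : ℕ}

/-- The steps of the symmetric random walk of size `δ` on `ℝⁿ`. -/
noncomputable def noise (n : ℕ) (δ : ℝ) (j : Fin n × Bool) : EuclideanSpace ℝ (Fin n) :=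
  (if j.2 then δ else -δ) • EuclideanSpace.single j.1 (1 : ℝ)

lemma norm_noise {δ : ℝ} (hδ : 0 ≤ δ) (j : Fin n × Bool) : ‖noise n δ j‖ = δ := by
  rw [noise, norm_smul]
  split_ifs <;> simp [abs_of_nonneg hδ]

lemma famMean_fin_bool {F : Type*} [AddCommGroup F] [Module ℝ F] (u : Fin n × Bool → F) :
    famMean u = (2 * n : ℝ)⁻¹ • ∑ i, (u (i, true) + u (i, false)) := by
  simp [famMean, Fintype.sum_prod_type, mul_comm]

lemma sum_sq_apply_single_le (ℓ : EuclideanSpace ℝ (Fin n) →L[ℝ] ℝ) :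
    ∑ i, ℓ (EuclideanSpace.single i 1) ^ 2 ≤ ‖ℓ‖ ^ 2 := by
  have h := (EuclideanSpace.basisFun (Fin n) ℝ).sum_sq_norm_inner_right
    ((InnerProductSpace.toDual ℝ _).symm ℓ)
  rw [LinearIsometryEquiv.norm_map] at h
  rw [← h]
  refine le_of_eq (Finset.sum_congr rfl fun i _ => ?_)
  rw [real_inner_comm, InnerProductSpace.toDual_symm_apply, Real.norm_eq_abs, sq_abs]
  simp

lemma famMean_sq_apply_noise_le (ℓ : EuclideanSpace ℝ (Fin n) →L[ℝ] ℝ) (δ : ℝ) :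
    famMean (fun j => ℓ (noise n δ j) ^ 2) ≤ (n : ℝ)⁻¹ * δ ^ 2 * ‖ℓ‖ ^ 2 := by
  have e : famMean (fun j => ℓ (noise n δ j) ^ 2)
      = (n : ℝ)⁻¹ * δ ^ 2 * ∑ i, ℓ (EuclideanSpace.single i 1) ^ 2 := by
    rw [famMean_fin_bool, smul_eq_mul, Finset.mul_sum, Finset.mul_sum]
    refine Finset.sum_congr rfl fun i _ => ?_
    simp [noise]
    ring
  rw [e]
  gcongr
  exact sum_sq_apply_single_le ℓ

lemma LipschitzFDeriv.famMean_sq_sub_le {L₁ L₂ : ℝ} {g : EuclideanSpace ℝ (Fin n) → ℝ}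
    (hg : LipschitzFDeriv L₁ L₂ g) (hn : 0 < n) {δ : ℝ} (hδ : 0 ≤ δ) (hδ1 : δ ≤ 1)
    (z : EuclideanSpace ℝ (Fin n)) :
    famMean (fun j => (g (z + noise n δ j) - g z) ^ 2) ≤
      (n : ℝ)⁻¹ * δ ^ 2 * ‖famMean fun j => fderiv ℝ g (z + noise n δ j)‖ ^ 2
        + (4 * L₁ * L₂ + 4 * L₂ ^ 2) * δ ^ 3 := by
  have : Nonempty (Fin n) := ⟨⟨0, hn⟩⟩
  set ℓ := famMean fun j => fderiv ℝ g (z + noise n δ j) with hℓ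
  have hL₁ := hg.nonneg_left
  have hL₂ := hg.nonneg
  have hℓL : ‖ℓ‖ ≤ L₁ := norm_famMean_le fun j => hg.norm_fderiv_le _
  have hℓz : ‖fderiv ℝ g z - ℓ‖ ≤ L₂ * δ := by
    have : fderiv ℝ g z - ℓ = famMean fun j => fderiv ℝ g z - fderiv ℝ g (z + noise n δ j) := by
      rw [famMean_sub, famMean_const]
    rw [this]
    refine norm_famMean_le fun j => (hg.norm_fderiv_sub_le _ _).trans (le_of_eq ?_)
    rw [sub_add_cancel_left, norm_neg, norm_noise hδ]
  calc famMean (fun j => (g (z + noise n δ j) - g z) ^ 2)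
      ≤ famMean fun j => ℓ (noise n δ j) ^ 2 + (4 * L₁ * L₂ + 4 * L₂ ^ 2) * δ ^ 3 := by
        refine famMean_mono fun j => ?_
        set v := noise n δ j
        have hv : ‖v‖ = δ := norm_noise hδ j
        have h1 := hg.abs_taylor_le z (z + v)
        rw [add_sub_cancel_left, hv] at h1
        have h2 : |(fderiv ℝ g z - ℓ) v| ≤ L₂ * δ * δ := by
          have := (fderiv ℝ g z - ℓ).le_of_opNorm_le hℓz v
          rwa [hv] at this
        have h3 : |ℓ v| ≤ L₁ * δ := by
          have := ℓ.le_of_opNorm_le hℓL v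
          rwa [hv] at this
        rw [sub_apply] at h2
        set A := ℓ v
        have h4 : |g (z + v) - g z - A| ≤ 2 * L₂ * δ ^ 2 := by
          have := abs_add_le (g (z + v) - g z - fderiv ℝ g z v) (fderiv ℝ g z v - A)
          rw [sub_add_sub_cancel] at this
          linarith
        set D := g (z + v) - g z - A with hD
        have e : (g (z + v) - g z) ^ 2 = A ^ 2 + 2 * (A * D) + D ^ 2 := by rw [hD]; ring
        have h5 : A * D ≤ (L₁ * δ) * (2 * L₂ * δ ^ 2) := by
          refine (le_abs_self _).trans ?_
          rw [abs_mul]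
          gcongr
        have h6 : D ^ 2 ≤ (2 * L₂ * δ ^ 2) ^ 2 := by
          rw [← sq_abs D]
          gcongr
        have h7 : δ ^ 4 ≤ δ ^ 3 := pow_le_pow_of_le_one hδ hδ1 (by norm_num)
        have h8 : L₂ ^ 2 * δ ^ 4 ≤ L₂ ^ 2 * δ ^ 3 := by gcongr
        rw [e]
        nlinarith
    _ ≤ _ := by
        rw [famMean_add, famMean_const]
        gcongr
        exact famMean_sq_apply_noise_le ℓ δ

end Noise

section Bellman

variable {M p q : ℝ → ℝ → ℝ} {a b ε R Λ L₁ C : ℝ}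

lemma BellmanTaylor.le_of_contraction {r₁ : ℝ} (hB : BellmanTaylor M p q a b ε r₁ C) (hε : 0 < ε)
    (hR : 0 < R) {κ h P x r r' : ℝ} (hx : x ∈ Set.Icc a b) (hh : 0 ≤ h) (hκ1 : κ ≤ 1) (hκ0 : 0 ≤ κ)
    (hκ : κ ^ 2 = (1 - h * R) ^ 2 + h ^ 2 * Λ ^ 2) (hP0 : 0 ≤ P) (hP : P ≤ L₁ ^ 2)
    (hr : r = √(ε ^ 2 + P / R)) (hr₁ : r ≤ r₁) (hr' : r' ∈ Set.Icc ε (√(ε ^ 2 + κ ^ 2 * P / R))) :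
    M x r + q x r * (h * P)
      ≤ M x r' + h ^ 2 * (C * (R ^ 2 + Λ ^ 2) * L₁ ^ 2 / (2 * R) + C * L₁ ^ 4 / ε ^ 2) := by
  set s := √(ε ^ 2 + κ ^ 2 * P / R) with hs
  have hs2 : s ^ 2 = ε ^ 2 + κ ^ 2 * P / R := Real.sq_sqrt (by positivity)
  have hr2 : r ^ 2 = ε ^ 2 + P / R := by rw [hr]; exact Real.sq_sqrt (by positivity)
  have hεs : ε ≤ s := hr'.1.trans hr'.2
  have hsr : s ≤ r := by
    rw [hr, hs]
    have : κ ^ 2 * P ≤ P := mul_le_of_le_one_left hP0 (pow_le_one₀ hκ0 hκ1)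
    gcongr
  have hrmem : r ∈ Set.Icc ε r₁ := ⟨hεs.trans hsr, hr₁⟩
  have hsmem : s ∈ Set.Icc ε r₁ := ⟨hεs, hsr.trans hr₁⟩
  have h1 : M x s ≤ M x r' := hB.antitone x hx ⟨hr'.1, hr'.2.trans hsmem.2⟩ hsmem hr'.2
  have h2 := hB.taylor_le x hx r hrmem s hsmem
  have hq := hB.q_nonneg x hx r hrmem
  have hq' := hB.q_le x hx r hrmem
  have hC := hB.nonneg
  have hPR : P = R * (P / R) := by field_simp
  have hw : r ^ 2 - s ^ 2 = 2 * h * P - h ^ 2 * (R ^ 2 + Λ ^ 2) * P / R := by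
    rw [hr2, hs2, hκ]
    field_simp
    ring
  have h3 : r * (r - s) ≥ h * P - h ^ 2 * ((R ^ 2 + Λ ^ 2) * L₁ ^ 2 / (2 * R)) := by
    have e : h ^ 2 * (R ^ 2 + Λ ^ 2) * P / R = 2 * (h ^ 2 * ((R ^ 2 + Λ ^ 2) * P / (2 * R))) := by
      field_simp
    have e2 : h ^ 2 * ((R ^ 2 + Λ ^ 2) * P / (2 * R)) ≤
        h ^ 2 * ((R ^ 2 + Λ ^ 2) * L₁ ^ 2 / (2 * R)) := by gcongr
    nlinarith [sq_nonneg (r - s)]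
  have h4 : r - s ≤ h * L₁ ^ 2 / ε := by
    rw [le_div_iff₀ hε]
    have e3 : 0 ≤ h ^ 2 * (R ^ 2 + Λ ^ 2) * P / R := by positivity
    have e4 : h * P ≤ h * L₁ ^ 2 := by gcongr
    nlinarith
  have h5 : C * (s - r) ^ 2 ≤ h ^ 2 * (C * L₁ ^ 4 / ε ^ 2) := by
    have : (s - r) ^ 2 ≤ (h * L₁ ^ 2 / ε) ^ 2 := by
      rw [← neg_sub, neg_sq]
      exact pow_le_pow_left₀ (sub_nonneg.2 hsr) h4 2
    calc _ ≤ C * (h * L₁ ^ 2 / ε) ^ 2 := by gcongr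
      _ = _ := by field_simp
  have h6 : q x r * (h * P) - h ^ 2 * (C * (R ^ 2 + Λ ^ 2) * L₁ ^ 2 / (2 * R))
      ≤ q x r * (r * (r - s)) := by
    have e5 := mul_le_mul_of_nonneg_left h3 hq
    have e6 : q x r * (h ^ 2 * ((R ^ 2 + Λ ^ 2) * L₁ ^ 2 / (2 * R))) ≤
        C * (h ^ 2 * ((R ^ 2 + Λ ^ 2) * L₁ ^ 2 / (2 * R))) := by gcongr
    have e7 : C * (h ^ 2 * ((R ^ 2 + Λ ^ 2) * L₁ ^ 2 / (2 * R)))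
      = h ^ 2 * (C * (R ^ 2 + Λ ^ 2) * L₁ ^ 2 / (2 * R)) := by ring
    linarith
  linarith

variable {n : ℕ}

/-- The integrand `M(g, ‖∇g‖ / √R)`, regularised at critical points of `g`. -/
noncomputable def bellman {E : Type*} [NormedAddCommGroup E] [NormedSpace ℝ E]
    (M : ℝ → ℝ → ℝ) (ε R : ℝ) (g : E → ℝ) (x : E) : ℝ := M (g x) (regNorm ε R (fderiv ℝ g x))

/-- Along one step of the random walk the function `bellman M ε R g` almost increases. -/
lemma BellmanTaylor.walkStep_le (hn : 0 < n) (hε : 0 < ε) (hR : 0 < R)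
    (hB : BellmanTaylor M p q a b ε (√(ε ^ 2 + L₁ ^ 2 / R)) C) (L₂ : ℝ) :
    ∃ K, 0 ≤ K ∧ ∀ (h δ κ : ℝ) (T : EuclideanSpace ℝ (Fin n) → EuclideanSpace ℝ (Fin n))
      (g : EuclideanSpace ℝ (Fin n) → ℝ), 0 ≤ h → 0 ≤ δ → δ ≤ 1 → δ ^ 2 = 2 * n * h →
      κ ≤ 1 → κ ^ 2 = (1 - h * R) ^ 2 + h ^ 2 * Λ ^ 2 → Differentiable ℝ T →
      (∀ x, ‖fderiv ℝ T x‖ ≤ κ) → LipschitzFDeriv L₁ L₂ g → (∀ x, g x ∈ Set.Icc a b) →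
      ∀ x, walkStep T (noise n δ) (bellman M ε R g) x
        ≤ bellman M ε R (walkStep T (noise n δ) g) x + K * δ ^ 3 := by
  have hC := hB.nonneg
  by_cases hL : 0 ≤ L₁ ∧ 0 ≤ L₂
  swap
  · refine ⟨0, le_rfl, fun h δ κ T g _ _ _ _ _ _ _ _ hg => absurd ⟨hg.nonneg_left, hg.nonneg⟩ hL⟩
  obtain ⟨hL₁, hL₂⟩ := hL
  set r₁ := √(ε ^ 2 + L₁ ^ 2 / R) with hr₁
  set K₁ := C * (R ^ 2 + Λ ^ 2) * L₁ ^ 2 / (2 * R) + C * L₁ ^ 4 / ε ^ 2 with hK₁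
  set K₂ := C * (2 * L₁) ^ 2 * (2 * L₁ + (√R)⁻¹ * (2 * L₂)) with hK₂
  set K₃ := C / 2 * (4 * L₁ * L₂ + 4 * L₂ ^ 2) with hK₃
  refine ⟨K₁ + K₂ + K₃, by positivity, fun h δ κ T g hh hδ hδ1 hδh hκ1 hκ hT hTκ hg hgI x => ?_⟩
  have : Nonempty (Fin n) := ⟨⟨0, hn⟩⟩
  have hn' : (0 : ℝ) < n := by exact_mod_cast hn
  have hκ0 : 0 ≤ κ := (norm_nonneg _).trans (hTκ 0)
  set z := fun j => T x + noise n δ j with hz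
  set m := famMean fun j => g (z j) with hm
  set ℓ := famMean fun j => fderiv ℝ g (z j) with hℓ
  have hmI : m ∈ Set.Icc a b := famMean_mem_Icc fun j => hgI _
  have hzz : ∀ i j, ‖z i - z j‖ ≤ 2 * δ := fun i j => by
    simp only [hz, add_sub_add_left_eq_sub]
    refine (norm_sub_le _ _).trans ?_
    rw [norm_noise hδ, norm_noise hδ, two_mul]
  have hd₁ : ∀ j, |g (z j) - m| ≤ 2 * L₁ * δ := fun j => by
    have : g (z j) - m = famMean fun i => g (z j) - g (z i) := by
      rw [famMean_sub, famMean_const]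
    rw [this]
    refine norm_famMean_le (u := fun i => g (z j) - g (z i)) fun i => (hg.abs_sub_le _ _).trans ?_
    linarith [mul_le_mul_of_nonneg_left (hzz j i) hL₁]
  have hd₂ : ∀ j, |regNorm ε R (fderiv ℝ g (z j)) - regNorm ε R ℓ| ≤ (√R)⁻¹ * (2 * L₂) * δ :=
    fun j => by
    refine (abs_regNorm_sub_le hR _ _ _).trans ?_
    rw [mul_assoc]
    gcongr
    have : fderiv ℝ g (z j) - ℓ = famMean fun i => fderiv ℝ g (z j) - fderiv ℝ g (z i) := by
      rw [famMean_sub, famMean_const]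
    rw [this]
    refine norm_famMean_le fun i => (hg.norm_fderiv_sub_le _ _).trans ?_
    linarith [mul_le_mul_of_nonneg_left (hzz j i) hL₂]
  have hℓL : ‖ℓ‖ ≤ L₁ := norm_famMean_le fun j => hg.norm_fderiv_le _
  have hrI : regNorm ε R ℓ ∈ Set.Icc ε r₁ := regNorm_mem_Icc hR hℓL
  have key := hB.famMean_le hε.le (u := fun j => g (z j))
    (s := fun j => regNorm ε R (fderiv ℝ g (z j))) (fun j => hgI _)
    (fun j => regNorm_mem_Icc hR (hg.norm_fderiv_le _)) hrI (regNorm_famMean_le hR ε _) hd₁ hd₂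
  rw [← hm] at key
  set r := regNorm ε R ℓ with hr
  have hvar : famMean (fun j => (g (z j) - m) ^ 2)
      ≤ 2 * h * ‖ℓ‖ ^ 2 + (4 * L₁ * L₂ + 4 * L₂ ^ 2) * δ ^ 3 := by
    have e := hg.famMean_sq_sub_le hn hδ hδ1 (T x)
    have e' : (n : ℝ)⁻¹ * δ ^ 2 = 2 * h := by rw [hδh]; field_simp
    rw [e'] at e
    exact (famMean_sub_sq_le _ _).trans e
  have hq := hB.q_nonneg m hmI r hrI
  have hq' := hB.q_le m hmI r hrI
  have h1 : q m r / 2 * famMean (fun j => (g (z j) - m) ^ 2)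
      ≤ q m r * (h * ‖ℓ‖ ^ 2) + K₃ * δ ^ 3 := by
    have e1 : q m r / 2 * famMean (fun j => (g (z j) - m) ^ 2)
      ≤ q m r / 2 * (2 * h * ‖ℓ‖ ^ 2 + (4 * L₁ * L₂ + 4 * L₂ ^ 2) * δ ^ 3) := by gcongr
    have e2 : q m r / 2 * ((4 * L₁ * L₂ + 4 * L₂ ^ 2) * δ ^ 3)
      ≤ C / 2 * ((4 * L₁ * L₂ + 4 * L₂ ^ 2) * δ ^ 3) := by gcongr
    rw [hK₃]
    linarith
  have hcon := hB.le_of_contraction (L₁ := L₁) hε hR (P := ‖ℓ‖ ^ 2) (x := m) (r := r)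
    (r' := regNorm ε R (fderiv ℝ (walkStep T (noise n δ) g) x)) hmI hh hκ1 hκ0 hκ
    (by positivity) (by gcongr) rfl hrI.2 (by
      refine ⟨le_regNorm hR _, Real.sqrt_le_sqrt ?_⟩
      rw [(hasFDerivAt_walkStep hT _ hg.differentiable x).fderiv, mul_comm, ← mul_pow]
      gcongr
      exact (ContinuousLinearMap.opNorm_comp_le _ _).trans (by gcongr; exact hTκ x))
  rw [← hK₁] at hcon
  have hh2 : h ^ 2 ≤ δ ^ 3 := by
    have e1 : h ≤ δ ^ 2 := by
      rw [hδh]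
      have : (1 : ℝ) ≤ n := by exact_mod_cast hn
      nlinarith
    calc h ^ 2 ≤ (δ ^ 2) ^ 2 := by gcongr
      _ = δ ^ 4 := by ring
      _ ≤ δ ^ 3 := pow_le_pow_of_le_one hδ hδ1 (by norm_num)
  have h2 : h ^ 2 * K₁ ≤ δ ^ 3 * K₁ := by gcongr
  have h3 : C * (2 * L₁ * δ) ^ 2 * (2 * L₁ * δ + (√R)⁻¹ * (2 * L₂) * δ) = K₂ * δ ^ 3 := by
    rw [hK₂]; ring
  change famMean (fun j => M (g (z j)) (regNorm ε R (fderiv ℝ g (z j)))) ≤ M m _ + _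
  linarith

end Bellman

section Drift

variable {n : ℕ}

/-- The Riesz identification of linear forms with vectors. -/
noncomputable def sharp :
    (EuclideanSpace ℝ (Fin n) →L[ℝ] ℝ) →L[ℝ] EuclideanSpace ℝ (Fin n) :=
  ∑ i, (ContinuousLinearMap.apply ℝ ℝ (EuclideanSpace.single i (1 : ℝ))).smulRight
    (EuclideanSpace.single i (1 : ℝ))

lemma sharp_eq (ℓ : EuclideanSpace ℝ (Fin n) →L[ℝ] ℝ) :
    sharp ℓ = (InnerProductSpace.toDual ℝ _).symm ℓ := by
  refine ext_inner_right ℝ fun w => ?_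
  rw [InnerProductSpace.toDual_symm_apply]
  have hw : w = ∑ i, w i • EuclideanSpace.single i (1 : ℝ) := by
    have := (EuclideanSpace.basisFun (Fin n) ℝ).sum_repr w
    simpa using this.symm
  conv_rhs => rw [hw]
  simp [sharp, sum_inner, inner_smul_left, EuclideanSpace.inner_single_left, mul_comm]

lemma inner_sharp (ℓ : EuclideanSpace ℝ (Fin n) →L[ℝ] ℝ) (w : EuclideanSpace ℝ (Fin n)) :
    inner ℝ (sharp ℓ) w = ℓ w := by
  rw [sharp_eq, InnerProductSpace.toDual_symm_apply]

lemma norm_sharp (ℓ : EuclideanSpace ℝ (Fin n) →L[ℝ] ℝ) : ‖sharp ℓ‖ = ‖ℓ‖ := by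
  rw [sharp_eq, LinearIsometryEquiv.norm_map]

lemma norm_sharp_le : ‖sharp (n := n)‖ ≤ 1 :=
  ContinuousLinearMap.opNorm_le_bound _ zero_le_one fun ℓ => by rw [norm_sharp, one_mul]

/-- A convex function with bounded gradient and bounded second and third derivatives. -/
structure TameConvex (B Λ Λ₂ : ℝ) (W : EuclideanSpace ℝ (Fin n) → ℝ) : Prop where
  lipschitzFDeriv : LipschitzFDeriv B Λ W
  differentiable_fderiv : Differentiable ℝ (fderiv ℝ W)
  norm_fderiv_sub_le : ∀ x y,
    ‖fderiv ℝ (fderiv ℝ W) x - fderiv ℝ (fderiv ℝ W) y‖ ≤ Λ₂ * ‖x - y‖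
  monotone_fderiv : ∀ x y, 0 ≤ (fderiv ℝ W x - fderiv ℝ W y) (x - y)
  nonneg : 0 ≤ Λ₂

/-- One explicit Euler step for the gradient flow of `R / 2 * ‖x‖ ^ 2 + W x`. -/
noncomputable def eulerStep (R h : ℝ) (W : EuclideanSpace ℝ (Fin n) → ℝ)
    (x : EuclideanSpace ℝ (Fin n)) : EuclideanSpace ℝ (Fin n) :=
  x - h • (R • x + sharp (fderiv ℝ W x))

variable {B Λ Λ₂ R h κ : ℝ} {W : EuclideanSpace ℝ (Fin n) → ℝ}

namespace TameConvex

lemma hasFDerivAt_eulerStep (hW : TameConvex B Λ Λ₂ W) (R h : ℝ) (x : EuclideanSpace ℝ (Fin n)) :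
    HasFDerivAt (eulerStep R h W) (ContinuousLinearMap.id ℝ _
      - h • (R • ContinuousLinearMap.id ℝ _ + sharp ∘L fderiv ℝ (fderiv ℝ W) x)) x :=
  (hasFDerivAt_id x).sub ((((hasFDerivAt_id x).const_smul R).add
    (sharp.hasFDerivAt.comp x (hW.differentiable_fderiv x).hasFDerivAt)).const_smul h)

lemma differentiable_eulerStep (hW : TameConvex B Λ Λ₂ W) (R h : ℝ) :
    Differentiable ℝ (eulerStep R h W) :=
  fun x => (hW.hasFDerivAt_eulerStep R h x).differentiableAt

lemma norm_fderiv_eulerStep_sub_le (hW : TameConvex B Λ Λ₂ W) (R : ℝ) (hh : 0 ≤ h)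
    (x y : EuclideanSpace ℝ (Fin n)) :
    ‖fderiv ℝ (eulerStep R h W) x - fderiv ℝ (eulerStep R h W) y‖ ≤ h * Λ₂ * ‖x - y‖ := by
  have e : fderiv ℝ (eulerStep R h W) x - fderiv ℝ (eulerStep R h W) y
      = h • (sharp ∘L (fderiv ℝ (fderiv ℝ W) y - fderiv ℝ (fderiv ℝ W) x)) := by
    rw [(hW.hasFDerivAt_eulerStep R h x).fderiv, (hW.hasFDerivAt_eulerStep R h y).fderiv]
    refine ContinuousLinearMap.ext fun w => ?_
    change (w - h • (R • w + sharp (fderiv ℝ (fderiv ℝ W) x w)))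
      - (w - h • (R • w + sharp (fderiv ℝ (fderiv ℝ W) y w)))
      = h • sharp (fderiv ℝ (fderiv ℝ W) y w - fderiv ℝ (fderiv ℝ W) x w)
    rw [map_sub]
    module
  rw [e, norm_smul, Real.norm_of_nonneg hh, mul_assoc]
  refine mul_le_mul_of_nonneg_left ((ContinuousLinearMap.opNorm_comp_le _ _).trans ?_) hh
  rw [← one_mul (Λ₂ * _), norm_sub_rev x y]
  exact mul_le_mul norm_sharp_le (hW.norm_fderiv_sub_le y x) (norm_nonneg _) zero_le_one

lemma norm_eulerStep_sub_le (hW : TameConvex B Λ Λ₂ W) (hh : 0 ≤ h) (hhR : h * R ≤ 1)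
    (hκ0 : 0 ≤ κ) (hκ : κ ^ 2 = (1 - h * R) ^ 2 + h ^ 2 * Λ ^ 2) (x y : EuclideanSpace ℝ (Fin n)) :
    ‖eulerStep R h W x - eulerStep R h W y‖ ≤ κ * ‖x - y‖ := by
  refine le_of_sq_le_sq ?_ (by positivity)
  set s := sharp (fderiv ℝ W x - fderiv ℝ W y) with hs
  have e : eulerStep R h W x - eulerStep R h W y = (1 - h * R) • (x - y) - h • s := by
    rw [hs, map_sub, eulerStep, eulerStep]
    module
  have h1 : 0 ≤ inner ℝ (x - y) s := by
    rw [real_inner_comm, inner_sharp]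
    exact hW.monotone_fderiv x y
  have h2 : ‖s‖ ≤ Λ * ‖x - y‖ := by
    rw [norm_sharp]
    exact hW.lipschitzFDeriv.norm_fderiv_sub_le x y
  have h3 : ‖s‖ ^ 2 ≤ Λ ^ 2 * ‖x - y‖ ^ 2 := by
    rw [← mul_pow]
    exact pow_le_pow_left₀ (norm_nonneg _) h2 2
  rw [e, norm_sub_sq_real, norm_smul, norm_smul, inner_smul_left, inner_smul_right, mul_pow,
    mul_pow, mul_pow, hκ, Real.norm_eq_abs, Real.norm_eq_abs, sq_abs, sq_abs]
  have h4 : 0 ≤ (1 - h * R) * (h * inner ℝ (x - y) s) :=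
    mul_nonneg (by linarith) (mul_nonneg hh h1)
  have h5 := mul_le_mul_of_nonneg_left h3 (sq_nonneg h)
  simp only [conj_trivial]
  linarith

lemma norm_fderiv_eulerStep_le (hW : TameConvex B Λ Λ₂ W) (hh : 0 ≤ h) (hhR : h * R ≤ 1)
    (hκ0 : 0 ≤ κ) (hκ : κ ^ 2 = (1 - h * R) ^ 2 + h ^ 2 * Λ ^ 2) (x : EuclideanSpace ℝ (Fin n)) :
    ‖fderiv ℝ (eulerStep R h W) x‖ ≤ κ :=
  (hW.hasFDerivAt_eulerStep R h x).differentiableAt.hasFDerivAt.le_of_lip' hκ0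
    (Filter.Eventually.of_forall fun y => hW.norm_eulerStep_sub_le hh hhR hκ0 hκ y x)

lemma norm_eulerStep_sub_self_le (hW : TameConvex B Λ Λ₂ W) (hR : 0 ≤ R) (hh : 0 ≤ h)
    (x : EuclideanSpace ℝ (Fin n)) :
    ‖eulerStep R h W x - x‖ ≤ h * (R * ‖x‖ + B) := by
  rw [eulerStep, sub_sub_cancel_left, norm_neg, norm_smul, Real.norm_of_nonneg hh]
  refine mul_le_mul_of_nonneg_left ((norm_add_le _ _).trans ?_) hh
  rw [norm_smul, Real.norm_of_nonneg hR, norm_sharp]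
  gcongr
  exact hW.lipschitzFDeriv.norm_fderiv_le x

end TameConvex

end Drift

section Gibbs

variable {n : ℕ}

lemma integrable_exp_linear_sub_sq {r : ℝ} (hr : 0 < r) (c : ℝ) :
    Integrable fun x : EuclideanSpace ℝ (Fin n) => exp (c * ‖x‖ - r * ‖x‖ ^ 2) := by
  have h := (GaussianFourier.integrable_cexp_neg_mul_sq_norm_add
    (V := EuclideanSpace ℝ (Fin n)) (b := ((r / 2 : ℝ) : ℂ)) (by simpa using hr) 0 0).norm.const_mul
      (exp (c ^ 2 / (2 * r)))
  refine h.mono' (by fun_prop) (Filter.Eventually.of_forall fun x => ?_)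
  have e : -((r / 2 : ℝ) : ℂ) * (‖x‖ : ℂ) ^ 2 + 0 * ((inner ℝ 0 x : ℝ) : ℂ)
      = ((-(r / 2) * ‖x‖ ^ 2 : ℝ) : ℂ) := by push_cast; ring
  rw [e, Complex.norm_exp_ofReal, ← exp_add, Real.norm_of_nonneg (exp_pos _).le]
  refine exp_le_exp.2 ?_
  have : c * ‖x‖ ≤ c ^ 2 / (2 * r) + r / 2 * ‖x‖ ^ 2 := by
    have e : c ^ 2 / (2 * r) + r / 2 * ‖x‖ ^ 2 - c * ‖x‖ = (c - r * ‖x‖) ^ 2 / (2 * r) := by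
      field_simp
      ring
    have : 0 ≤ (c - r * ‖x‖) ^ 2 / (2 * r) := by positivity
    linarith
  linarith

/-- The density `exp (-(R / 2 * ‖x‖ ^ 2 + W x))`. -/
noncomputable def gibbs (R : ℝ) (W : EuclideanSpace ℝ (Fin n) → ℝ)
    (x : EuclideanSpace ℝ (Fin n)) : ℝ := exp (-(R / 2 * ‖x‖ ^ 2 + W x))

lemma gibbs_pos (R : ℝ) (W : EuclideanSpace ℝ (Fin n) → ℝ) (x : EuclideanSpace ℝ (Fin n)) :
    0 < gibbs R W x := exp_pos _

lemma continuous_gibbs (R : ℝ) {W : EuclideanSpace ℝ (Fin n) → ℝ} (hW : Continuous W) :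
    Continuous (gibbs R W) := by unfold gibbs; fun_prop

variable {R B : ℝ} {W : EuclideanSpace ℝ (Fin n) → ℝ}

lemma gibbs_le (hW : ∀ x, W 0 - B * ‖x‖ ≤ W x) (x : EuclideanSpace ℝ (Fin n)) :
    gibbs R W x ≤ exp (-W 0) * exp (B * ‖x‖ - R / 2 * ‖x‖ ^ 2) := by
  rw [gibbs, ← exp_add]
  refine exp_le_exp.2 ?_
  linarith [hW x]

lemma integrable_mul_gibbs (hR : 0 < R) (hWc : Continuous W) (hW : ∀ x, W 0 - B * ‖x‖ ≤ W x)
    {F : EuclideanSpace ℝ (Fin n) → ℝ} (hF : Continuous F) {A c : ℝ}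
    (hFA : ∀ x, |F x| ≤ A * exp (c * ‖x‖)) : Integrable fun x => F x * gibbs R W x := by
  refine ((integrable_exp_linear_sub_sq (n := n) (half_pos hR) (c + B)).const_mul
    (A * exp (-W 0))).mono' (hF.mul (continuous_gibbs R hWc)).aestronglyMeasurable
    (Filter.Eventually.of_forall fun x => ?_)
  rw [norm_mul, Real.norm_eq_abs, Real.norm_of_nonneg (gibbs_pos R W x).le]
  refine (mul_le_mul (hFA x) (gibbs_le hW x) (gibbs_pos R W x).le
    ((abs_nonneg _).trans (hFA x))).trans (le_of_eq ?_)
  rw [show (c + B) * ‖x‖ - R / 2 * ‖x‖ ^ 2 = c * ‖x‖ + (B * ‖x‖ - R / 2 * ‖x‖ ^ 2) by ring,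
    exp_add]
  ring

lemma integrable_mul_gibbs_of_linear (hR : 0 < R) (hWc : Continuous W)
    (hW : ∀ x, W 0 - B * ‖x‖ ≤ W x)
    {F : EuclideanSpace ℝ (Fin n) → ℝ} (hF : Continuous F) {A c : ℝ}
    (hFA : ∀ x, |F x| ≤ A + c * ‖x‖) : Integrable fun x => F x * gibbs R W x := by
  refine integrable_mul_gibbs hR hWc hW hF (A := |A| + |c|) (c := 1) fun x => (hFA x).trans ?_
  have h1 : 1 ≤ exp (1 * ‖x‖) := one_le_exp (by positivity)
  have h2 : ‖x‖ ≤ exp (1 * ‖x‖) := by linarith [add_one_le_exp (1 * ‖x‖)]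
  rw [add_mul]
  refine add_le_add ((le_abs_self A).trans (le_mul_of_one_le_right (abs_nonneg _) h1)) ?_
  exact mul_le_mul (le_abs_self c) h2 (norm_nonneg _) (abs_nonneg _)

lemma integrable_gibbs (hR : 0 < R) (hWc : Continuous W) (hW : ∀ x, W 0 - B * ‖x‖ ≤ W x) :
    Integrable (gibbs R W) := by
  simpa using integrable_mul_gibbs_of_linear hR hWc hW (F := fun _ => 1) (A := 1) (c := 0)
    continuous_const (by simp)

lemma abs_exp_sub_one_sub_le (x : ℝ) : |exp x - 1 - x| ≤ x ^ 2 * exp |x| := by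
  have h := Complex.norm_exp_sub_sum_le_norm_mul_exp (x : ℂ) 2
  simp only [Finset.sum_range_succ, Finset.range_zero, Finset.sum_empty, pow_zero, pow_one,
    Nat.factorial_zero, Nat.factorial_one, Nat.cast_one, div_one, zero_add] at h
  rw [← Complex.ofReal_exp, ← Complex.ofReal_one, ← Complex.ofReal_add, ← Complex.ofReal_sub,
    Complex.norm_real, Complex.norm_real, Real.norm_eq_abs, Real.norm_eq_abs, sq_abs] at h
  rwa [sub_sub]

variable {Λ Λ₂ : ℝ}

lemma LipschitzFDeriv.sub_mul_norm_le (hW : LipschitzFDeriv B Λ W)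
    (x : EuclideanSpace ℝ (Fin n)) : W 0 - B * ‖x‖ ≤ W x := by
  have := abs_le.1 (hW.abs_sub_le 0 x)
  rw [sub_zero] at this
  linarith

/-- The derivative of `R / 2 * ‖x‖ ^ 2 + W x`. -/
noncomputable def potentialFDeriv (R : ℝ) (W : EuclideanSpace ℝ (Fin n) → ℝ)
    (x : EuclideanSpace ℝ (Fin n)) : EuclideanSpace ℝ (Fin n) →L[ℝ] ℝ :=
  R • innerSL ℝ x + fderiv ℝ W x

lemma LipschitzFDeriv.abs_potentialFDeriv_le (hW : LipschitzFDeriv B Λ W) (hR : 0 ≤ R)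
    (x e : EuclideanSpace ℝ (Fin n)) : |potentialFDeriv R W x e| ≤ (R * ‖x‖ + B) * ‖e‖ := by
  rw [potentialFDeriv, add_apply, smul_apply, smul_eq_mul, innerSL_apply_apply, add_mul]
  refine (abs_add_le _ _).trans (add_le_add ?_ ?_)
  · rw [abs_mul, abs_of_nonneg hR, mul_assoc]
    exact mul_le_mul_of_nonneg_left (abs_real_inner_le_norm x e) hR
  · exact (fderiv ℝ W x).le_of_opNorm_le (hW.norm_fderiv_le x) e

lemma LipschitzFDeriv.abs_gibbs_sub_le (hW : LipschitzFDeriv B Λ W) (hR : 0 ≤ R) {δ : ℝ}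
    (hδ : 0 ≤ δ) (hδ1 : δ ≤ 1) (x : EuclideanSpace ℝ (Fin n)) {e : EuclideanSpace ℝ (Fin n)}
    (he : ‖e‖ = 1) :
    |gibbs R W x - gibbs R W (x + δ • e) - δ * potentialFDeriv R W x e * gibbs R W x|
      ≤ δ ^ 2 * (3 * exp (2 * (R * ‖x‖ + B + R / 2 + Λ)) * gibbs R W x) := by
  have hB := hW.nonneg_left
  have hΛ := hW.nonneg
  set k := R * ‖x‖ + B + R / 2 + Λ with hk
  have hk0 : 0 ≤ k := by positivity
  set u := potentialFDeriv R W x e with hu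
  have hu' : |u| ≤ R * ‖x‖ + B := by simpa [he] using hW.abs_potentialFDeriv_le hR x e
  set t := R / 2 * ‖x‖ ^ 2 + W x - (R / 2 * ‖x + δ • e‖ ^ 2 + W (x + δ • e)) with ht
  have hexp : gibbs R W (x + δ • e) = exp t * gibbs R W x := by
    rw [gibbs, gibbs, ← exp_add, ht]
    congr 1
    ring
  have h1 : |t + δ * u| ≤ (R / 2 + Λ) * δ ^ 2 := by
    have h2 := hW.abs_taylor_le x (x + δ • e)
    rw [add_sub_cancel_left, norm_smul, he, mul_one, Real.norm_of_nonneg hδ, map_smul,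
      smul_eq_mul] at h2
    have h3 : t + δ * u = -(R / 2) * δ ^ 2 - (W (x + δ • e) - W x - δ * fderiv ℝ W x e) := by
      rw [ht, hu, potentialFDeriv, add_apply, smul_apply, smul_eq_mul, innerSL_apply_apply,
        norm_add_sq_real, norm_smul, he, Real.norm_of_nonneg hδ, inner_smul_right]
      ring
    rw [h3, add_mul]
    refine (abs_sub _ _).trans (add_le_add (le_of_eq ?_) h2)
    rw [neg_mul, abs_neg, abs_of_nonneg (by positivity)]
  have hδ2 : δ ^ 2 ≤ δ := by nlinarith
  have h4 : |t| ≤ δ * k := by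
    have h5 : |t| ≤ |t + δ * u| + |δ * u| := by
      simpa using abs_sub (t + δ * u) (δ * u)
    have h6 : |δ * u| ≤ δ * (R * ‖x‖ + B) := by
      rw [abs_mul, abs_of_nonneg hδ]
      gcongr
    have h7 : (R / 2 + Λ) * δ ^ 2 ≤ (R / 2 + Λ) * δ := by gcongr
    rw [hk]
    linarith
  have h8 : |exp t - 1 - t| ≤ δ ^ 2 * (k ^ 2 * exp k) := by
    refine (abs_exp_sub_one_sub_le t).trans ?_
    rw [← sq_abs t, ← mul_assoc, ← mul_pow]
    have : δ * k ≤ k := mul_le_of_le_one_left hk0 hδ1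
    gcongr
    exact h4.trans this
  have h9 : k + k ^ 2 * exp k ≤ 3 * exp (2 * k) := by
    have e1 : exp (2 * k) = exp k * exp k := by rw [two_mul, exp_add]
    have e2 := Real.quadratic_le_exp_of_nonneg hk0
    have e3 : 1 ≤ exp k := one_le_exp hk0
    rw [e1]
    nlinarith
  have h10 : gibbs R W x - gibbs R W (x + δ • e) - δ * u * gibbs R W x
      = -((exp t - 1 - t) + (t + δ * u)) * gibbs R W x := by
    rw [hexp]
    ring
  rw [h10, abs_mul, abs_neg, abs_of_pos (gibbs_pos R W x), ← mul_assoc]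
  refine mul_le_mul_of_nonneg_right ((abs_add_le _ _).trans ?_) (gibbs_pos R W x).le
  have h11 : (R / 2 + Λ) * δ ^ 2 ≤ δ ^ 2 * k := by
    rw [mul_comm]
    have : R / 2 + Λ ≤ k := by rw [hk]; nlinarith [mul_nonneg hR (norm_nonneg x)]
    gcongr
  nlinarith [mul_le_mul_of_nonneg_left h9 (sq_nonneg δ)]

end Gibbs

section Invariance

variable {n : ℕ} {R B Λ Λ₂ L₁ L₂ : ℝ} {W φ : EuclideanSpace ℝ (Fin n) → ℝ}

lemma LipschitzFDeriv.continuous_fderiv {E : Type*} [NormedAddCommGroup E] [NormedSpace ℝ E]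
    {φ : E → ℝ} (h : LipschitzFDeriv L₁ L₂ φ) : Continuous (fderiv ℝ φ) := by
  refine (LipschitzWith.of_dist_le_mul (K := L₂.toNNReal) fun x y => ?_).continuous
  rw [dist_eq_norm, dist_eq_norm, Real.coe_toNNReal _ h.nonneg]
  exact h.norm_fderiv_sub_le x y

lemma LipschitzFDeriv.continuous {E : Type*} [NormedAddCommGroup E] [NormedSpace ℝ E]
    {φ : E → ℝ} (h : LipschitzFDeriv L₁ L₂ φ) : Continuous φ := h.differentiable.continuous

lemma LipschitzFDeriv.abs_le {E : Type*} [NormedAddCommGroup E] [NormedSpace ℝ E]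
    {φ : E → ℝ} (h : LipschitzFDeriv L₁ L₂ φ) (x : E) : |φ x| ≤ |φ 0| + L₁ * ‖x‖ := by
  have h1 := h.abs_sub_le 0 x
  rw [sub_zero] at h1
  have h2 := abs_add_le (φ x - φ 0) (φ 0)
  rw [sub_add_cancel] at h2
  linarith

lemma continuous_potentialFDeriv (hW : LipschitzFDeriv B Λ W) (R : ℝ) :
    Continuous (potentialFDeriv R W) := by
  have := hW.continuous_fderiv
  unfold potentialFDeriv
  fun_prop

/-- A weight dominating the error terms of the random walk. -/
noncomputable def errorWeight (R B Λ : ℝ) (x : EuclideanSpace ℝ (Fin n)) : ℝ :=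
  3 * exp (2 * (R * ‖x‖ + B + R / 2 + Λ))

lemma integrable_errorWeight_mul_gibbs (hR : 0 < R) (hW : LipschitzFDeriv B Λ W) :
    Integrable fun x => errorWeight R B Λ x * gibbs R W x := by
  refine integrable_mul_gibbs hR hW.continuous hW.sub_mul_norm_le
    (A := 3 * exp (2 * (B + R / 2 + Λ))) (c := 2 * R) (by unfold errorWeight; fun_prop)
    fun x => le_of_eq ?_
  rw [errorWeight, abs_of_pos (by positivity), mul_assoc 3, ← exp_add]
  ring_nf

lemma sq_add_self_le_errorWeight {c : ℝ} (hR : 0 ≤ R) (hW : LipschitzFDeriv B Λ W)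
    (x : EuclideanSpace ℝ (Fin n)) (hc0 : 0 ≤ c) (hc : c ≤ R * ‖x‖ + B) :
    c ^ 2 + c ≤ errorWeight R B Λ x := by
  have hB := hW.nonneg_left
  have hΛ := hW.nonneg
  set k := R * ‖x‖ + B + R / 2 + Λ with hk
  have hck : c ≤ k := by rw [hk]; linarith
  have hk0 : 0 ≤ k := hc0.trans hck
  have e1 : exp (2 * k) = exp k * exp k := by rw [two_mul, exp_add]
  have e2 := Real.quadratic_le_exp_of_nonneg hk0
  have e3 : 1 ≤ exp k := one_le_exp hk0
  rw [errorWeight, ← hk, e1]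
  nlinarith

lemma errorWeight_nonneg (R B Λ : ℝ) (x : EuclideanSpace ℝ (Fin n)) :
    0 ≤ errorWeight R B Λ x := by unfold errorWeight; positivity

lemma LipschitzFDeriv.integrable_comp_mul_gibbs (hφ : LipschitzFDeriv L₁ L₂ φ) (hR : 0 < R)
    (hW : LipschitzFDeriv B Λ W) {T : EuclideanSpace ℝ (Fin n) → EuclideanSpace ℝ (Fin n)}
    (hT : Continuous T) {A c : ℝ} (hTA : ∀ x, ‖T x‖ ≤ A + c * ‖x‖) :
    Integrable fun x => φ (T x) * gibbs R W x := by
  have hL := hφ.nonneg_left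
  refine integrable_mul_gibbs_of_linear hR hW.continuous hW.sub_mul_norm_le
    (A := |φ 0| + L₁ * A) (c := L₁ * c) (hφ.continuous.comp hT) fun x => (hφ.abs_le _).trans ?_
  linarith [mul_le_mul_of_nonneg_left (hTA x) hL]

lemma LipschitzFDeriv.integrable_second_difference (hφ : LipschitzFDeriv L₁ L₂ φ)
    (hR : 0 < R) (hW : LipschitzFDeriv B Λ W) {δ : ℝ} (hδ : 0 ≤ δ) (hδ1 : δ ≤ 1)
    {e : EuclideanSpace ℝ (Fin n)} (he : ‖e‖ = 1) :
    Integrable (fun x => (φ (x + δ • e) + φ (x - δ • e) - 2 * φ x) * gibbs R W x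
        - δ ^ 2 * (fderiv ℝ φ x e * potentialFDeriv R W x e * gibbs R W x)) ∧
    |∫ x, ((φ (x + δ • e) + φ (x - δ • e) - 2 * φ x) * gibbs R W x
        - δ ^ 2 * (fderiv ℝ φ x e * potentialFDeriv R W x e * gibbs R W x))|
      ≤ (L₁ + L₂) * δ ^ 3 * ∫ x, errorWeight R B Λ x * gibbs R W x := by
  have hL₁ := hφ.nonneg_left
  have hL₂ := hφ.nonneg
  have hB := hW.nonneg_left
  set f := gibbs R W with hf
  have hnδ : ‖δ • e‖ = δ := by rw [norm_smul, he, mul_one, Real.norm_of_nonneg hδ]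
  have i0 : Integrable fun x => φ x * f x :=
    hφ.integrable_comp_mul_gibbs hR hW continuous_id (A := 0) (c := 1) (by simp)
  have i1 : Integrable fun x => φ (x + δ • e) * f x :=
    hφ.integrable_comp_mul_gibbs hR hW (by fun_prop) (A := δ) (c := 1)
      fun x => (norm_add_le _ _).trans (by rw [hnδ]; linarith)
  have i2 : Integrable fun x => φ (x - δ • e) * f x :=
    hφ.integrable_comp_mul_gibbs hR hW (by fun_prop) (A := δ) (c := 1)
      fun x => (norm_sub_le _ _).trans (by rw [hnδ]; linarith)
  have i3 : Integrable fun x => φ x * f (x + δ • e) := by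
    have := i2.comp_add_right (δ • e)
    simpa using this
  have i4 : Integrable fun x => φ (x + δ • e) * f (x + δ • e) := i0.comp_add_right (δ • e)
  have i5 : Integrable fun x => fderiv ℝ φ x e * potentialFDeriv R W x e * f x := by
    have h1 := hφ.continuous_fderiv
    have h2 := continuous_potentialFDeriv hW R
    refine integrable_mul_gibbs_of_linear hR hW.continuous hW.sub_mul_norm_le
      (A := L₁ * B) (c := L₁ * R) (by fun_prop) fun x => ?_
    rw [abs_mul]
    have h3 : |fderiv ℝ φ x e| ≤ L₁ := by
      simpa [he] using (fderiv ℝ φ x).le_of_opNorm_le (hφ.norm_fderiv_le x) e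
    have h4 : |potentialFDeriv R W x e| ≤ R * ‖x‖ + B := by
      simpa [he] using hW.abs_potentialFDeriv_le hR.le x e
    calc _ ≤ L₁ * (R * ‖x‖ + B) := by gcongr
      _ = _ := by ring
  have i6 := i5.const_mul (δ ^ 2)
  have i7 : Integrable fun x => (φ (x + δ • e) + φ (x - δ • e) - 2 * φ x) * f x := by
    refine ((i1.add i2).sub (i0.const_mul 2)).congr (Filter.Eventually.of_forall fun x => ?_)
    simp only [Pi.sub_apply, Pi.add_apply]
    ring
  refine ⟨i7.sub i6, ?_⟩
  have key : ∫ x, ((φ (x + δ • e) + φ (x - δ • e) - 2 * φ x) * f x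
        - δ ^ 2 * (fderiv ℝ φ x e * potentialFDeriv R W x e * f x))
      = ∫ x, ((φ (x + δ • e) - φ x) * (f x - f (x + δ • e))
        - δ ^ 2 * (fderiv ℝ φ x e * potentialFDeriv R W x e * f x)) := by
    have t1 : ∫ x, (φ x * f x - φ (x - δ • e) * f x)
        = ∫ x, (φ (x + δ • e) * f (x + δ • e) - φ x * f (x + δ • e)) := by
      rw [← integral_add_right_eq_self (fun x => φ x * f x - φ (x - δ • e) * f x) (δ • e)]
      simp
    rw [integral_sub i7 i6, integral_sub _ i6]
    · congr 1
      have e1 : ∀ x, (φ (x + δ • e) + φ (x - δ • e) - 2 * φ x) * f x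
          = (φ (x + δ • e) * f x - φ x * f x) - (φ x * f x - φ (x - δ • e) * f x) := fun x => by
        ring
      have e2 : ∀ x, (φ (x + δ • e) - φ x) * (f x - f (x + δ • e)) =
          (φ (x + δ • e) * f x - φ x * f x)
            - (φ (x + δ • e) * f (x + δ • e) - φ x * f (x + δ • e)) := fun x => by ring
      simp_rw [e1, e2]
      have j1 : Integrable fun x => φ (x + δ • e) * f x - φ x * f x := i1.sub i0
      have j2 : Integrable fun x => φ x * f x - φ (x - δ • e) * f x := i0.sub i2
      have j3 : Integrable fun x => φ (x + δ • e) * f (x + δ • e) - φ x * f (x + δ • e) := i4.sub i3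
      rw [integral_sub j1 j2, integral_sub j1 j3, t1]
    · refine ((i1.sub i0).sub (i4.sub i3)).congr (Filter.Eventually.of_forall fun x => ?_)
      simp only [Pi.sub_apply]
      ring
  rw [key, ← integral_const_mul, ← Real.norm_eq_abs]
  refine norm_integral_le_of_norm_le ((integrable_errorWeight_mul_gibbs hR hW).const_mul _)
    (Filter.Eventually.of_forall fun x => ?_)
  rw [Real.norm_eq_abs]
  set D := fderiv ℝ φ x e
  set u := potentialFDeriv R W x e
  set S := errorWeight R B Λ x with hS
  have hf0 : 0 < f x := gibbs_pos R W x
  have a1 : |φ (x + δ • e) - φ x| ≤ L₁ * δ := by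
    simpa [hnδ] using hφ.abs_sub_le x (x + δ • e)
  have a2 : |φ (x + δ • e) - φ x - δ * D| ≤ L₂ * δ ^ 2 := by
    simpa [hnδ] using hφ.abs_taylor_le x (x + δ • e)
  have a3 : |f x - f (x + δ • e) - δ * u * f x| ≤ δ ^ 2 * (S * f x) :=
    hW.abs_gibbs_sub_le hR.le hδ hδ1 x he
  have a4 : |u| ≤ S := by
    have h4 : |u| ≤ R * ‖x‖ + B := by
      simpa [he] using hW.abs_potentialFDeriv_le hR.le x e
    linarith [sq_add_self_le_errorWeight hR.le hW x (abs_nonneg u) h4, sq_nonneg |u|]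
  have e3 : (φ (x + δ • e) - φ x) * (f x - f (x + δ • e)) - δ ^ 2 * (D * u * f x)
      = (φ (x + δ • e) - φ x) * (f x - f (x + δ • e) - δ * u * f x)
        + (φ (x + δ • e) - φ x - δ * D) * (δ * u * f x) := by ring
  rw [e3]
  refine (abs_add_le _ _).trans ?_
  rw [abs_mul, abs_mul, abs_mul (δ * u), abs_mul δ u, abs_of_nonneg hδ, abs_of_pos hf0]
  calc _ ≤ (L₁ * δ) * (δ ^ 2 * (S * f x)) + (L₂ * δ ^ 2) * (δ * S * f x) := by gcongr
    _ = _ := by ring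

lemma TameConvex.abs_integral_walkStep_sub_le (hW : TameConvex B Λ Λ₂ W) (hn : 0 < n)
    (hR : 0 < R) (hφ : LipschitzFDeriv L₁ L₂ φ) {h δ : ℝ} (hh : 0 ≤ h) (hδ : 0 ≤ δ)
    (hδ1 : δ ≤ 1) (hδh : δ ^ 2 = 2 * n * h) :
    |(∫ x, walkStep (eulerStep R h W) (noise n δ) φ x * gibbs R W x) - ∫ x, φ x * gibbs R W x|
      ≤ 2 * (L₁ + L₂) * δ ^ 3 * ∫ x, errorWeight R B Λ x * gibbs R W x := by
  have : Nonempty (Fin n) := ⟨⟨0, hn⟩⟩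
  have hn' : (0 : ℝ) < n := by exact_mod_cast hn
  have hL₁ := hφ.nonneg_left
  have hL₂ := hφ.nonneg
  have hWl := hW.lipschitzFDeriv
  have hB := hWl.nonneg_left
  set f := gibbs R W with hf
  set T := eulerStep R h W with hT
  have hTc : Continuous T := (hW.differentiable_eulerStep R h).continuous
  have hTx : ∀ x, ‖T x - x‖ ≤ h * (R * ‖x‖ + B) := hW.norm_eulerStep_sub_self_le hR.le hh
  have hhδ : h ≤ δ ^ 2 := by
    rw [hδh]
    have : (1 : ℝ) ≤ n := by exact_mod_cast hn
    nlinarith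
  have i0 : Integrable fun x => φ x * f x :=
    hφ.integrable_comp_mul_gibbs hR hWl continuous_id (A := 0) (c := 1) (by simp)
  have iQ : Integrable fun x => walkStep T (noise n δ) φ x * f x := by
    have : (fun x => walkStep T (noise n δ) φ x * f x) = fun x =>
        (Fintype.card (Fin n × Bool) : ℝ)⁻¹ * ∑ j, φ (T x + noise n δ j) * f x := by
      ext x
      rw [walkStep, famMean, smul_eq_mul, mul_assoc, Finset.sum_mul]
    rw [this]
    refine (integrable_finsetSum _ fun j _ => ?_).const_mul _
    refine hφ.integrable_comp_mul_gibbs hR hWl (by fun_prop) (A := h * B + δ) (c := 1 + h * R)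
      fun x => (norm_add_le _ _).trans ?_
    rw [norm_noise hδ]
    have := norm_add_le (T x - x) x
    rw [sub_add_cancel] at this
    linarith [hTx x]
  set G : Fin n → EuclideanSpace ℝ (Fin n) → ℝ := fun i x =>
    (φ (x + δ • EuclideanSpace.single i 1) + φ (x - δ • EuclideanSpace.single i 1) - 2 * φ x) * f x
      - δ ^ 2 * (fderiv ℝ φ x (EuclideanSpace.single i 1)
        * potentialFDeriv R W x (EuclideanSpace.single i 1) * f x) with hG
  have hdrift : ∀ x, fderiv ℝ φ x (T x - x) = -(h * ∑ i, fderiv ℝ φ x (EuclideanSpace.single i 1)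
      * potentialFDeriv R W x (EuclideanSpace.single i 1)) := fun x => by
    have e1 : T x - x = -(h • sharp (potentialFDeriv R W x)) := by
      have e2 : sharp (innerSL ℝ x) = x := ext_inner_right ℝ fun w => by
        rw [inner_sharp, innerSL_apply_apply]
      rw [hT, eulerStep, potentialFDeriv, map_add, map_smul, e2, sub_sub_cancel_left]
    rw [e1, map_neg, map_smul, smul_eq_mul, sharp]
    simp [mul_comm]
  have hmean : ∀ x, (famMean fun j => φ (x + noise n δ j)) - φ x = (2 * n : ℝ)⁻¹ *
      ∑ i, (φ (x + δ • EuclideanSpace.single i 1) + φ (x - δ • EuclideanSpace.single i 1)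
        - 2 * φ x) := fun x => by
    rw [famMean_fin_bool, Finset.sum_sub_distrib, Finset.sum_const, Finset.card_univ,
      Fintype.card_fin, smul_eq_mul, mul_sub, nsmul_eq_mul]
    simp only [noise, if_true, Bool.false_eq_true, if_false, neg_smul, ← sub_eq_add_neg]
    field_simp
  have hGsum : ∀ x, ((famMean fun j => φ (x + noise n δ j)) - φ x + fderiv ℝ φ x (T x - x)) * f x
      = (2 * n : ℝ)⁻¹ * ∑ i, G i x := fun x => by
    simp only [hmean, hdrift, hG]
    rw [Finset.mul_sum, Finset.mul_sum, Finset.mul_sum, ← Finset.sum_neg_distrib,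
      ← Finset.sum_add_distrib, Finset.sum_mul]
    refine Finset.sum_congr rfl fun i _ => ?_
    rw [hδh]
    field_simp
    ring
  have hGi : ∀ i, Integrable (G i) ∧ |∫ x, G i x| ≤
      (L₁ + L₂) * δ ^ 3 * ∫ x, errorWeight R B Λ x * gibbs R W x :=
    fun i => hφ.integrable_second_difference hR hWl hδ hδ1 (by simp)
  set I := ∫ x, errorWeight R B Λ x * gibbs R W x with hI
  have iS := integrable_errorWeight_mul_gibbs hR hWl
  have iG : Integrable fun x => (2 * n : ℝ)⁻¹ * ∑ i, G i x :=
    (integrable_finsetSum _ fun i _ => (hGi i).1).const_mul _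
  have e1 : (∫ x, walkStep T (noise n δ) φ x * f x) - ∫ x, φ x * f x
      = (∫ x, (walkStep T (noise n δ) φ x * f x - φ x * f x - (2 * n : ℝ)⁻¹ * ∑ i, G i x))
        + (2 * n : ℝ)⁻¹ * ∑ i, ∫ x, G i x := by
    have iD : Integrable fun x => walkStep T (noise n δ) φ x * f x - φ x * f x := iQ.sub i0
    rw [integral_sub iD iG, integral_sub iQ i0, integral_const_mul,
      integral_finsetSum _ fun i _ => (hGi i).1, sub_add_cancel]
  have h1 : |(2 * n : ℝ)⁻¹ * ∑ i, ∫ x, G i x| ≤ (L₁ + L₂) * δ ^ 3 * I := by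
    rw [abs_mul, abs_of_nonneg (by positivity)]
    have h2 : |∑ i, ∫ x, G i x| ≤ n * ((L₁ + L₂) * δ ^ 3 * I) := by
      refine (Finset.abs_sum_le_sum_abs _ _).trans
        ((Finset.sum_le_sum fun i _ => (hGi i).2).trans (le_of_eq ?_))
      simp
    have h3 : 0 ≤ (L₁ + L₂) * δ ^ 3 * I :=
      (abs_nonneg _).trans (hGi ⟨0, hn⟩).2
    calc _ ≤ (2 * n : ℝ)⁻¹ * (n * ((L₁ + L₂) * δ ^ 3 * I)) := by gcongr
      _ = ((L₁ + L₂) * δ ^ 3 * I) / 2 := by field_simp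
      _ ≤ _ := by linarith
  have h2 : |∫ x, (walkStep T (noise n δ) φ x * f x - φ x * f x - (2 * n : ℝ)⁻¹ * ∑ i, G i x)|
      ≤ L₂ * δ ^ 3 * I := by
    rw [hI, ← integral_const_mul, ← Real.norm_eq_abs]
    refine norm_integral_le_of_norm_le (iS.const_mul _) (Filter.Eventually.of_forall fun x => ?_)
    have e2 : walkStep T (noise n δ) φ x * f x - φ x * f x - (2 * n : ℝ)⁻¹ * ∑ i, G i x
        = (famMean fun j => φ (T x + noise n δ j) - φ (x + noise n δ j)
          - fderiv ℝ φ x (T x - x)) * f x := by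
      rw [← hGsum, famMean_sub, famMean_sub, famMean_const, walkStep]
      ring
    rw [e2, Real.norm_eq_abs, abs_mul, abs_of_pos (gibbs_pos R W x), ← mul_assoc]
    refine mul_le_mul_of_nonneg_right (norm_famMean_le (u := fun j => φ (T x + noise n δ j)
      - φ (x + noise n δ j) - fderiv ℝ φ x (T x - x)) fun j => ?_) (gibbs_pos R W x).le
    set v := noise n δ j with hv
    have hvδ : ‖v‖ = δ := norm_noise hδ j
    set c := R * ‖x‖ + B with hc
    have hc0 : 0 ≤ c := by positivity
    have a1 := hφ.abs_taylor_le (x + v) (T x + v)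
    rw [add_sub_add_right_eq_sub] at a1
    have a2 : |(fderiv ℝ φ (x + v) - fderiv ℝ φ x) (T x - x)| ≤ L₂ * δ * ‖T x - x‖ := by
      refine (fderiv ℝ φ (x + v) - fderiv ℝ φ x).le_of_opNorm_le ?_ _
      simpa [hvδ] using hφ.norm_fderiv_sub_le (x + v) x
    have a3 : ‖T x - x‖ ≤ δ ^ 2 * c := (hTx x).trans (by gcongr)
    have a4 := sq_add_self_le_errorWeight hR.le hWl x hc0 le_rfl
    rw [Real.norm_eq_abs]
    have e3 : φ (T x + v) - φ (x + v) - fderiv ℝ φ x (T x - x)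
        = (φ (T x + v) - φ (x + v) - fderiv ℝ φ (x + v) (T x - x))
          + (fderiv ℝ φ (x + v) - fderiv ℝ φ x) (T x - x) := by
      rw [sub_apply]; ring
    rw [e3]
    refine (abs_add_le _ _).trans ((add_le_add a1 a2).trans ?_)
    have h43 : δ ^ 4 ≤ δ ^ 3 := pow_le_pow_of_le_one hδ hδ1 (by norm_num)
    calc _ ≤ L₂ * (δ ^ 2 * c) ^ 2 + L₂ * δ * (δ ^ 2 * c) := by gcongr
      _ = L₂ * (δ ^ 4 * c ^ 2 + δ ^ 3 * c) := by ring
      _ ≤ L₂ * (δ ^ 3 * c ^ 2 + δ ^ 3 * c) := by gcongr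
      _ = L₂ * δ ^ 3 * (c ^ 2 + c) := by ring
      _ ≤ _ := by gcongr
  have hI0 : 0 ≤ I := integral_nonneg fun x =>
    mul_nonneg (errorWeight_nonneg _ _ _ _) (gibbs_pos R W x).le
  rw [e1]
  refine (abs_add_le _ _).trans ((add_le_add h2 h1).trans ?_)
  have : 0 ≤ L₁ * δ ^ 3 * I := by positivity
  linarith

end Invariance

section Convolution

open scoped Convolution NNReal

lemma ConvexOn.fderiv_apply_sub_le {E : Type*} [NormedAddCommGroup E] [NormedSpace ℝ E] {V : E → ℝ}
    (hV : ConvexOn ℝ Set.univ V) {x : E} (hd : DifferentiableAt ℝ V x) (y : E) :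
    fderiv ℝ V x (y - x) ≤ V y - V x := by
  have h1 : ConvexOn ℝ Set.univ (V ∘ AffineMap.lineMap (k := ℝ) x y) := hV.comp_affineMap _
  have h2 : HasDerivAt (V ∘ AffineMap.lineMap (k := ℝ) x y) (fderiv ℝ V x (y - x)) 0 := by
    refine HasFDerivAt.comp_hasDerivAt (0 : ℝ) ?_ AffineMap.hasDerivAt_lineMap
    simpa using hd.hasFDerivAt
  simpa [slope_def_field] using
    h1.le_slope_of_hasDerivAt (Set.mem_univ 0) (Set.mem_univ 1) zero_lt_one h2

variable {E F : Type*} [NormedAddCommGroup E] [InnerProductSpace ℝ E] [FiniteDimensional ℝ E]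
  [MeasurableSpace E] [BorelSpace E] [NormedAddCommGroup F] [NormedSpace ℝ F]

lemma exists_norm_convolution_sub_le {F' : Type*} [NormedAddCommGroup F'] [NormedSpace ℝ F']
    (L : F →L[ℝ] ℝ →L[ℝ] F') {ψ : E → F} (hψ : HasCompactSupport ψ) (hψc : Continuous ψ)
    {V : E → ℝ} {K : ℝ≥0} (hV : LipschitzWith K V) :
    ∃ Λ : ℝ, 0 ≤ Λ ∧ ∀ x y,
      ‖(ψ ⋆[L, volume] V) x - (ψ ⋆[L, volume] V) y‖ ≤ Λ * ‖x - y‖ := by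
  refine ⟨∫ t, ‖L‖ * ‖ψ t‖ * K, integral_nonneg fun t => by positivity, fun x y => ?_⟩
  have hVl : LocallyIntegrable V (volume : Measure E) := hV.continuous.locallyIntegrable
  have hx := hψ.convolutionExists_left L hψc hVl x
  have hy := hψ.convolutionExists_left L hψc hVl y
  rw [convolution_def, convolution_def, ← integral_sub hx hy, ← integral_mul_const]
  have hi : Integrable ψ := hψc.integrable_of_hasCompactSupport hψ
  refine norm_integral_le_of_norm_le (((hi.norm.const_mul _).mul_const _).mul_const _)
    (Filter.Eventually.of_forall fun t => ?_)
  rw [← map_sub]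
  refine (L.le_opNorm₂ _ _).trans ?_
  rw [mul_assoc (_ * _)]
  gcongr
  have := hV.dist_le_mul (x - t) (y - t)
  rwa [dist_eq_norm, dist_eq_norm, sub_sub_sub_cancel_right] at this

lemma LipschitzWith.exists_norm_fderiv_convolution_sub_le {F' : Type*} [NormedAddCommGroup F']
    [NormedSpace ℝ F'] (L : F →L[ℝ] ℝ →L[ℝ] F') {V : E → ℝ} {K : ℝ≥0} (hV : LipschitzWith K V)
    {ψ : E → F} (hψ : HasCompactSupport ψ) (hψc : ContDiff ℝ 1 ψ) :
    Differentiable ℝ (ψ ⋆[L, volume] V) ∧ ∃ Λ : ℝ, 0 ≤ Λ ∧ ∀ x y,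
      ‖fderiv ℝ (ψ ⋆[L, volume] V) x - fderiv ℝ (ψ ⋆[L, volume] V) y‖ ≤ Λ * ‖x - y‖ := by
  have h := fun x => hψ.hasFDerivAt_convolution_left L hψc
    (hV.continuous.locallyIntegrable (μ := (volume : Measure E))) x
  have h' := funext fun x => (h x).fderiv
  refine ⟨fun x => (h x).differentiableAt, ?_⟩
  rw [h']
  exact exists_norm_convolution_sub_le _ (hψ.fderiv ℝ) (hψc.continuous_fderiv one_ne_zero) hV

/-- Mollification of a Lipschitz function. -/
lemma LipschitzWith.exists_smooth_approx {V : E → ℝ} {K : ℝ≥0} (hV : LipschitzWith K V) {η : ℝ}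
    (hη : 0 < η) : ∃ (φ : E → ℝ) (Λ Λ₂ : ℝ), LipschitzFDeriv K Λ φ ∧ Differentiable ℝ (fderiv ℝ φ) ∧
      (∀ x y, ‖fderiv ℝ (fderiv ℝ φ) x - fderiv ℝ (fderiv ℝ φ) y‖ ≤ Λ₂ * ‖x - y‖) ∧ 0 ≤ Λ₂ ∧
      (∀ x, |φ x - V x| ≤ η) ∧ (ConvexOn ℝ Set.univ V → ConvexOn ℝ Set.univ φ) := by
  have hVl : LocallyIntegrable V (volume : Measure E) := hV.continuous.locallyIntegrable
  set r := η / (K + 1) with hr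
  have hr0 : 0 < r := by positivity
  let ρ : ContDiffBump (0 : E) := ⟨r / 2, r, by positivity, by linarith⟩
  set w := ρ.normed volume with hw
  have hwc : HasCompactSupport w := ρ.hasCompactSupport_normed
  have hws : ContDiff ℝ 2 w := ρ.contDiff_normed
  have hwi : Integrable w := ρ.integrable_normed
  set A := ContinuousLinearMap.lsmul ℝ ℝ (E := ℝ) with hA
  set φ := w ⋆[A, volume] V with hφ
  have hex : ∀ x, Integrable fun t => w t * V (x - t) := fun x =>
    hwc.convolutionExists_left A hws.continuous hVl x
  have hφx : ∀ x, φ x = ∫ t, w t * V (x - t) := fun x => rfl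
  have hw0 : ∀ t, 0 ≤ w t := ρ.nonneg_normed
  have hw1 : ∫ t, w t = 1 := ρ.integral_normed
  have hφ' : fderiv ℝ φ = fderiv ℝ w ⋆[A.precompL E, volume] V := funext fun x =>
    (hwc.hasFDerivAt_convolution_left A (hws.of_le one_le_two) hVl x).fderiv
  have hws' : ContDiff ℝ 1 (fderiv ℝ w) := hws.fderiv_right (m := 1) (by norm_num)
  obtain ⟨hφd, Λ, hΛ0, hΛ⟩ :=
    hV.exists_norm_fderiv_convolution_sub_le A hwc (hws.of_le one_le_two)
  obtain ⟨hφd', Λ₂, hΛ₂0, hΛ₂⟩ :=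
    hV.exists_norm_fderiv_convolution_sub_le (A.precompL E) (hwc.fderiv ℝ) hws'
  rw [← hφ'] at hφd' hΛ₂
  have hlip : LipschitzWith K φ := LipschitzWith.of_dist_le_mul fun x y => by
    rw [dist_eq_norm, dist_eq_norm, hφx, hφx, ← integral_sub (hex x) (hex y)]
    have h1 : ∫ t, w t * (K * ‖x - y‖) = K * ‖x - y‖ := by
      rw [integral_mul_const, hw1, one_mul]
    rw [← h1]
    refine norm_integral_le_of_norm_le (hwi.mul_const _) (Filter.Eventually.of_forall fun t => ?_)
    rw [← mul_sub, norm_mul, Real.norm_of_nonneg (hw0 t)]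
    have := hV.dist_le_mul (x - t) (y - t)
    rw [dist_eq_norm, dist_eq_norm, sub_sub_sub_cancel_right] at this
    exact mul_le_mul_of_nonneg_left this (hw0 t)
  refine ⟨φ, Λ, Λ₂, ⟨hφd, fun x => norm_fderiv_le_of_lipschitz ℝ hlip, hΛ, hΛ0⟩, hφd', hΛ₂, hΛ₂0,
    fun x => ?_, fun hc => ?_⟩
  · rw [← Real.norm_eq_abs, ← dist_eq_norm]
    refine ρ.dist_normed_convolution_le hV.continuous.aestronglyMeasurable fun y hy => ?_
    refine (hV.dist_le_mul y x).trans ?_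
    have h2 : dist y x ≤ r := (Metric.mem_ball.1 hy).le
    calc (K : ℝ) * dist y x ≤ K * r := by gcongr
      _ ≤ (K + 1) * r := by nlinarith
      _ = η := by rw [hr]; field_simp
  · refine ⟨convex_univ, fun x _ y _ a b ha hb hab => ?_⟩
    rw [hφx, hφx, hφx, smul_eq_mul, smul_eq_mul, ← integral_const_mul, ← integral_const_mul,
      ← integral_add ((hex x).const_mul a) ((hex y).const_mul b)]
    refine integral_mono (hex _) (((hex x).const_mul a).add ((hex y).const_mul b)) fun t => ?_
    have h1 : a • x + b • y - t = a • (x - t) + b • (y - t) := by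
      have : t = (a + b) • t := by rw [hab, one_smul]
      conv_lhs => rw [this]
      module
    have h2 := hc.2 (Set.mem_univ (x - t)) (Set.mem_univ (y - t)) ha hb hab
    rw [smul_eq_mul, smul_eq_mul] at h2
    beta_reduce
    rw [h1]
    nlinarith [mul_le_mul_of_nonneg_left h2 (hw0 t)]

end Convolution

section Iteration

/-- Admissible parameters of the Euler scheme: time step `h`, noise size `δ`, contraction
rate `κ`. -/
structure StepSize (n : ℕ) (R Λ h δ κ : ℝ) : Prop where
  nonneg : 0 ≤ h
  noise_nonneg : 0 ≤ δ
  noise_le_one : δ ≤ 1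
  noise_sq : δ ^ 2 = 2 * n * h
  mul_le_one : h * R ≤ 1
  rate_nonneg : 0 ≤ κ
  rate_le_one : κ ≤ 1
  rate_sq : κ ^ 2 = (1 - h * R) ^ 2 + h ^ 2 * Λ ^ 2

variable {n : ℕ} {R B Λ Λ₂ L₁ L₂ h δ κ a b : ℝ} {W φ g : EuclideanSpace ℝ (Fin n) → ℝ}

lemma LipschitzFDeriv.iterate_walkStep [NeZero n] (hφ : LipschitzFDeriv L₁ L₂ φ)
    (hW : TameConvex B Λ Λ₂ W) (hs : StepSize n R Λ h δ κ) (k : ℕ) :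
    LipschitzFDeriv (κ ^ k * L₁) (L₂ + k * (h * Λ₂ * L₁))
      ((_root_.walkStep (eulerStep R h W) (noise n δ))^[k] φ) := by
  have hL₁ := hφ.nonneg_left
  have hL₂ := hφ.nonneg
  have hΛ₂ := hW.nonneg
  have hh := hs.nonneg
  have hκ := hs.rate_nonneg
  have hκ1 : κ ^ 2 ≤ 1 := pow_le_one₀ hκ hs.rate_le_one
  induction k with
  | zero => exact hφ.mono (by simp) (by simp)
  | succ k ih =>
    rw [Function.iterate_succ_apply']
    have hk : κ ^ k * L₁ ≤ L₁ := mul_le_of_le_one_left hL₁ (pow_le_one₀ hκ hs.rate_le_one)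
    refine (ih.walkStep (hW.differentiable_eulerStep R h)
      (hW.norm_fderiv_eulerStep_le hs.nonneg hs.mul_le_one hκ hs.rate_sq)
      (hW.norm_eulerStep_sub_le hs.nonneg hs.mul_le_one hκ hs.rate_sq)
      (hW.norm_fderiv_eulerStep_sub_le R hs.nonneg) (by positivity) _).mono ?_ ?_
    · exact (by ring : κ * (κ ^ k * L₁) = κ ^ (k + 1) * L₁).le
    · have h1 : κ ^ 2 * (L₂ + k * (h * Λ₂ * L₁)) ≤ L₂ + k * (h * Λ₂ * L₁) :=
        mul_le_of_le_one_left (by positivity) hκ1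
      have h2 : h * Λ₂ * (κ ^ k * L₁) ≤ h * Λ₂ * L₁ := by gcongr
      push_cast
      linarith

lemma LipschitzFDeriv.iterate_walkStep_le [NeZero n] (hφ : LipschitzFDeriv L₁ L₂ φ)
    (hW : TameConvex B Λ Λ₂ W) (hs : StepSize n R Λ h δ κ) {k N : ℕ} (hk : k ≤ N) :
    LipschitzFDeriv L₁ (L₂ + N * h * Λ₂ * L₁)
      ((_root_.walkStep (eulerStep R h W) (noise n δ))^[k] φ) := by
  have hL₁ := hφ.nonneg_left
  have hΛ₂ := hW.nonneg
  have hh := hs.nonneg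
  refine (hφ.iterate_walkStep hW hs k).mono
    (mul_le_of_le_one_left hL₁ (pow_le_one₀ hs.rate_nonneg hs.rate_le_one)) ?_
  have : (k : ℝ) * (h * Λ₂ * L₁) ≤ N * (h * Λ₂ * L₁) := by gcongr
  linarith

lemma iterate_walkStep_mem_Icc [NeZero n] (T : EuclideanSpace ℝ (Fin n) → EuclideanSpace ℝ (Fin n))
    (δ : ℝ) (hg : ∀ x, g x ∈ Set.Icc a b) (k : ℕ) (x : EuclideanSpace ℝ (Fin n)) :
    (walkStep T (noise n δ))^[k] g x ∈ Set.Icc a b := by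
  induction k generalizing x with
  | zero => exact hg x
  | succ k ih =>
    rw [Function.iterate_succ_apply']
    exact famMean_mem_Icc fun j => ih _

lemma iterate_walkStep_le_add [NeZero n]
    (T : EuclideanSpace ℝ (Fin n) → EuclideanSpace ℝ (Fin n)) (δ c : ℝ)
    {F : ℕ → EuclideanSpace ℝ (Fin n) → ℝ} {N : ℕ}
    (hF : ∀ k < N, ∀ x, walkStep T (noise n δ) (F k) x ≤ F (k + 1) x + c) :
    ∀ k ≤ N, ∀ x, (walkStep T (noise n δ))^[k] (F 0) x ≤ F k x + k * c := by
  intro k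
  induction k with
  | zero => intro _ x; simp
  | succ k ih =>
    intro hk x
    rw [Function.iterate_succ_apply']
    refine (walkStep_mono T _ (ih (by omega)) x).trans ?_
    rw [walkStep_add_const]
    have := hF k (by omega) x
    push_cast
    linarith

lemma TameConvex.abs_integral_iterate_walkStep_sub_le [NeZero n] (hW : TameConvex B Λ Λ₂ W)
    (hR : 0 < R) (hφ : LipschitzFDeriv L₁ L₂ φ) (hs : StepSize n R Λ h δ κ) (N : ℕ) :
    |(∫ x, (walkStep (eulerStep R h W) (noise n δ))^[N] φ x * gibbs R W x)
        - ∫ x, φ x * gibbs R W x|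
      ≤ N * (2 * (L₁ + (L₂ + N * h * Λ₂ * L₁)) * δ ^ 3
          * ∫ x, errorWeight R B Λ x * gibbs R W x) := by
  suffices h : ∀ k ≤ N, |(∫ x, (walkStep (eulerStep R h W) (noise n δ))^[k] φ x * gibbs R W x)
        - ∫ x, φ x * gibbs R W x|
      ≤ k * (2 * (L₁ + (L₂ + N * h * Λ₂ * L₁)) * δ ^ 3
          * ∫ x, errorWeight R B Λ x * gibbs R W x) from h N le_rfl
  intro k
  induction k with
  | zero => intro _; simp
  | succ k ih =>
    intro hk
    rw [Function.iterate_succ_apply']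
    have h1 := hW.abs_integral_walkStep_sub_le (NeZero.pos n) hR
      (hφ.iterate_walkStep_le hW hs (show k ≤ N by omega)) hs.nonneg hs.noise_nonneg
      hs.noise_le_one hs.noise_sq
    refine (abs_sub_le _ (∫ x, (walkStep (eulerStep R h W) (noise n δ))^[k] φ x * gibbs R W x)
      _).trans ?_
    have h2 := ih (by omega)
    push_cast
    linarith

lemma LipschitzFDeriv.integrable_mul_gibbs (hφ : LipschitzFDeriv L₁ L₂ φ) (hR : 0 < R)
    (hW : LipschitzFDeriv B Λ W) : Integrable fun x => φ x * gibbs R W x :=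
  integrable_mul_gibbs_of_linear hR hW.continuous hW.sub_mul_norm_le hφ.continuous hφ.abs_le

lemma integrable_norm_mul_gibbs (hR : 0 < R) (hW : LipschitzFDeriv B Λ W) :
    Integrable fun x => ‖x‖ * gibbs R W x :=
  integrable_mul_gibbs_of_linear (A := 0) (c := 1) hR hW.continuous hW.sub_mul_norm_le
    continuous_norm fun x => by simp

lemma LipschitzFDeriv.abs_sub_integral_le (hφ : LipschitzFDeriv L₁ L₂ φ) (hR : 0 < R)
    (hW : LipschitzFDeriv B Λ W) (h1 : ∫ x, gibbs R W x = 1) (x : EuclideanSpace ℝ (Fin n)) :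
    |φ x - ∫ y, φ y * gibbs R W y| ≤ L₁ * (‖x‖ + ∫ y, ‖y‖ * gibbs R W y) := by
  have hi := integrable_gibbs hR hW.continuous hW.sub_mul_norm_le
  have hL := hφ.nonneg_left
  have h2 : φ x - ∫ y, φ y * gibbs R W y = ∫ y, (φ x * gibbs R W y - φ y * gibbs R W y) := by
    rw [integral_sub (hi.const_mul _) (hφ.integrable_mul_gibbs hR hW), integral_const_mul, h1,
      mul_one]
  have h3 : L₁ * (‖x‖ + ∫ y, ‖y‖ * gibbs R W y)
      = ∫ y, L₁ * (‖x‖ * gibbs R W y + ‖y‖ * gibbs R W y) := by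
    rw [integral_const_mul, integral_add (hi.const_mul _) (integrable_norm_mul_gibbs hR hW),
      integral_const_mul, h1, mul_one]
  rw [h2, h3, ← Real.norm_eq_abs]
  refine norm_integral_le_of_norm_le
    (((hi.const_mul _).add (integrable_norm_mul_gibbs hR hW)).const_mul _)
    (Filter.Eventually.of_forall fun y => ?_)
  have h4 := hφ.abs_sub_le y x
  have hp := (gibbs_pos R W y).le
  rw [← sub_mul, norm_mul, Real.norm_of_nonneg hp, Real.norm_eq_abs, ← add_mul, ← mul_assoc]
  refine mul_le_mul_of_nonneg_right (h4.trans ?_) hp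
  gcongr
  exact norm_sub_le x y

variable {M p q : ℝ → ℝ → ℝ} {ε C : ℝ}

lemma BellmanTaylor.abs_bellman_sub_le {E : Type*} [NormedAddCommGroup E] [NormedSpace ℝ E]
    {g : E → ℝ} (hR : 0 < R) (hB : BellmanTaylor M p q a b ε (√(ε ^ 2 + L₁ ^ 2 / R)) C)
    (hg : LipschitzFDeriv L₁ L₂ g) (hgI : ∀ x, g x ∈ Set.Icc a b) (x y : E) :
    |bellman M ε R g x - bellman M ε R g y| ≤ C * (L₁ + (√R)⁻¹ * L₂) * ‖x - y‖ := by
  refine (hB.abs_sub_le _ (hgI y) _ (regNorm_mem_Icc hR (hg.norm_fderiv_le y)) _ (hgI x) _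
    (regNorm_mem_Icc hR (hg.norm_fderiv_le x))).trans ?_
  have hC := hB.nonneg
  calc C * (|g x - g y| + |regNorm ε R (fderiv ℝ g x) - regNorm ε R (fderiv ℝ g y)|)
      ≤ C * (L₁ * ‖x - y‖ + (√R)⁻¹ * (L₂ * ‖x - y‖)) := by
        gcongr
        · exact hg.abs_sub_le y x
        · exact (abs_regNorm_sub_le hR ε _ _).trans (by gcongr; exact hg.norm_fderiv_sub_le x y)
    _ = _ := by ring

lemma BellmanTaylor.integrable_bellman_mul_gibbs (hR : 0 < R)
    (hB : BellmanTaylor M p q a b ε (√(ε ^ 2 + L₁ ^ 2 / R)) C)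
    (hg : LipschitzFDeriv L₁ L₂ g) (hgI : ∀ x, g x ∈ Set.Icc a b) (hW : LipschitzFDeriv B Λ W) :
    Integrable fun x => bellman M ε R g x * gibbs R W x := by
  have h := hB.abs_bellman_sub_le hR hg hgI
  have hC : 0 ≤ C * (L₁ + (√R)⁻¹ * L₂) :=
    mul_nonneg hB.nonneg (add_nonneg hg.nonneg_left (mul_nonneg (by positivity) hg.nonneg))
  refine integrable_mul_gibbs_of_linear (A := |bellman M ε R g 0|)
    (c := C * (L₁ + (√R)⁻¹ * L₂)) hR hW.continuous hW.sub_mul_norm_le ?_ fun x => ?_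
  · exact (LipschitzWith.of_dist_le_mul (K := ⟨_, hC⟩) fun x y => by
      rw [dist_eq_norm, dist_eq_norm]
      exact h x y).continuous
  · have h1 := h x 0
    rw [sub_zero] at h1
    have := abs_add_le (bellman M ε R g 0) (bellman M ε R g x - bellman M ε R g 0)
    rw [add_sub_cancel] at this
    linarith

end Iteration

section Nice

variable {n : ℕ} {R B Λ Λ₂ L₁ L₂ h δ κ a b : ℝ} {W φ g : EuclideanSpace ℝ (Fin n) → ℝ}

lemma integral_mul_mem_Icc {X : Type*} [MeasurableSpace X] {ν : Measure X} {f g : X → ℝ}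
    (hf : Integrable f ν) (hfg : Integrable (fun x => g x * f x) ν) (hf0 : ∀ x, 0 ≤ f x)
    (h1 : ∫ x, f x ∂ν = 1) (hg : ∀ x, g x ∈ Set.Icc a b) :
    ∫ x, g x * f x ∂ν ∈ Set.Icc a b := by
  constructor
  · calc a = ∫ x, a * f x ∂ν := by rw [integral_const_mul, h1, mul_one]
      _ ≤ _ := integral_mono (hf.const_mul _) hfg
        fun x => mul_le_mul_of_nonneg_right (hg x).1 (hf0 x)
  · calc ∫ x, g x * f x ∂ν ≤ ∫ x, b * f x ∂ν := integral_mono hfg (hf.const_mul _)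
          fun x => mul_le_mul_of_nonneg_right (hg x).2 (hf0 x)
      _ = b := by rw [integral_const_mul, h1, mul_one]

lemma stepSize_sqrt (hh : 0 ≤ h) (hR : 0 ≤ R) (h₁ : h * R ≤ 1) (h₂ : 2 * n * h ≤ 1)
    (h₃ : h * (R ^ 2 + Λ ^ 2) ≤ R) :
    StepSize n R Λ h (√(2 * n * h)) (√((1 - h * R) ^ 2 + h ^ 2 * Λ ^ 2)) ∧
      √((1 - h * R) ^ 2 + h ^ 2 * Λ ^ 2) ≤ exp (-(h * R / 2)) := by
  have hκ : (1 - h * R) ^ 2 + h ^ 2 * Λ ^ 2 ≤ 1 - h * R := by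
    nlinarith [mul_le_mul_of_nonneg_left h₃ hh]
  refine ⟨⟨hh, sqrt_nonneg _, sqrt_le_one.2 h₂, sq_sqrt (by positivity), h₁, sqrt_nonneg _,
    sqrt_le_one.2 (hκ.trans (by nlinarith [mul_nonneg hh hR])), sq_sqrt (by positivity)⟩, ?_⟩
  rw [sqrt_le_left (exp_pos _).le, ← exp_nat_mul]
  refine hκ.trans ((one_sub_le_exp_neg _).trans (le_of_eq ?_))
  congr 1
  push_cast
  ring

variable {M p q : ℝ → ℝ → ℝ} {ε C : ℝ}

lemma BellmanTaylor.exists_integral_bellman_le [NeZero n] (hR : 0 < R) (hε : 0 < ε)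
    (hB : BellmanTaylor M p q a b ε (√(ε ^ 2 + L₁ ^ 2 / R)) C) (hW : TameConvex B Λ Λ₂ W)
    (h1 : ∫ x, gibbs R W x = 1) (hg : LipschitzFDeriv L₁ L₂ g) (hgI : ∀ x, g x ∈ Set.Icc a b)
    (T : ℝ) {η : ℝ} (hη : 0 < η) :
    ∃ D, ∀ (N : ℕ) (h δ κ : ℝ), StepSize n R Λ h δ κ → N * h = T →
      ∫ x, bellman M ε R g x * gibbs R W x ≤ M (∫ x, g x * gibbs R W x) ε + 2 * η
        + D * (N * δ ^ 3) + κ ^ N * (2 * C * L₁ * ∫ x, ‖x‖ * gibbs R W x) := by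
  have hWf := hW.lipschitzFDeriv
  have hC := hB.nonneg
  have hL₁ := hg.nonneg_left
  have hF := hB.abs_bellman_sub_le hR hg hgI
  have hFi := hB.integrable_bellman_mul_gibbs hR hg hgI hWf
  have hA : 0 ≤ C * (L₁ + (√R)⁻¹ * L₂) :=
    mul_nonneg hC (add_nonneg hL₁ (mul_nonneg (by positivity) hg.nonneg))
  obtain ⟨φ, A, -, hφ, -, -, -, hφF, -⟩ := (LipschitzWith.of_dist_le_mul (K := ⟨_, hA⟩)
    fun x y => by rw [dist_eq_norm, dist_eq_norm]; exact hF x y :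
      LipschitzWith _ (bellman M ε R g)).exists_smooth_approx hη
  set A₁ : ℝ := ((⟨C * (L₁ + (√R)⁻¹ * L₂), hA⟩ : NNReal) : ℝ)
  obtain ⟨K, hK, hKs⟩ := hB.walkStep_le (Λ := Λ) (NeZero.pos n) hε hR (L₂ + T * Λ₂ * L₁)
  set f := gibbs R W
  set I := ∫ x, errorWeight R B Λ x * f x
  set m := ∫ x, ‖x‖ * f x
  set c := ∫ x, g x * f x
  have hfi : Integrable f := integrable_gibbs hR hWf.continuous hWf.sub_mul_norm_le
  have hf0 : ∀ x, 0 ≤ f x := fun x => (gibbs_pos R W x).le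
  have hc : c ∈ Set.Icc a b :=
    integral_mul_mem_Icc hfi (hg.integrable_mul_gibbs hR hWf) hf0 h1 hgI
  have hε₁ : ε ≤ √(ε ^ 2 + L₁ ^ 2 / R) := le_sqrt_of_sq_le (by
    have : 0 ≤ L₁ ^ 2 / R := by positivity
    linarith)
  refine ⟨2 * (A₁ + (A + T * Λ₂ * A₁)) * I + K + C * (2 * (L₁ + (L₂ + T * Λ₂ * L₁)) * I),
    fun N h δ κ hs hNh => ?_⟩
  set Q := walkStep (eulerStep R h W) (noise n δ)
  have hgk : ∀ k ≤ N, LipschitzFDeriv L₁ (L₂ + T * Λ₂ * L₁) (Q^[k] g) := fun k hk => by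
    have := hg.iterate_walkStep_le hW hs hk
    rwa [hNh] at this
  have hgkI := iterate_walkStep_mem_Icc (eulerStep R h W) δ hgI
  have hgN := hgk N le_rfl
  have e1 := hW.abs_integral_iterate_walkStep_sub_le hR hφ hs N
  have e2 := hW.abs_integral_iterate_walkStep_sub_le hR hg hs N
  rw [hNh] at e1 e2
  have hφN := (hφ.iterate_walkStep_le hW hs (le_refl N)).integrable_mul_gibbs hR hWf
  have hbound : ∀ x, Q^[N] φ x ≤ bellman M ε R (Q^[N] g) x + N * (K * δ ^ 3) + η := by
    intro x
    have h2 := iterate_walkStep_le_add (eulerStep R h W) δ (K * δ ^ 3)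
      (F := fun k => fun x => bellman M ε R (Q^[k] g) x + η) (N := N) (fun k hk x => by
        rw [walkStep_add_const, Function.iterate_succ_apply']
        have := hKs h δ κ (eulerStep R h W) (Q^[k] g) hs.nonneg hs.noise_nonneg hs.noise_le_one
          hs.noise_sq hs.rate_le_one hs.rate_sq (hW.differentiable_eulerStep R h)
          (hW.norm_fderiv_eulerStep_le hs.nonneg hs.mul_le_one hs.rate_nonneg hs.rate_sq)
          (hgk k hk.le) (hgkI k) x
        linarith) N le_rfl x
    have h3 : ∀ k x, Q^[k] φ x ≤ Q^[k] (fun x => bellman M ε R g x + η) x := by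
      intro k
      induction k with
      | zero => intro x; exact sub_le_iff_le_add'.1 (abs_le.1 (hφF x)).2
      | succ k ih =>
        intro x
        rw [Function.iterate_succ_apply', Function.iterate_succ_apply']
        exact walkStep_mono _ _ ih x
    have := h3 N x
    simp only [Function.iterate_zero, id_eq] at h2
    linarith
  have hpt : ∀ x, Q^[N] φ x ≤ M c ε + N * (K * δ ^ 3) + η
      + C * (κ ^ N * L₁ * (‖x‖ + m) + N * (2 * (L₁ + (L₂ + T * Λ₂ * L₁)) * δ ^ 3 * I)) := by
    intro x
    have hd := (hg.iterate_walkStep hW hs N).abs_sub_integral_le hR hWf h1 x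
    have h2 : |Q^[N] g x - c| ≤ κ ^ N * L₁ * (‖x‖ + m)
        + N * (2 * (L₁ + (L₂ + T * Λ₂ * L₁)) * δ ^ 3 * I) :=
      (_root_.abs_sub_le _ (∫ y, Q^[N] g y * f y) _).trans (add_le_add hd e2)
    have h3 : bellman M ε R (Q^[N] g) x ≤ M (Q^[N] g x) ε :=
      hB.antitone _ (hgkI N x) ⟨le_rfl, hε₁⟩ (regNorm_mem_Icc hR (hgN.norm_fderiv_le x))
        (le_regNorm hR _)
    have h4 := hB.abs_sub_le c hc ε ⟨le_rfl, hε₁⟩ _ (hgkI N x) ε ⟨le_rfl, hε₁⟩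
    rw [sub_self, abs_zero, add_zero] at h4
    have h5 := (abs_le.1 (h4.trans (mul_le_mul_of_nonneg_left h2 hC))).2
    linarith [hbound x]
  have hni := integrable_norm_mul_gibbs hR hWf
  have s1 : ∫ x, bellman M ε R g x * f x ≤ (∫ x, φ x * f x) + η := by
    rw [← mul_one η, ← h1, ← integral_const_mul, ← integral_add
      (hφ.integrable_mul_gibbs hR hWf) (hfi.const_mul _)]
    refine integral_mono hFi ((hφ.integrable_mul_gibbs hR hWf).add (hfi.const_mul _)) fun x => ?_
    have := (abs_le.1 (hφF x)).1
    simp only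
    rw [← add_mul]
    exact mul_le_mul_of_nonneg_right (by linarith) (hf0 x)
  set c₀ := M c ε + N * (K * δ ^ 3) + η
      + C * (κ ^ N * L₁ * m + N * (2 * (L₁ + (L₂ + T * Λ₂ * L₁)) * δ ^ 3 * I)) with hc₀
  have s2 : ∫ x, Q^[N] φ x * f x ≤ c₀ + C * κ ^ N * L₁ * m := by
    have : c₀ + C * κ ^ N * L₁ * m = ∫ x, (c₀ * f x + C * κ ^ N * L₁ * (‖x‖ * f x)) := by
      rw [integral_add (hfi.const_mul _) (hni.const_mul _), integral_const_mul,
        integral_const_mul, h1, mul_one]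
    rw [this]
    refine integral_mono hφN ((hfi.const_mul _).add (hni.const_mul _)) fun x => ?_
    refine (mul_le_mul_of_nonneg_right (hpt x) (hf0 x)).trans (le_of_eq ?_)
    simp only [hc₀]
    ring
  have s3 : -(N * (2 * (A₁ + (A + T * Λ₂ * A₁)) * δ ^ 3 * I))
      ≤ (∫ x, Q^[N] φ x * f x) - ∫ x, φ x * f x := (abs_le.1 e1).1
  have : c₀ + C * κ ^ N * L₁ * m + N * (2 * (A₁ + (A + T * Λ₂ * A₁)) * δ ^ 3 * I) + η
      = M c ε + 2 * η + (2 * (A₁ + (A + T * Λ₂ * A₁)) * I + K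
        + C * (2 * (L₁ + (L₂ + T * Λ₂ * L₁)) * I)) * (N * δ ^ 3)
        + κ ^ N * (2 * C * L₁ * m) := by
    rw [hc₀]; ring
  linarith

open Filter Topology in
lemma BellmanTaylor.integral_bellman_le [NeZero n] (hR : 0 < R) (hε : 0 < ε)
    (hB : BellmanTaylor M p q a b ε (√(ε ^ 2 + L₁ ^ 2 / R)) C) (hW : TameConvex B Λ Λ₂ W)
    (h1 : ∫ x, gibbs R W x = 1) (hg : LipschitzFDeriv L₁ L₂ g) (hgI : ∀ x, g x ∈ Set.Icc a b) :
    ∫ x, bellman M ε R g x * gibbs R W x ≤ M (∫ x, g x * gibbs R W x) ε := by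
  have hm : 0 ≤ 2 * C * L₁ * ∫ x, ‖x‖ * gibbs R W x :=
    mul_nonneg (mul_nonneg (mul_nonneg two_pos.le hB.nonneg) hg.nonneg_left)
      (integral_nonneg fun x => mul_nonneg (norm_nonneg x) (gibbs_pos R W x).le)
  set m := 2 * C * L₁ * ∫ x, ‖x‖ * gibbs R W x
  set J := ∫ x, bellman M ε R g x * gibbs R W x
  set c := ∫ x, g x * gibbs R W x
  have key : ∀ T η : ℝ, 0 < T → 0 < η → J ≤ M c ε + 2 * η + exp (-(T * R / 2)) * m := by
    intro T η hT hη
    obtain ⟨D, hD⟩ := hB.exists_integral_bellman_le hR hε hW h1 hg hgI T hη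
    have hh : Tendsto (fun N : ℕ => T / N) atTop (𝓝 0) := tendsto_const_div_atTop_nhds_zero_nat T
    have ev : ∀ {A r : ℝ}, 0 < r → ∀ᶠ N : ℕ in atTop, T / N * A ≤ r := fun {A r} hr => by
      have := hh.mul_const A
      rw [zero_mul] at this
      exact (this.eventually_lt_const hr).mono fun N => le_of_lt
    have hlim : Tendsto (fun N : ℕ => M c ε + 2 * η
        + D * (2 * n * T * √(2 * n * (T / N))) + exp (-(T * R / 2)) * m) atTop
        (𝓝 (M c ε + 2 * η + D * (2 * n * T * √(2 * n * 0)) + exp (-(T * R / 2)) * m)) :=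
      ((((hh.const_mul _).sqrt.const_mul _).const_mul D).const_add _).add_const _
    rw [mul_zero, sqrt_zero, mul_zero, mul_zero, add_zero] at hlim
    refine ge_of_tendsto hlim ?_
    filter_upwards [ev (A := R) one_pos, ev (A := 2 * n) one_pos, ev (A := R ^ 2 + Λ ^ 2) hR,
      eventually_gt_atTop 0] with N h₁ h₂ h₃ hN
    have hN' : (0 : ℝ) < N := Nat.cast_pos.2 hN
    obtain ⟨hs, hκ⟩ := stepSize_sqrt (n := n) (Λ := Λ) (by positivity) hR.le h₁
      (by rwa [mul_comm]) h₃
    have hNT : N * (T / N) = T := by field_simp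
    refine (hD N _ _ _ hs hNT).trans ?_
    have e1 : (N : ℝ) * √(2 * n * (T / N)) ^ 3 = 2 * n * T * √(2 * n * (T / N)) := by
      rw [pow_succ, sq_sqrt (by positivity)]
      field_simp
    have e2 : √((1 - T / N * R) ^ 2 + (T / N) ^ 2 * Λ ^ 2) ^ N ≤ exp (-(T * R / 2)) := by
      refine (pow_le_pow_left₀ (sqrt_nonneg _) hκ N).trans (le_of_eq ?_)
      rw [← exp_nat_mul]
      congr 1
      field_simp
    rw [e1]
    gcongr
  have key' : ∀ η : ℝ, 0 < η → J ≤ M c ε + 2 * η := fun η hη => by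
    have hlim : Tendsto (fun T : ℝ => M c ε + 2 * η + exp (-(T * (R / 2))) * m) atTop
        (𝓝 (M c ε + 2 * η + 0 * m)) :=
      ((tendsto_exp_neg_atTop_nhds_zero.comp
        (tendsto_id.atTop_mul_const (half_pos hR))).mul_const m).const_add _
    rw [zero_mul, add_zero] at hlim
    refine ge_of_tendsto hlim ((eventually_gt_atTop 0).mono fun T hT => ?_)
    rw [← mul_div_assoc]
    exact key T η hT hη
  exact le_of_forall_pos_le_add fun η hη => by
    have := key' (η / 2) (half_pos hη)
    linarith

end Nice

section Potential

open scoped NNReal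

variable {E : Type*} [NormedAddCommGroup E] [NormedSpace ℝ E]

/-- A function with a continuous choice of supporting affine functions is an increasing limit of
Lipschitz convex functions. -/
lemma exists_lipschitz_convex_minorant [ProperSpace E] {V : E → ℝ} {ℓ : E → E →L[ℝ] ℝ}
    (hℓ : Continuous ℓ) (hV : ∀ x y, V y + ℓ y (x - y) ≤ V x) {r : ℝ} (hr : 0 ≤ r) :
    ∃ (W : E → ℝ) (K : ℝ≥0), LipschitzWith K W ∧ ConvexOn ℝ Set.univ W ∧
      (∀ x, V 0 + ℓ 0 x ≤ W x) ∧ ∀ x, ‖x‖ ≤ r → W x = V x := by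
  obtain ⟨K, hK⟩ := (isCompact_closedBall (0 : E) r).exists_bound_of_continuousOn hℓ.continuousOn
  have : Nonempty (Metric.closedBall (0 : E) r) := ⟨⟨0, by simpa using hr⟩⟩
  have hK0 : 0 ≤ K := (norm_nonneg _).trans (hK 0 (by simpa using hr))
  have hbdd : ∀ x, BddAbove (Set.range fun y : Metric.closedBall (0 : E) r => V y + ℓ y (x - y)) :=
    fun x => ⟨V x, by rintro _ ⟨y, rfl⟩; exact hV x y⟩
  have hle : ∀ x (y : Metric.closedBall (0 : E) r), V y + ℓ y (x - y)
      ≤ ⨆ y : Metric.closedBall (0 : E) r, V y + ℓ y (x - y) := fun x y => le_ciSup (hbdd x) y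
  refine ⟨fun x => ⨆ y : Metric.closedBall (0 : E) r, V y + ℓ y (x - y), ⟨K, hK0⟩, ?_, ?_, ?_, ?_⟩
  · refine LipschitzWith.of_le_add_mul _ fun x z => ciSup_le fun y => ?_
    have h1 := (le_abs_self _).trans ((ℓ y).le_of_opNorm_le (hK y y.2) (x - z))
    have h2 : ℓ y (x - y) = ℓ y (z - y) + ℓ y (x - z) := by rw [← map_add]; congr 1; abel
    rw [dist_eq_norm, h2]
    have := hle z y
    change _ ≤ _ + K * ‖x - z‖
    linarith
  · refine ⟨convex_univ, fun x _ z _ s t hs ht hst => ciSup_le fun y => ?_⟩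
    have h1 := mul_le_mul_of_nonneg_left (hle x y) hs
    have h2 := mul_le_mul_of_nonneg_left (hle z y) ht
    have h3 : s • x + t • z - (y : E) = s • (x - y) + t • (z - y) := by
      have : (y : E) = (s + t) • (y : E) := by rw [hst, one_smul]
      conv_lhs => rw [this]
      module
    have h4 : V y = s * V y + t * V y := by rw [← add_mul, hst, one_mul]
    rw [h3, map_add, map_smul, map_smul, h4]
    simp only [smul_eq_mul]
    linarith
  · intro x
    simpa using hle x ⟨0, by simpa using hr⟩
  · intro x hx
    refine le_antisymm (ciSup_le fun y => hV x y) ?_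
    simpa using hle x ⟨x, by simpa using hx⟩

variable {n : ℕ} {R : ℝ}

lemma gibbs_add_const (R : ℝ) (W : EuclideanSpace ℝ (Fin n) → ℝ) (c : ℝ)
    (x : EuclideanSpace ℝ (Fin n)) :
    gibbs R (fun y => W y + c) x = exp (-c) * gibbs R W x := by
  rw [gibbs, gibbs, ← exp_add]
  congr 1
  ring

open Filter Topology in
lemma exists_tameConvex_tendsto (hR : 0 < R) {V : EuclideanSpace ℝ (Fin n) → ℝ}
    {ℓ : EuclideanSpace ℝ (Fin n) → EuclideanSpace ℝ (Fin n) →L[ℝ] ℝ}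
    (hℓ : Continuous ℓ) (hV : ∀ x y, V y + ℓ y (x - y) ≤ V x) (h1 : ∫ x, gibbs R V x = 1) :
    ∃ W : ℕ → EuclideanSpace ℝ (Fin n) → ℝ, (∀ m, ∃ B Λ Λ₂, TameConvex B Λ Λ₂ (W m)) ∧
      (∀ m, ∫ x, gibbs R (W m) x = 1) ∧ ∀ F : EuclideanSpace ℝ (Fin n) → ℝ, Continuous F →
      ∀ A, (∀ x, |F x| ≤ A) → Tendsto (fun m => ∫ x, F x * gibbs R (W m) x) atTop
        (𝓝 (∫ x, F x * gibbs R V x)) := by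
  choose V' K hK hconv hlow heq using fun m : ℕ =>
    exists_lipschitz_convex_minorant hℓ hV (r := m) m.cast_nonneg
  choose φ Λ Λ₂ hφ hφd hφ₂ hΛ₂ happ hφc using fun m : ℕ =>
    (hK m).exists_smooth_approx (η := 1 / ((m : ℝ) + 1)) Nat.one_div_pos_of_nat
  have hmono : ∀ m x y, 0 ≤ (fderiv ℝ (φ m) x - fderiv ℝ (φ m) y) (x - y) := fun m x y => by
    have e1 := (hφc m (hconv m)).fderiv_apply_sub_le ((hφ m).differentiable x) y
    have e2 := (hφc m (hconv m)).fderiv_apply_sub_le ((hφ m).differentiable y) x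
    rw [← neg_sub x y, map_neg] at e1
    rw [sub_apply]
    linarith
  have hdom : ∀ m x, gibbs R (φ m) x
      ≤ exp (1 - V 0) * exp (‖ℓ 0‖ * ‖x‖ - R / 2 * ‖x‖ ^ 2) := fun m x => by
    rw [gibbs, ← exp_add, exp_le_exp]
    have e1 := hlow m x
    have e2 := (abs_le.1 (happ m x)).1
    have e3 := (abs_le.1 ((ℓ 0).le_opNorm x)).1
    have e4 : 1 / ((m : ℝ) + 1) ≤ 1 := by
      rw [div_le_one (by positivity)]
      linarith [m.cast_nonneg (α := ℝ)]
    linarith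
  have hpt : ∀ x, Tendsto (fun m => gibbs R (φ m) x) atTop (𝓝 (gibbs R V x)) := fun x => by
    have hVx : Tendsto (fun m => φ m x) atTop (𝓝 (V x)) := by
      rw [tendsto_iff_dist_tendsto_zero]
      refine squeeze_zero' (Eventually.of_forall fun _ => dist_nonneg) ?_
        tendsto_one_div_add_atTop_nhds_zero_nat
      filter_upwards [tendsto_natCast_atTop_atTop.eventually_ge_atTop ‖x‖] with m hm
      rw [← heq m x hm]
      exact happ m x
    exact (continuous_exp.tendsto _).comp (hVx.const_add _).neg
  have hlim : ∀ F : EuclideanSpace ℝ (Fin n) → ℝ, Continuous F → ∀ A, (∀ x, |F x| ≤ A) →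
      Tendsto (fun m => ∫ x, F x * gibbs R (φ m) x) atTop (𝓝 (∫ x, F x * gibbs R V x)) := by
    intro F hF A hA
    refine tendsto_integral_of_dominated_convergence
      (fun x => A * (exp (1 - V 0) * exp (‖ℓ 0‖ * ‖x‖ - R / 2 * ‖x‖ ^ 2)))
      (fun m => (hF.mul (continuous_gibbs R (hφ m).continuous)).aestronglyMeasurable)
      (((integrable_exp_linear_sub_sq (half_pos hR) _).const_mul _).const_mul _)
      (fun m => Eventually.of_forall fun x => ?_)
      (Eventually.of_forall fun x => (hpt x).const_mul _)
    rw [norm_mul, Real.norm_of_nonneg (gibbs_pos R (φ m) x).le]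
    exact mul_le_mul (hA x) (hdom m x) (gibbs_pos R (φ m) x).le ((abs_nonneg _).trans (hA x))
  have hZ : ∀ m, 0 < ∫ x, gibbs R (φ m) x := fun m =>
    integral_exp_pos (integrable_gibbs hR (hφ m).continuous (hφ m).sub_mul_norm_le)
  have hW : ∀ m x, gibbs R (fun y => φ m y + log (∫ x, gibbs R (φ m) x)) x
      = (∫ x, gibbs R (φ m) x)⁻¹ * gibbs R (φ m) x := fun m x => by
    rw [gibbs_add_const, exp_neg, exp_log (hZ m)]
  refine ⟨fun m y => φ m y + log (∫ x, gibbs R (φ m) x), fun m => ⟨K m, Λ m, Λ₂ m, ?_⟩,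
    fun m => ?_, fun F hF A hA => ?_⟩
  · have hD : fderiv ℝ (fun y => φ m y + log (∫ x, gibbs R (φ m) x)) = fderiv ℝ (φ m) :=
      funext fun x => fderiv_add_const _
    refine ⟨⟨(hφ m).differentiable.add_const _, ?_, ?_, (hφ m).nonneg⟩, ?_, ?_, ?_, hΛ₂ m⟩
    all_goals rw [hD]
    exacts [(hφ m).norm_fderiv_le, (hφ m).norm_fderiv_sub_le, hφd m, hφ₂ m, hmono m]
  · simp_rw [hW]
    rw [integral_const_mul, inv_mul_cancel₀ (hZ m).ne']
  · simp_rw [hW, mul_left_comm (F _), integral_const_mul]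
    have hZ1 := hlim (fun _ => 1) continuous_const 1 fun _ => by simp
    simp only [one_mul, h1] at hZ1
    simpa using (hZ1.inv₀ one_ne_zero).mul (hlim F hF A hA)

variable {ε C a b L₁ L₂ : ℝ} {M p q : ℝ → ℝ → ℝ} {g : EuclideanSpace ℝ (Fin n) → ℝ}

open Filter Topology in
lemma BellmanTaylor.integral_bellman_le_of_supporting [NeZero n] (hR : 0 < R) (hε : 0 < ε)
    (hB : BellmanTaylor M p q a b ε (√(ε ^ 2 + L₁ ^ 2 / R)) C)
    {V : EuclideanSpace ℝ (Fin n) → ℝ}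
    {ℓ : EuclideanSpace ℝ (Fin n) → EuclideanSpace ℝ (Fin n) →L[ℝ] ℝ}
    (hℓ : Continuous ℓ) (hV : ∀ x y, V y + ℓ y (x - y) ≤ V x) (h1 : ∫ x, gibbs R V x = 1)
    (hg : LipschitzFDeriv L₁ L₂ g) (hgI : ∀ x, g x ∈ Set.Icc a b) :
    ∫ x, bellman M ε R g x * gibbs R V x ≤ M (∫ x, g x * gibbs R V x) ε := by
  obtain ⟨W, hW, hW1, hlim⟩ := exists_tameConvex_tendsto hR hℓ hV h1
  have hF := hB.abs_bellman_sub_le hR hg hgI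
  have hA : 0 ≤ C * (L₁ + (√R)⁻¹ * L₂) :=
    mul_nonneg hB.nonneg (add_nonneg hg.nonneg_left (mul_nonneg (by positivity) hg.nonneg))
  have hFc : Continuous (bellman M ε R g) :=
    (LipschitzWith.of_dist_le_mul (K := ⟨_, hA⟩) fun x y => by
      rw [dist_eq_norm, dist_eq_norm]
      exact hF x y).continuous
  have hr := fun x => regNorm_mem_Icc (ε := ε) hR (hg.norm_fderiv_le x)
  have hFb : ∀ x, |bellman M ε R g x| ≤ |bellman M ε R g 0|
      + C * ((b - a) + (√(ε ^ 2 + L₁ ^ 2 / R) - ε)) := fun x => by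
    have e1 := hB.abs_sub_le _ (hgI 0) _ (hr 0) _ (hgI x) _ (hr x)
    have e2 : |g x - g 0| ≤ b - a := abs_sub_le_of_le_of_le (hgI x).1 (hgI x).2 (hgI 0).1 (hgI 0).2
    have e3 := abs_sub_le_of_le_of_le (hr x).1 (hr x).2 (hr 0).1 (hr 0).2
    have e4 := mul_le_mul_of_nonneg_left (add_le_add e2 e3) hB.nonneg
    have e5 := abs_add_le (bellman M ε R g 0) (bellman M ε R g x - bellman M ε R g 0)
    rw [add_sub_cancel] at e5
    exact e5.trans (add_le_add_right (e1.trans e4) _)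
  have hgb : ∀ x, |g x| ≤ max |a| |b| := fun x => abs_le_max_abs_abs (hgI x).1 (hgI x).2
  have hc : ∀ m, ∫ x, g x * gibbs R (W m) x ∈ Set.Icc a b := fun m => by
    obtain ⟨B, Λ, Λ₂, hWm⟩ := hW m
    have hWf := hWm.lipschitzFDeriv
    exact integral_mul_mem_Icc (integrable_gibbs hR hWf.continuous hWf.sub_mul_norm_le)
      (hg.integrable_mul_gibbs hR hWf) (fun x => (gibbs_pos _ _ x).le) (hW1 m) hgI
  have hcl := hlim g hg.continuous _ hgb
  have hc0 : ∫ x, g x * gibbs R V x ∈ Set.Icc a b :=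
    isClosed_Icc.mem_of_tendsto hcl (Eventually.of_forall hc)
  have hε₁ : ε ∈ Set.Icc ε (√(ε ^ 2 + L₁ ^ 2 / R)) := ⟨le_rfl, (hr 0).1.trans (hr 0).2⟩
  have hcont : ContinuousOn (fun t => M t ε) (Set.Icc a b) :=
    (LipschitzOnWith.of_dist_le_mul (K := ⟨C, hB.nonneg⟩) fun x hx y hy => by
      have := hB.abs_sub_le y hy ε hε₁ x hx ε hε₁
      rwa [sub_self, abs_zero, add_zero] at this).continuousOn
  have hM : Tendsto (fun m => M (∫ x, g x * gibbs R (W m) x) ε) atTop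
      (𝓝 (M (∫ x, g x * gibbs R V x) ε)) :=
    (hcont _ hc0).tendsto.comp (tendsto_nhdsWithin_iff.2 ⟨hcl, Eventually.of_forall hc⟩)
  refine le_of_tendsto_of_tendsto' (hlim _ hFc _ hFb) hM fun m => ?_
  obtain ⟨B, Λ, Λ₂, hWm⟩ := hW m
  exact hB.integral_bellman_le hR hε hWm (hW1 m) hg hgI

end Potential

section Final

lemma LipschitzFDeriv.of_contDiff {E : Type*} [NormedAddCommGroup E] [NormedSpace ℝ E] {g : E → ℝ}
    (hg : ContDiff ℝ 2 g) {L₁ L₂ : ℝ} (h₁ : ∀ x, ‖iteratedFDeriv ℝ 1 g x‖ ≤ L₁)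
    (h₂ : ∀ x, ‖iteratedFDeriv ℝ 2 g x‖ ≤ L₂) : LipschitzFDeriv L₁ L₂ g where
  differentiable := hg.differentiable two_ne_zero
  norm_fderiv_le x := by
    have := h₁ x
    rwa [← norm_iteratedFDeriv_fderiv, norm_iteratedFDeriv_zero] at this
  norm_fderiv_sub_le x y := by
    refine convex_univ.norm_image_sub_le_of_norm_fderiv_le (𝕜 := ℝ)
      (fun z _ => ((hg.fderiv_right (m := 1) (by norm_num)).differentiable one_ne_zero) z)
      (fun z _ => ?_) (Set.mem_univ y) (Set.mem_univ x)
    have := h₂ z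
    rwa [← norm_iteratedFDeriv_fderiv, ← norm_iteratedFDeriv_fderiv,
      norm_iteratedFDeriv_zero] at this
  nonneg := (norm_nonneg _).trans (h₂ 0)

lemma supporting_of_le_fderiv2 {n : ℕ} {R : ℝ} {U : EuclideanSpace ℝ (Fin n) → ℝ}
    (hU : ContDiff ℝ 2 U)
    (hHess : ∀ x v : EuclideanSpace ℝ (Fin n), R * ‖v‖ ^ 2 ≤ fderiv ℝ (fderiv ℝ U) x v v)
    (x y : EuclideanSpace ℝ (Fin n)) :
    (U y - R / 2 * ‖y‖ ^ 2) + (fderiv ℝ U y - R • innerSL ℝ y) (x - y)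
      ≤ U x - R / 2 * ‖x‖ ^ 2 := by
  have hd1 : fderiv ℝ (fun z => -U z) = fun z => -fderiv ℝ U z := funext fun z => fderiv_neg
  have hd2 : ∀ z, fderiv ℝ (fun z => -fderiv ℝ U z) z = -fderiv ℝ (fderiv ℝ U) z :=
    fun z => fderiv_neg
  have h := le_taylor_of_fderiv2_le (m := fun z => -U z) (P := y) (Q := x)
    (D := -(R * ‖x - y‖ ^ 2)) isOpen_univ
    hU.neg.contDiffOn (Set.subset_univ _) fun z _ => by
      rw [hd1, hd2]
      exact neg_le_neg (hHess z (x - y))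
  rw [hd1] at h
  have hxy : ‖x‖ ^ 2 = ‖y‖ ^ 2 + 2 * inner ℝ y (x - y) + ‖x - y‖ ^ 2 := by
    rw [← norm_add_sq_real, add_sub_cancel]
  simp only [neg_apply, sub_apply, smul_apply, innerSL_apply_apply, smul_eq_mul] at h ⊢
  rw [hxy]
  linarith

lemma integral_bellman_of_forall_eq {n : ℕ} {M : ℝ → ℝ → ℝ} {R c : ℝ}
    {μ : Measure (EuclideanSpace ℝ (Fin n))} [IsProbabilityMeasure μ]
    {g : EuclideanSpace ℝ (Fin n) → ℝ} (hg : ∀ x, g x = c) :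
    ∫ x, M (g x) (‖fderiv ℝ g x‖ / √R) ∂μ ≤ M (∫ x, g x ∂μ) 0 := by
  obtain rfl : g = fun _ => c := funext hg
  simp

variable {n : ℕ} {R a b : ℝ} {M : ℝ → ℝ → ℝ} {U g : EuclideanSpace ℝ (Fin n) → ℝ}
  {μ : Measure (EuclideanSpace ℝ (Fin n))}

lemma integral_eq_integral_mul_gibbs (hU : Continuous U)
    (hμ : μ = volume.withDensity (fun x => ENNReal.ofReal (exp (-U x)))) (R : ℝ)
    (F : EuclideanSpace ℝ (Fin n) → ℝ) :
    ∫ x, F x ∂μ = ∫ x, F x * gibbs R (fun y => U y - R / 2 * ‖y‖ ^ 2) x := by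
  rw [hμ, integral_withDensity_eq_integral_toReal_smul
    (by fun_prop : Continuous fun x => exp (-U x)).measurable.ennreal_ofReal
    (Filter.Eventually.of_forall fun x => ENNReal.ofReal_lt_top)]
  refine integral_congr_ae (Filter.Eventually.of_forall fun x => ?_)
  simp only [gibbs, smul_eq_mul, add_sub_cancel]
  rw [ENNReal.toReal_ofReal (exp_pos _).le, mul_comm]

lemma integral_bellman_le_of_mem_Ioo [NeZero n] [IsProbabilityMeasure μ]
    (hC2 : ContDiffOn ℝ 2 (fun p : ℝ × ℝ => M p.1 (Real.sqrt p.2))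
      (Set.Icc a b ×ˢ Set.Ici (0 : ℝ)))
    (hNeg : ∀ x ∈ Set.Icc a b, ∀ y : ℝ, 0 < y → (Mmat M x y).NegSemidef') (hR : 0 < R)
    (hU : ContDiff ℝ 2 U)
    (hHess : ∀ x v : EuclideanSpace ℝ (Fin n), R * ‖v‖ ^ 2 ≤ fderiv ℝ (fderiv ℝ U) x v v)
    (hμ : μ = volume.withDensity (fun x => ENNReal.ofReal (exp (-U x))))
    {a' b' ε L₁ L₂ : ℝ} (hg : LipschitzFDeriv L₁ L₂ g) (ha : a < a') (hb : b' < b)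
    (hgI : ∀ x, g x ∈ Set.Icc a' b') (hε : 0 < ε) :
    ∫ x, bellman M ε R g x ∂μ ≤ M (∫ x, g x ∂μ) ε := by
  obtain ⟨p, q, C, hB⟩ := exists_bellmanTaylor (r₁ := √(ε ^ 2 + L₁ ^ 2 / R)) hC2 hNeg ha hb hε
  have hμ' := integral_eq_integral_mul_gibbs hU.continuous hμ R
  rw [hμ', hμ']
  refine hB.integral_bellman_le_of_supporting hR hε
    (ℓ := fun y => fderiv ℝ U y - R • innerSL ℝ y) ?_ (supporting_of_le_fderiv2 hU hHess) ?_ hg hgI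
  · exact (hU.continuous_fderiv two_ne_zero).sub ((innerSL ℝ).continuous.const_smul R)
  · have := hμ' fun _ => 1
    simpa using this.symm

open Filter Topology in
lemma integral_le_of_forall_interior [IsProbabilityMeasure μ] (hab : a < b)
    (hM : ContinuousOn (Function.uncurry M) (Set.Icc a b ×ˢ Set.Ici 0)) (hR : 0 < R)
    {L₁ L₂ : ℝ} (hg : LipschitzFDeriv L₁ L₂ g) (hgI : ∀ x, g x ∈ Set.Icc a b)
    (H : ∀ (a' b' ε : ℝ) (g' : EuclideanSpace ℝ (Fin n) → ℝ), LipschitzFDeriv L₁ L₂ g' → a < a' →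
      b' < b → (∀ x, g' x ∈ Set.Icc a' b') → 0 < ε →
      ∫ x, bellman M ε R g' x ∂μ ≤ M (∫ x, g' x ∂μ) ε) :
    ∫ x, M (g x) (‖fderiv ℝ g x‖ / √R) ∂μ ≤ M (∫ x, g x ∂μ) 0 := by
  set c := (a + b) / 2
  have hL₁ := hg.nonneg_left
  let θ : ℕ → ℝ := fun k => 1 / ((k : ℝ) + 1)
  have hθ0 : ∀ k, 0 < θ k := fun k => Nat.one_div_pos_of_nat
  have hθ1 : ∀ k, θ k ≤ 1 := fun k => by
    rw [div_le_one (by positivity)]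
    linarith [k.cast_nonneg (α := ℝ)]
  have hθ : Tendsto θ atTop (𝓝 0) := tendsto_one_div_add_atTop_nhds_zero_nat
  let G : ℕ → EuclideanSpace ℝ (Fin n) → ℝ := fun k x => (1 - θ k) * g x + θ k * c
  have hGd : ∀ k x, fderiv ℝ (G k) x = (1 - θ k) • fderiv ℝ g x := fun k x => by
    rw [fderiv_add_const, fderiv_const_mul (hg.differentiable x)]
  have hG : ∀ k, LipschitzFDeriv L₁ L₂ (G k) := fun k => by
    have h1 : |1 - θ k| ≤ 1 := abs_le.2 ⟨by linarith [hθ1 k], by linarith [hθ0 k]⟩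
    refine ⟨(hg.differentiable.const_mul _).add_const _, fun x => ?_, fun x y => ?_, hg.nonneg⟩
    · rw [hGd, norm_smul, Real.norm_eq_abs]
      exact (mul_le_of_le_one_left (norm_nonneg _) h1).trans (hg.norm_fderiv_le x)
    · rw [hGd, hGd, ← smul_sub, norm_smul, Real.norm_eq_abs]
      exact (mul_le_of_le_one_left (norm_nonneg _) h1).trans (hg.norm_fderiv_sub_le x y)
  have hGI : ∀ k x, G k x ∈ Set.Icc (a + θ k * ((b - a) / 2)) (b - θ k * ((b - a) / 2)) :=
    fun k x => by
      have h1 := mul_le_mul_of_nonneg_left (hgI x).1 (sub_nonneg.2 (hθ1 k))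
      have h2 := mul_le_mul_of_nonneg_left (hgI x).2 (sub_nonneg.2 (hθ1 k))
      constructor <;> simp only [G, c] <;> linarith
  have hpos : ∀ k, 0 < θ k * ((b - a) / 2) := fun k => mul_pos (hθ0 k) (by linarith)
  have hGI' : ∀ k x, G k x ∈ Set.Icc a b := fun k x =>
    ⟨by linarith [(hGI k x).1, hpos k], by linarith [(hGI k x).2, hpos k]⟩
  have hineq : ∀ k, ∫ x, bellman M (θ k) R (G k) x ∂μ ≤ M (∫ x, G k x ∂μ) (θ k) := fun k =>
    H _ _ _ _ (hG k) (lt_add_of_pos_right a (hpos k)) (sub_lt_self b (hpos k)) (hGI k) (hθ0 k)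
  have hgi : Integrable g μ := Integrable.of_mem_Icc a b hg.continuous.aemeasurable
    (Eventually.of_forall hgI)
  have hGint : ∀ k, ∫ x, G k x ∂μ = (1 - θ k) * ∫ x, g x ∂μ + θ k * c := fun k => by
    rw [integral_add (hgi.const_mul _) (integrable_const _), integral_const_mul]
    simp
  have hmean : ∀ {f : EuclideanSpace ℝ (Fin n) → ℝ}, Continuous f → (∀ x, f x ∈ Set.Icc a b) →
      ∫ x, f x ∂μ ∈ Set.Icc a b := fun {f} hf hfI =>
    (convex_Icc a b).integral_mem isClosed_Icc (Eventually.of_forall hfI)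
      (Integrable.of_mem_Icc a b hf.aemeasurable (Eventually.of_forall hfI))
  set r₁ := √(1 + L₁ ^ 2 / R)
  have hreg0 : ∀ k x, 0 ≤ regNorm (θ k) R (fderiv ℝ (G k) x) := fun k x => sqrt_nonneg _
  have hreg : ∀ k x, regNorm (θ k) R (fderiv ℝ (G k) x) ≤ r₁ := fun k x => by
    refine (regNorm_mem_Icc hR ((hG k).norm_fderiv_le x)).2.trans (sqrt_le_sqrt ?_)
    have := pow_le_one₀ (hθ0 k).le (hθ1 k) (n := 2)
    linarith
  obtain ⟨A, hA⟩ := (isCompact_Icc.prod isCompact_Icc).exists_bound_of_continuousOn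
    (hM.mono (Set.prod_mono_right fun r hr => hr.1 : Set.Icc a b ×ˢ Set.Icc 0 r₁ ⊆ _))
  have hGc : ∀ x, Tendsto (fun k => G k x) atTop (𝓝 (g x)) := fun x => by
    have : Tendsto (fun k => (1 - θ k) * g x + θ k * c) atTop (𝓝 ((1 - 0) * g x + 0 * c)) :=
      ((hθ.const_sub 1).mul_const _).add (hθ.mul_const c)
    simpa using this
  have hregc : ∀ x, Tendsto (fun k => regNorm (θ k) R (fderiv ℝ (G k) x)) atTop
      (𝓝 (‖fderiv ℝ g x‖ / √R)) := fun x => by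
    have : Tendsto (fun k => √(θ k ^ 2 + ‖(1 - θ k) • fderiv ℝ g x‖ ^ 2 / R)) atTop
        (𝓝 (√(0 ^ 2 + ‖(1 - (0 : ℝ)) • fderiv ℝ g x‖ ^ 2 / R))) :=
      ((hθ.pow 2).add (((((hθ.const_sub 1).smul_const _).norm).pow 2).div_const R)).sqrt
    rw [sub_zero, one_smul, zero_pow two_ne_zero, zero_add, sqrt_div (sq_nonneg _),
      sqrt_sq (norm_nonneg _)] at this
    simpa only [regNorm, hGd] using this
  have hMlim : ∀ {u s : ℕ → ℝ} {u₀ s₀ : ℝ}, Tendsto u atTop (𝓝 u₀) → Tendsto s atTop (𝓝 s₀) →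
      (∀ k, u k ∈ Set.Icc a b) → (∀ k, 0 ≤ s k) →
      Tendsto (fun k => M (u k) (s k)) atTop (𝓝 (M u₀ s₀)) := by
    intro u s u₀ s₀ hu hs huI hs0
    have hmem : (u₀, s₀) ∈ Set.Icc a b ×ˢ Set.Ici (0 : ℝ) :=
      ⟨isClosed_Icc.mem_of_tendsto hu (Eventually.of_forall huI),
        isClosed_Ici.mem_of_tendsto hs (Eventually.of_forall hs0)⟩
    exact (hM _ hmem).tendsto.comp (tendsto_nhdsWithin_iff.2
      ⟨hu.prodMk_nhds hs, Eventually.of_forall fun k => ⟨huI k, hs0 k⟩⟩)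
  have hlhs : Tendsto (fun k => ∫ x, bellman M (θ k) R (G k) x ∂μ) atTop
      (𝓝 (∫ x, M (g x) (‖fderiv ℝ g x‖ / √R) ∂μ)) := by
    refine tendsto_integral_of_dominated_convergence (fun _ => A) (fun k => ?_)
      (integrable_const A)
      (fun k => Eventually.of_forall fun x => hA (_, _) ⟨hGI' k x, hreg0 k x, hreg k x⟩)
      (Eventually.of_forall fun x => hMlim (hGc x) (hregc x) (hGI' · x) (hreg0 · x))
    have hc : Continuous fun x => (G k x, regNorm (θ k) R (fderiv ℝ (G k) x)) := by
      refine (hG k).continuous.prodMk (Continuous.sqrt ?_)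
      exact continuous_const.add (((hG k).continuous_fderiv.norm.pow 2).div_const R)
    exact (hM.comp_continuous hc fun x => ⟨hGI' k x, hreg0 k x⟩).aestronglyMeasurable
  have hint : Tendsto (fun k => ∫ x, G k x ∂μ) atTop (𝓝 (∫ x, g x ∂μ)) := by
    simp_rw [hGint]
    have := ((hθ.const_sub 1).mul_const (∫ x, g x ∂μ)).add (hθ.mul_const c)
    simpa using this
  exact le_of_tendsto_of_tendsto' hlhs
    (hMlim hint hθ (fun k => hmean (hG k).continuous (hGI' k)) fun k => (hθ0 k).le) hineq

end Final

/-- Corollary 2: the analogue of Theorem 1 for a uniformly log-concave probability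
measure `dμ = e^{-U} dx` with `Hess U ≥ R·Id`:
`∫ M(g, ‖∇g‖/√R) dμ ≤ M(∫ g dμ, 0)`. -/
theorem stmt_1 (a b : ℝ) (hab : a ≤ b) (M : ℝ → ℝ → ℝ)
    (hC2 : ContDiffOn ℝ 2 (fun p : ℝ × ℝ => M p.1 (Real.sqrt p.2))
      (Set.Icc a b ×ˢ Set.Ici (0 : ℝ)))
    (hNeg : ∀ x ∈ Set.Icc a b, ∀ y : ℝ, 0 < y → (Mmat M x y).NegSemidef')
    (n : ℕ) (R : ℝ) (hR : 0 < R)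
    (U : EuclideanSpace ℝ (Fin n) → ℝ) (hU : ContDiff ℝ (⊤ : ℕ∞) U)
    (hHess : ∀ x v : EuclideanSpace ℝ (Fin n), R * ‖v‖ ^ 2 ≤ fderiv ℝ (fderiv ℝ U) x v v)
    (μ : Measure (EuclideanSpace ℝ (Fin n)))
    (hμ : μ = volume.withDensity (fun x => ENNReal.ofReal (Real.exp (-U x))))
    (hprob : IsProbabilityMeasure μ)
    (g : EuclideanSpace ℝ (Fin n) → ℝ)
    (hg : ContDiff ℝ (⊤ : ℕ∞) g)
    (hgΩ : ∀ x, g x ∈ Set.Icc a b)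
    (hgd : ∀ i : ℕ, ∃ C : ℝ, ∀ x, ‖iteratedFDeriv ℝ i g x‖ ≤ C) :
    ∫ x, M (g x) (‖fderiv ℝ g x‖ / Real.sqrt R) ∂μ ≤ M (∫ x, g x ∂μ) 0 := by
  rcases hab.eq_or_lt with rfl | hab
  · exact integral_bellman_of_forall_eq fun x => le_antisymm (hgΩ x).2 (hgΩ x).1
  rcases n.eq_zero_or_pos with rfl | hn
  · exact integral_bellman_of_forall_eq fun x => congrArg g (Subsingleton.elim x 0)
  have : NeZero n := ⟨hn.ne'⟩
  obtain ⟨L₁, hL₁⟩ := hgd 1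
  obtain ⟨L₂, hL₂⟩ := hgd 2
  exact integral_le_of_forall_interior hab (continuousOn_uncurry_of_sqrt hC2) hR
    (LipschitzFDeriv.of_contDiff (contDiff_infty.1 hg 2) hL₁ hL₂) hgΩ
    fun a' b' ε g' hg' ha hb hgI hε =>
      integral_bellman_le_of_mem_Ioo hC2 hNeg hR (contDiff_infty.1 hU 2) hHess hμ hg' ha hb hgI hε
end

section
/- Let Ω ⊂ ℝ be a bounded closed interval and let M : Ω × [0,∞) → ℝ be such that (x,y) ↦ M(x,√y) is C² on Ω × [0,∞). If for all x ∈ Ω and all y > 0 the 2×2 matrix [[M_xx(x,y) + M_y(x,y)/y, M_xy(x,y)], [M_xy(x,y), M_yy(x,y)]] is negative semidefinite, then M_y(x,y) ≤ 0 for all x ∈ Ω and all y ≥ 0. -/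
open MeasureTheory Real

/-- If `t ↦ h √t` is `C²` on `[0, ∞)` and the second derivative of `h` is nonpositive on
`(0, ∞)`, then the first derivative of `h` is nonpositive on `[0, ∞)`. -/
theorem deriv_nonpos_of_contDiffOn_comp_sqrt {h : ℝ → ℝ}
    (hg : ContDiffOn ℝ 2 (fun t => h (√t)) (Set.Ici 0))
    (hneg : ∀ y, 0 < y → deriv (deriv h) y ≤ 0) {y : ℝ} (hy : 0 ≤ y) : deriv h y ≤ 0 := by
  have hmaps : Set.MapsTo (fun s : ℝ => s ^ 2) (Set.Ici 0) (Set.Ici 0) :=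
    fun s _ => sq_nonneg s
  have heq : ∀ s ∈ Set.Ici (0 : ℝ), h s = h (√(s ^ 2)) := fun s hs => by
    rw [Real.sqrt_sq hs]
  have hh : ContDiffOn ℝ 2 h (Set.Ici 0) :=
    (hg.comp (contDiff_id.pow 2).contDiffOn hmaps).congr heq
  have hzero : HasDerivWithinAt h 0 (Set.Ici 0) 0 := by
    have hg0 := ((hg.differentiableOn (by norm_num)) ((0 : ℝ) ^ 2)
      (by simp)).hasDerivWithinAt
    have hsq : HasDerivWithinAt (fun s : ℝ => s ^ 2) 0 (Set.Ici 0) 0 := by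
      simpa using (hasDerivAt_pow 2 (0 : ℝ)).hasDerivWithinAt (s := Set.Ici 0)
    have hcomp := HasDerivWithinAt.comp (h := fun s : ℝ => s ^ 2) (0 : ℝ) hg0 hsq hmaps
    rw [mul_zero] at hcomp
    exact hcomp.congr heq (heq 0 Set.self_mem_Ici)
  have huniq : UniqueDiffOn ℝ (Set.Ici (0 : ℝ)) := uniqueDiffOn_Ici 0
  have hderiv : ∀ s, 0 < s → derivWithin h (Set.Ici 0) s = deriv h s := fun s hs =>
    derivWithin_of_mem_nhds (Ici_mem_nhds hs)
  have hC1 : ContDiffOn ℝ 1 (derivWithin h (Set.Ici 0)) (Set.Ici 0) :=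
    hh.derivWithin huniq (by norm_num)
  have hanti : AntitoneOn (derivWithin h (Set.Ici 0)) (Set.Ici 0) := by
    refine antitoneOn_of_deriv_nonpos (convex_Ici 0) hC1.continuousOn
      ((hC1.differentiableOn (by norm_num)).mono interior_subset) fun s hs => ?_
    rw [interior_Ici, Set.mem_Ioi] at hs
    have hev : derivWithin h (Set.Ici 0) =ᶠ[nhds s] deriv h := by
      filter_upwards [Ioi_mem_nhds hs] with t ht using hderiv t ht
    rw [hev.deriv_eq]
    exact hneg s hs
  have hder0 : derivWithin h (Set.Ici 0) 0 = 0 := hzero.derivWithin (huniq 0 Set.self_mem_Ici)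
  rcases hy.eq_or_lt with rfl | hpos
  · by_cases hd : DifferentiableAt ℝ h 0
    · rw [← hd.derivWithin (huniq 0 Set.self_mem_Ici), hder0]
    · rw [deriv_zero_of_not_differentiableAt hd]
  · rw [← hderiv y hpos]
    exact (hanti Set.self_mem_Ici hy hy).trans_eq hder0

/-- negative semidefiniteness of the matrix
`[[M_xx + M_y/y, M_xy], [M_xy, M_yy]]` for all `x ∈ Ω`, `y > 0` implies
`M_y(x,y) ≤ 0` for all `x ∈ Ω`, `y ≥ 0`. -/
theorem stmt_2 (a b : ℝ) (hab : a ≤ b) (M : ℝ → ℝ → ℝ)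
    (hC2 : ContDiffOn ℝ 2 (fun p : ℝ × ℝ => M p.1 (Real.sqrt p.2))
      (Set.Icc a b ×ˢ Set.Ici (0 : ℝ)))
    (hNeg : ∀ x ∈ Set.Icc a b, ∀ y : ℝ, 0 < y → (Mmat M x y).NegSemidef') :
    ∀ x ∈ Set.Icc a b, ∀ y : ℝ, 0 ≤ y → My M x y ≤ 0 := by
  intro x hx y hy
  refine deriv_nonpos_of_contDiffOn_comp_sqrt (h := fun s => M x s) ?_ (fun s hs => ?_) hy
  · exact hC2.comp (f := fun t : ℝ => (x, t)) (contDiff_const.prodMk contDiff_id).contDiffOn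
      fun t ht => ⟨hx, ht⟩
  · have hdiag := (hNeg x hx s hs).diag_nonneg (i := 1)
    have hMyy : Myy M x s ≤ 0 := by simpa [Mmat] using hdiag
    exact hMyy
end

section
/- Let R > 0 and let μ = e^{-U(x)} dx be a probability measure on ℝⁿ with U smooth and Hess U(x) ≥ R·Id for all x. Then for every smooth bounded function g : ℝⁿ → (0,∞) with bounded derivatives whose values lie in a compact subinterval of (0,∞), ∫_{ℝⁿ} ( g·ln g − ‖∇g‖²/(2R·g) ) dμ ≤ (∫_{ℝⁿ} g dμ) · ln(∫_{ℝⁿ} g dμ). -/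
open MeasureTheory Real

section

open scoped ENNReal Pointwise

/-- A measure satisfies the Prékopa–Leindler inequality. -/
def PrekopaLeindler {E : Type*} [AddCommGroup E] [Module ℝ E] [MeasurableSpace E]
    (μ : Measure E) : Prop :=
  ∀ ⦃t s : ℝ⦄, 0 < t → 0 < s → t + s = 1 → ∀ ⦃u v w : E → ℝ≥0∞⦄,
    Measurable u → Measurable v → Measurable w →
    (∀ x y, u x ^ t * v y ^ s ≤ w (t • x + s • y)) →
    (∫⁻ x, u x ∂μ) ^ t * (∫⁻ x, v x ∂μ) ^ s ≤ ∫⁻ x, w x ∂μ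

/-- Weighted arithmetic–geometric mean inequality in `ℝ≥0∞`. -/
theorem ENNReal.rpow_mul_rpow_le_weighted_add {t s : ℝ} (ht : 0 < t) (hs : 0 < s)
    (hts : t + s = 1) (p q : ℝ≥0∞) :
    p ^ t * q ^ s ≤ ENNReal.ofReal t * p + ENNReal.ofReal s * q := by
  by_cases hp : p = ∞
  · simp [hp, ENNReal.mul_top, ht]
  by_cases hq : q = ∞
  · simp [hq, ENNReal.mul_top, hs]
  lift p to NNReal using hp
  lift q to NNReal using hq
  have h := NNReal.geom_mean_le_arith_mean2_weighted t.toNNReal s.toNNReal p q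
    (by rw [← Real.toNNReal_add ht.le hs.le, hts, Real.toNNReal_one])
  rw [Real.coe_toNNReal _ ht.le, Real.coe_toNNReal _ hs.le] at h
  rw [← ENNReal.coe_rpow_of_nonneg _ ht.le, ← ENNReal.coe_rpow_of_nonneg _ hs.le]
  unfold ENNReal.ofReal
  exact_mod_cast h

/-- The Brunn–Minkowski inequality for compact subsets of the line. -/
theorem IsCompact.volume_add_volume_le_volume_add {A B : Set ℝ} (hA : IsCompact A)
    (hB : IsCompact B) (hA' : A.Nonempty) (hB' : B.Nonempty) :
    volume A + volume B ≤ volume (A + B) := by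
  obtain ⟨p, hp, hpA⟩ := hA.exists_isGreatest hA'
  obtain ⟨q, hq, hqB⟩ := hB.exists_isLeast hB'
  have hinter : (A + {q}) ∩ ({p} + B) ⊆ {p + q} := by
    rintro _ ⟨⟨x, hx, _, rfl, rfl⟩, ⟨_, rfl, y, hy, h⟩⟩
    have h1 := hpA hx
    have h2 := hqB hy
    simp only [Set.mem_singleton_iff] at h ⊢
    linarith
  have h0 : volume ((A + {q}) ∩ ({p} + B)) = 0 :=
    measure_mono_null hinter (by simp)
  have hm : MeasurableSet ({p} + B) := (isCompact_singleton.add hB).measurableSet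
  have h1 := measure_union_add_inter (μ := volume) (A + {q}) hm
  rw [h0, add_zero] at h1
  have hAq : volume (A + {q}) = volume A := by
    simp
  have hBp : volume ({p} + B) = volume B := by
    simp
  rw [hAq, hBp] at h1
  rw [← h1]
  apply measure_mono
  apply Set.union_subset
  · exact Set.add_subset_add_left (by simpa using hq)
  · exact Set.add_subset_add_right (by simpa using hp)

/-- The Brunn–Minkowski inequality on the line, for convex combinations of nonempty sets. -/
theorem volume_convex_comb_le {t s : ℝ} (ht : 0 < t) (hs : 0 < s) {A B S : Set ℝ}
    (hA : MeasurableSet A) (hB : MeasurableSet B) (hA' : A.Nonempty) (hB' : B.Nonempty)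
    (h : ∀ x ∈ A, ∀ y ∈ B, t * x + s * y ∈ S) :
    ENNReal.ofReal t * volume A + ENNReal.ofReal s * volume B ≤ volume S := by
  obtain ⟨p, hp⟩ := hA'
  obtain ⟨q, hq⟩ := hB'
  have key : ∀ K : Set ℝ, K ⊆ A → IsCompact K → ∀ L : Set ℝ, L ⊆ B → IsCompact L →
      ENNReal.ofReal t * volume K + ENNReal.ofReal s * volume L ≤ volume S := by
    intro K hK hKc L hL hLc
    have hK1 : IsCompact (t • (insert p K)) := (hKc.insert p).smul t
    have hL1 : IsCompact (s • (insert q L)) := (hLc.insert q).smul s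
    have := hK1.volume_add_volume_le_volume_add hL1
      ((Set.insert_nonempty p K).smul_set) ((Set.insert_nonempty q L).smul_set)
    rw [Measure.addHaar_smul_of_nonneg _ ht.le, Measure.addHaar_smul_of_nonneg _ hs.le] at this
    simp only [Module.finrank_self, pow_one] at this
    calc _ ≤ ENNReal.ofReal t * volume (insert p K) + ENNReal.ofReal s * volume (insert q L) := by
          gcongr <;> exact Set.subset_insert _ _
      _ ≤ _ := this
      _ ≤ volume S := by
          apply measure_mono
          rintro _ ⟨_, ⟨x, hx, rfl⟩, _, ⟨y, hy, rfl⟩, rfl⟩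
          exact h x (Set.insert_subset hp hK hx) y (Set.insert_subset hq hL hy)
  rw [hA.measure_eq_iSup_isCompact, hB.measure_eq_iSup_isCompact]
  simp only [ENNReal.mul_iSup]
  simp only [iSup_and']
  refine ENNReal.biSup_add_biSup_le' ⟨∅, Set.empty_subset _, isCompact_empty⟩
    ⟨∅, Set.empty_subset _, isCompact_empty⟩ fun K hK L hL => key K hK.1 hK.2 L hL.1 hL.2

/-- The additive form of the Prékopa–Leindler inequality on the line. -/
theorem lintegral_weighted_add_le_of_iSup_eq_one {t s : ℝ} (ht : 0 < t) (hs : 0 < s)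
    (hts : t + s = 1) {u v w : ℝ → ℝ≥0∞} (hu : Measurable u) (hv : Measurable v)
    (hw : Measurable w) (hu1 : ⨆ x, u x = 1) (hv1 : ⨆ x, v x = 1)
    (h : ∀ x y, u x ^ t * v y ^ s ≤ w (t * x + s * y)) :
    ENNReal.ofReal t * (∫⁻ x, u x) + ENNReal.ofReal s * (∫⁻ x, v x) ≤ ∫⁻ x, w x := by
  have hu1' : ∀ x, u x ≤ 1 := fun x => hu1 ▸ le_iSup u x
  have hv1' : ∀ x, v x ≤ 1 := fun x => hv1 ▸ le_iSup v x
  have layer : ∀ f : ℝ → ℝ≥0∞, Measurable f → (∀ x, f x ≤ 1) →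
      ∫⁻ x, f x = ∫⁻ r in Set.Ioi (0 : ℝ), volume {x | ENNReal.ofReal r < f x} := by
    intro f hf hf1
    have hfin : ∀ x, f x ≠ ∞ := fun x => ((hf1 x).trans_lt ENNReal.one_lt_top).ne
    have := lintegral_eq_lintegral_meas_lt volume (f := fun x => (f x).toReal)
      (ae_of_all _ fun x => ENNReal.toReal_nonneg) hf.ennreal_toReal.aemeasurable
    simp only [ENNReal.ofReal_toReal (hfin _)] at this
    rw [this]
    refine setLIntegral_congr_fun measurableSet_Ioi fun r hr => ?_
    simp only [ENNReal.ofReal_lt_iff_lt_toReal (le_of_lt hr) (hfin _)]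
  have hmeas : ∀ f : ℝ → ℝ≥0∞, Measurable fun r : ℝ => volume {x | ENNReal.ofReal r < f x} := by
    intro f
    refine Antitone.measurable fun r r' hr => measure_mono fun x hx => ?_
    exact (ENNReal.ofReal_le_ofReal hr).trans_lt hx
  rw [layer u hu hu1', layer v hv hv1']
  calc _ = ∫⁻ r in Set.Ioi (0 : ℝ), (ENNReal.ofReal t * volume {x | ENNReal.ofReal r < u x}
          + ENNReal.ofReal s * volume {x | ENNReal.ofReal r < v x}) := by
        rw [lintegral_add_left ((hmeas u).const_mul _), lintegral_const_mul _ (hmeas u),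
          lintegral_const_mul _ (hmeas v)]
    _ ≤ ∫⁻ r in Set.Ioi (0 : ℝ), volume {x | ENNReal.ofReal r < min (w x) 1} := by
        refine setLIntegral_mono (hmeas _) fun r hr => ?_
        rcases le_or_gt 1 (ENNReal.ofReal r) with h1 | h1
        · simp [not_lt.2 ((hu1' _).trans h1), not_lt.2 ((hv1' _).trans h1)]
        · obtain ⟨x₀, hx₀⟩ := lt_iSup_iff.1 (h1.trans_eq hu1.symm)
          obtain ⟨y₀, hy₀⟩ := lt_iSup_iff.1 (h1.trans_eq hv1.symm)
          refine volume_convex_comb_le ht hs (measurableSet_lt measurable_const hu)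
            (measurableSet_lt measurable_const hv) ⟨x₀, hx₀⟩ ⟨y₀, hy₀⟩ fun x hx y hy => ?_
          refine lt_min (lt_of_lt_of_le ?_ (h x y)) h1
          have hr0 : ENNReal.ofReal r ≠ 0 := by simpa using hr
          calc ENNReal.ofReal r = ENNReal.ofReal r ^ t * ENNReal.ofReal r ^ s := by
                rw [← ENNReal.rpow_add _ _ hr0 ENNReal.ofReal_ne_top, hts, ENNReal.rpow_one]
            _ < u x ^ t * v y ^ s := ENNReal.mul_lt_mul (ENNReal.rpow_lt_rpow hx ht)
                (ENNReal.rpow_lt_rpow hy hs)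
    _ = ∫⁻ x, min (w x) 1 := (layer _ (hw.min measurable_const) fun x => min_le_right _ _).symm
    _ ≤ ∫⁻ x, w x := lintegral_mono fun x => min_le_left _ _

theorem prekopaLeindler_real_of_bounded {t s : ℝ} (ht : 0 < t) (hs : 0 < s)
    (hts : t + s = 1) {u v w : ℝ → ℝ≥0∞} (hu : Measurable u) (hv : Measurable v)
    (hw : Measurable w) (hub : ⨆ x, u x ≠ ∞) (hvb : ⨆ x, v x ≠ ∞)
    (h : ∀ x y, u x ^ t * v y ^ s ≤ w (t * x + s * y)) :
    (∫⁻ x, u x) ^ t * (∫⁻ x, v x) ^ s ≤ ∫⁻ x, w x := by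
  set M := ⨆ x, u x with hM
  set N := ⨆ x, v x with hN
  by_cases hM0 : M = 0
  · have : ∀ x, u x = 0 := by simpa using hM.symm.trans hM0
    simp [this, ht]
  by_cases hN0 : N = 0
  · have : ∀ x, v x = 0 := by simpa using hN.symm.trans hN0
    simp [this, hs]
  set c := M ^ t * N ^ s with hc
  have hc0 : c ≠ 0 := mul_ne_zero (by simp [hM0, hub]) (by simp [hN0, hvb])
  have hct : c ≠ ∞ := ENNReal.mul_ne_top (by simp [hub, hM0]) (by simp [hvb, hN0])
  have key := lintegral_weighted_add_le_of_iSup_eq_one ht hs hts (u := fun x => M⁻¹ * u x)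
    (v := fun x => N⁻¹ * v x) (w := fun x => c⁻¹ * w x) (hu.const_mul _) (hv.const_mul _)
    (hw.const_mul _) (by rw [← ENNReal.mul_iSup, ← hM, ENNReal.inv_mul_cancel hM0 hub])
    (by rw [← ENNReal.mul_iSup, ← hN, ENNReal.inv_mul_cancel hN0 hvb]) (fun x y => by
      refine le_trans (le_of_eq ?_) (mul_le_mul_right (h x y) c⁻¹)
      rw [ENNReal.mul_rpow_of_nonneg _ _ ht.le, ENNReal.mul_rpow_of_nonneg _ _ hs.le, hc,
        ENNReal.mul_inv (.inl (by simp [hM0, hub])) (.inl (by simp [hM0, hub])),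
        ENNReal.inv_rpow, ENNReal.inv_rpow]
      ring)
  rw [lintegral_const_mul _ hu, lintegral_const_mul _ hv, lintegral_const_mul _ hw] at key
  have key2 := (ENNReal.rpow_mul_rpow_le_weighted_add ht hs hts _ _).trans key
  calc (∫⁻ x, u x) ^ t * (∫⁻ x, v x) ^ s
      = c * ((M⁻¹ * ∫⁻ x, u x) ^ t * (N⁻¹ * ∫⁻ x, v x) ^ s) := by
        have : c * c⁻¹ = 1 := ENNReal.mul_inv_cancel hc0 hct
        rw [ENNReal.mul_rpow_of_nonneg _ _ ht.le, ENNReal.mul_rpow_of_nonneg _ _ hs.le,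
          ENNReal.inv_rpow, ENNReal.inv_rpow]
        rw [hc, ENNReal.mul_inv (.inl (by simp [hM0, hub])) (.inl (by simp [hM0, hub])), ← hc]
          at this
        rw [mul_mul_mul_comm (M ^ t)⁻¹, ← mul_assoc c, this, one_mul]
    _ ≤ c * (c⁻¹ * ∫⁻ x, w x) := by gcongr
    _ = ∫⁻ x, w x := by rw [← mul_assoc, ENNReal.mul_inv_cancel hc0 hct, one_mul]

theorem tendsto_lintegral_min_natCast {α : Type*} [MeasurableSpace α] (μ : Measure α)
    {u : α → ℝ≥0∞} (hu : Measurable u) :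
    Filter.Tendsto (fun k : ℕ => ∫⁻ x, min (u x) k ∂μ) Filter.atTop (nhds (∫⁻ x, u x ∂μ)) := by
  refine lintegral_tendsto_of_tendsto_of_monotone
    (fun k => (hu.min measurable_const).aemeasurable)
    (ae_of_all _ fun x k l hkl => min_le_min_left _ (by exact_mod_cast hkl))
    (ae_of_all _ fun x => ?_)
  simpa using (tendsto_const_nhds (x := u x)).min ENNReal.tendsto_nat_nhds_top

/-- The Prékopa–Leindler inequality on the line. -/
theorem prekopaLeindler_real : PrekopaLeindler (volume : Measure ℝ) := by
  intro t s ht hs hts u v w hu hv hw h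
  by_cases hu0 : ∫⁻ x, u x = 0
  · simp [hu0, ht]
  by_cases hv0 : ∫⁻ x, v x = 0
  · simp [hv0, hs]
  have hlim : Filter.Tendsto (fun k : ℕ => (∫⁻ x, min (u x) k) ^ t * (∫⁻ x, min (v x) k) ^ s)
      Filter.atTop (nhds ((∫⁻ x, u x) ^ t * (∫⁻ x, v x) ^ s)) := by
    refine ENNReal.Tendsto.mul
      ((ENNReal.continuous_rpow_const.tendsto _).comp (tendsto_lintegral_min_natCast volume hu))
      (.inl ?_)
      ((ENNReal.continuous_rpow_const.tendsto _).comp (tendsto_lintegral_min_natCast volume hv))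
      (.inl ?_)
    · simp [hu0, ht.le, ht]
    · simp [hv0, hs.le, hs]
  refine le_of_tendsto' hlim fun k => ?_
  have hb : ∀ f : ℝ → ℝ≥0∞, ⨆ x, min (f x) k ≠ ∞ := fun f =>
    ((iSup_le fun x => min_le_right _ _).trans_lt (ENNReal.natCast_lt_top k)).ne
  refine prekopaLeindler_real_of_bounded ht hs hts (hu.min measurable_const)
    (hv.min measurable_const) hw (hb u) (hb v) fun x y => le_trans ?_ (h x y)
  gcongr <;> exact min_le_left _ _

theorem PrekopaLeindler.prod {E F : Type*} [AddCommGroup E] [Module ℝ E] [MeasurableSpace E]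
    [AddCommGroup F] [Module ℝ F] [MeasurableSpace F] {μ : Measure E} {ν : Measure F} [SFinite ν]
    (hμ : PrekopaLeindler μ) (hν : PrekopaLeindler ν) : PrekopaLeindler (μ.prod ν) := by
  intro t s ht hs hts u v w hu hv hw h
  rw [lintegral_prod _ hu.aemeasurable, lintegral_prod _ hv.aemeasurable,
    lintegral_prod _ hw.aemeasurable]
  exact hμ ht hs hts hu.lintegral_prod_right' hv.lintegral_prod_right' hw.lintegral_prod_right'
    fun x y => hν ht hs hts (by fun_prop) (by fun_prop) (by fun_prop)
      fun x' y' => h (x, x') (y, y')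

theorem PrekopaLeindler.map {E F : Type*} [AddCommGroup E] [Module ℝ E] [MeasurableSpace E]
    [AddCommGroup F] [Module ℝ F] [MeasurableSpace F] {μ : Measure E} {ν : Measure F}
    (hμ : PrekopaLeindler μ) (f : E →ₗ[ℝ] F) (hf : MeasurePreserving f μ ν) :
    PrekopaLeindler ν := by
  intro t s ht hs hts u v w hu hv hw h
  rw [← hf.lintegral_comp hu, ← hf.lintegral_comp hv, ← hf.lintegral_comp hw]
  refine hμ ht hs hts (hu.comp hf.measurable) (hv.comp hf.measurable) (hw.comp hf.measurable)
    fun x y => ?_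
  simpa using h (f x) (f y)

theorem prekopaLeindler_pi (n : ℕ) : PrekopaLeindler (volume : Measure (Fin n → ℝ)) := by
  induction n with
  | zero =>
    intro t s ht hs hts u v w hu hv hw h
    simp only [lintegral_unique, Measure.volume_pi_eq_dirac default, measure_univ, mul_one]
    convert h default default
  | succ n ih =>
    refine (prekopaLeindler_real.prod ih).map
      { toFun := (MeasurableEquiv.piFinSuccAbove (fun _ : Fin (n + 1) => ℝ) 0).symm
        map_add' := fun x y => ?_
        map_smul' := fun c x => ?_ }
      (volume_preserving_piFinSuccAbove (fun _ : Fin (n + 1) => ℝ) 0).symm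
    · ext i
      refine Fin.cases ?_ (fun j => ?_) i <;> simp [MeasurableEquiv.piFinSuccAbove]
    · ext i
      refine Fin.cases ?_ (fun j => ?_) i <;> simp [MeasurableEquiv.piFinSuccAbove]

/-- The Prékopa–Leindler inequality on Euclidean space. -/
theorem prekopaLeindler_euclideanSpace (n : ℕ) :
    PrekopaLeindler (volume : Measure (EuclideanSpace ℝ (Fin n))) :=
  (prekopaLeindler_pi n).map (WithLp.linearEquiv 2 ℝ (Fin n → ℝ)).symm.toLinearMap
    (PiLp.volume_preserving_toLp (Fin n))

/-- A lower bound on the Hessian gives quantitative convexity. -/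
theorem add_mul_norm_sq_le_of_le_hessian {E : Type*} [NormedAddCommGroup E] [NormedSpace ℝ E]
    {R : ℝ} {U : E → ℝ} (hU : ContDiff ℝ 2 U)
    (hHess : ∀ x v : E, R * ‖v‖ ^ 2 ≤ fderiv ℝ (fderiv ℝ U) x v v)
    {t s : ℝ} (ht : 0 ≤ t) (hs : 0 ≤ s) (hts : t + s = 1) (x y : E) :
    U (t • x + s • y) + R / 2 * (t * s) * ‖x - y‖ ^ 2 ≤ t * U x + s * U y := by
  set d := x - y with hd
  have hline : ∀ r : ℝ, HasDerivAt (fun r : ℝ => y + r • d) d r := fun r => by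
    simpa using ((hasDerivAt_id r).smul_const d).const_add y
  have hU1 : Differentiable ℝ U := hU.differentiable (by norm_num)
  have hU2 : Differentiable ℝ (fderiv ℝ U) :=
    (hU.fderiv_right (m := 1) (by norm_num)).differentiable (by norm_num)
  have h1 : ∀ r : ℝ, HasDerivAt (fun r : ℝ => U (y + r • d) - R / 2 * ‖d‖ ^ 2 * r ^ 2)
      (fderiv ℝ U (y + r • d) d - R * ‖d‖ ^ 2 * r) r := fun r => by
    have := ((hU1 _).hasFDerivAt.comp_hasDerivAt r (hline r)).sub
      ((hasDerivAt_pow 2 r).const_mul (R / 2 * ‖d‖ ^ 2))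
    refine this.congr_deriv ?_
    simp only [Nat.cast_ofNat, Nat.add_one_sub_one, pow_one]
    ring
  have h2 : ∀ r : ℝ, HasDerivAt (fun r : ℝ => fderiv ℝ U (y + r • d) d - R * ‖d‖ ^ 2 * r)
      (fderiv ℝ (fderiv ℝ U) (y + r • d) d d - R * ‖d‖ ^ 2) r := fun r => by
    have := (((hU2 _).hasFDerivAt.comp_hasDerivAt r (hline r)).clm_apply
      (hasDerivAt_const r d)).sub ((hasDerivAt_id r).const_mul (R * ‖d‖ ^ 2))
    refine this.congr_deriv ?_
    simp
  have hconv : ConvexOn ℝ Set.univ (fun r : ℝ => U (y + r • d) - R / 2 * ‖d‖ ^ 2 * r ^ 2) :=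
    convexOn_of_hasDerivWithinAt2_nonneg convex_univ
      (fun r _ => (h1 r).continuousAt.continuousWithinAt)
      (fun r _ => (h1 r).hasDerivWithinAt) (fun r _ => (h2 r).hasDerivWithinAt)
      fun r _ => sub_nonneg.2 (hHess _ d)
  have key := hconv.2 (Set.mem_univ 1) (Set.mem_univ 0) ht hs hts
  have e1 : y + (t * 1 + s * 0) • d = t • x + s • y := by
    have : s = 1 - t := by linarith
    subst this
    simp only [mul_one, mul_zero, add_zero, hd]
    module
  have e2 : y + (1 : ℝ) • d = x := by simp [hd]
  have e3 : y + (0 : ℝ) • d = y := by simp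
  simp only [smul_eq_mul, e1, e2, e3] at key
  have : s = 1 - t := by linarith
  subst this
  nlinarith

/-- First-order Taylor bound for a function whose second derivative is bounded. -/
theorem norm_sub_sub_fderiv_le_of_norm_fderiv_fderiv_le {E F : Type*} [NormedAddCommGroup E]
    [NormedSpace ℝ E] [NormedAddCommGroup F] [NormedSpace ℝ F] {g : E → F} (hg : ContDiff ℝ 2 g)
    {C : ℝ} (hC : ∀ x, ‖fderiv ℝ (fderiv ℝ g) x‖ ≤ C) (z x : E) :
    ‖g x - g z - fderiv ℝ g z (x - z)‖ ≤ C * ‖x - z‖ ^ 2 := by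
  have hg1 : Differentiable ℝ g := hg.differentiable (by norm_num)
  have hg2 : Differentiable ℝ (fderiv ℝ g) :=
    (hg.fderiv_right (m := 1) (by norm_num)).differentiable (by norm_num)
  have hC0 : 0 ≤ C := (norm_nonneg (fderiv ℝ (fderiv ℝ g) z)).trans (hC z)
  have hlip : ∀ y, ‖fderiv ℝ g y - fderiv ℝ g z‖ ≤ C * ‖y - z‖ := fun y =>
    convex_univ.norm_image_sub_le_of_norm_fderiv_le (fun w _ => hg2 w) (fun w _ => hC w)
      (Set.mem_univ z) (Set.mem_univ y)
  have := (convex_closedBall z ‖x - z‖).norm_image_sub_le_of_norm_fderiv_le' (𝕜 := ℝ)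
    (φ := fderiv ℝ g z) (C := C * ‖x - z‖)
    (fun w _ => hg1 w) (fun w hw => (hlip w).trans
      (mul_le_mul_of_nonneg_left (by simpa [dist_eq_norm] using hw) hC0))
    (Metric.mem_closedBall_self (norm_nonneg _)) (by simp [dist_eq_norm] : x ∈ _)
  rwa [mul_assoc, ← sq] at this

/-- Prékopa–Leindler for a probability measure with uniformly log-concave density, where the
second function is constant. -/
theorem integral_exp_rpow_le_of_le_hessian {n : ℕ} {R : ℝ} {U : EuclideanSpace ℝ (Fin n) → ℝ}
    (hU : ContDiff ℝ 2 U)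
    (hHess : ∀ x v : EuclideanSpace ℝ (Fin n), R * ‖v‖ ^ 2 ≤ fderiv ℝ (fderiv ℝ U) x v v)
    {μ : Measure (EuclideanSpace ℝ (Fin n))} [IsProbabilityMeasure μ]
    (hμ : μ = volume.withDensity (fun x => ENNReal.ofReal (Real.exp (-U x))))
    {t s : ℝ} (ht : 0 < t) (hs : 0 < s) (hts : t + s = 1)
    {F H : EuclideanSpace ℝ (Fin n) → ℝ} (hF : Measurable F) (hH : Measurable H)
    (hFi : Integrable (fun x => exp (F x)) μ) (hHi : Integrable (fun x => exp (H x)) μ)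
    (h : ∀ x y, t * F x ≤ H (t • x + s • y) + R / 2 * (t * s) * ‖x - y‖ ^ 2) :
    (∫ x, exp (F x) ∂μ) ^ t ≤ ∫ x, exp (H x) ∂μ := by
  have hUm : Measurable U := hU.continuous.measurable
  have hdens : ∀ G : EuclideanSpace ℝ (Fin n) → ℝ, Measurable G →
      ∫⁻ x, ENNReal.ofReal (exp (G x)) ∂μ = ∫⁻ x, ENNReal.ofReal (exp (G x - U x)) := by
    intro G hG
    rw [hμ, lintegral_withDensity_eq_lintegral_mul _ (by fun_prop) (by fun_prop)]
    refine lintegral_congr fun x => ?_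
    rw [Pi.mul_apply, ← ENNReal.ofReal_mul (exp_pos _).le, ← exp_add]
    congr 2
    ring
  have hone : ∫⁻ x, ENNReal.ofReal (exp (0 - U x)) = 1 := by
    rw [← hdens (fun _ => 0) measurable_const]
    simp
  have key := prekopaLeindler_euclideanSpace n ht hs hts
    (u := fun x => ENNReal.ofReal (exp (F x - U x))) (v := fun x => ENNReal.ofReal (exp (0 - U x)))
    (w := fun x => ENNReal.ofReal (exp (H x - U x))) (by fun_prop) (by fun_prop) (by fun_prop)
    fun x y => by
      rw [ENNReal.ofReal_rpow_of_pos (exp_pos _), ENNReal.ofReal_rpow_of_pos (exp_pos _),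
        ← ENNReal.ofReal_mul (by positivity), ← exp_mul, ← exp_mul, ← exp_add]
      refine ENNReal.ofReal_le_ofReal (exp_le_exp.2 ?_)
      have := add_mul_norm_sq_le_of_le_hessian hU hHess ht.le hs.le hts x y
      linarith [h x y]
  rw [hone, ENNReal.one_rpow, mul_one, ← hdens F hF, ← hdens H hH,
    ← ofReal_integral_eq_lintegral_ofReal hFi (ae_of_all _ fun x => (exp_pos _).le),
    ← ofReal_integral_eq_lintegral_ofReal hHi (ae_of_all _ fun x => (exp_pos _).le),
    ENNReal.ofReal_rpow_of_nonneg (integral_nonneg fun x => (exp_pos _).le) ht.le,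
    ENNReal.ofReal_le_ofReal_iff (integral_nonneg fun x => (exp_pos _).le)] at key
  exact key

theorem HasDerivAt.nonneg_of_eventually_nonneg_right {φ : ℝ → ℝ} {d x : ℝ}
    (hd : HasDerivAt φ d x) (h0 : φ x = 0) (h : ∀ᶠ s in nhdsWithin 0 (Set.Ioi 0), 0 ≤ φ (x + s)) :
    0 ≤ d := by
  refine ge_of_tendsto hd.tendsto_slope_zero_right ?_
  filter_upwards [h, self_mem_nhdsWithin] with s hs hs0
  rw [h0, sub_zero, smul_eq_mul]
  exact mul_nonneg (inv_nonneg.2 (le_of_lt hs0)) hs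

/-- Pointwise bound on the increments of `log g` with a quadratic penalty. -/
theorem log_le_log_add_of_norm_fderiv_fderiv_le {E : Type*} [NormedAddCommGroup E]
    [NormedSpace ℝ E] {g : E → ℝ} (hg : ContDiff ℝ 2 g) {a C R t s : ℝ} (ha : 0 < a)
    (hga : ∀ x, a ≤ g x) (hC : ∀ x, ‖fderiv ℝ (fderiv ℝ g) x‖ ≤ C) (hs : 0 < s)
    (hts : t + s = 1) (hB : 0 < R * t - 2 * (C / a) * s) (x y : E) :
    log (g x) ≤ log (g (t • x + s • y))
      + s / (2 * (R * t - 2 * (C / a) * s))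
        * (‖fderiv ℝ g (t • x + s • y)‖ / g (t • x + s • y)) ^ 2
      + R / 2 * (t * s) * ‖x - y‖ ^ 2 := by
  set z := t • x + s • y with hz
  set B := R * t - 2 * (C / a) * s with hBdef
  set p := ‖fderiv ℝ g z‖ / g z with hp
  have hC0 : 0 ≤ C := (norm_nonneg (fderiv ℝ (fderiv ℝ g) z)).trans (hC z)
  have hgz : 0 < g z := ha.trans_le (hga z)
  have hgx : 0 < g x := ha.trans_le (hga x)
  have hxz : x - z = s • (x - y) := by
    have : t = 1 - s := by linarith
    rw [hz, this]
    module
  have hnorm : ‖x - z‖ = s * ‖x - y‖ := by rw [hxz, norm_smul, Real.norm_of_nonneg hs.le]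
  have htaylor := norm_sub_sub_fderiv_le_of_norm_fderiv_fderiv_le hg hC z x
  have hop := (fderiv ℝ g z).le_opNorm (x - z)
  rw [hnorm] at htaylor hop
  have h1 : g x - g z ≤ ‖fderiv ℝ g z‖ * (s * ‖x - y‖) + C * (s * ‖x - y‖) ^ 2 := by
    have h2 := (abs_le.1 htaylor).2
    have h3 := (abs_le.1 hop).2
    linarith
  have hlog : log (g x) - log (g z) ≤ (g x - g z) / g z := by
    rw [← log_div hgx.ne' hgz.ne', sub_div, div_self hgz.ne']
    exact log_le_sub_one_of_pos (by positivity)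
  have h2 : (g x - g z) / g z ≤ p * (s * ‖x - y‖) + C / a * (s * ‖x - y‖) ^ 2 :=
    calc (g x - g z) / g z
        ≤ (‖fderiv ℝ g z‖ * (s * ‖x - y‖) + C * (s * ‖x - y‖) ^ 2) / g z := by gcongr
      _ = p * (s * ‖x - y‖) + C / g z * (s * ‖x - y‖) ^ 2 := by rw [hp]; ring
      _ ≤ _ := by gcongr; exact hga z
  have h3 : p * ‖x - y‖ ≤ 1 / (2 * B) * p ^ 2 + B / 2 * ‖x - y‖ ^ 2 := by
    have h4 : 0 ≤ (p - B * ‖x - y‖) ^ 2 / (2 * B) := by positivity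
    have h5 : (p - B * ‖x - y‖) ^ 2 / (2 * B)
        = 1 / (2 * B) * p ^ 2 + B / 2 * ‖x - y‖ ^ 2 - p * ‖x - y‖ := by
      field_simp
      ring
    linarith
  have h6 := mul_le_mul_of_nonneg_left h3 hs.le
  have h7 : s * (B / 2 * ‖x - y‖ ^ 2)
      = R / 2 * (t * s) * ‖x - y‖ ^ 2 - C / a * (s * ‖x - y‖) ^ 2 := by
    rw [hBdef]; ring
  have h8 : s / (2 * B) * p ^ 2 = s * (1 / (2 * B) * p ^ 2) := by ring
  rw [h8]
  linarith

end

/-- Bakry–Emery type entropy bound: for `dμ = e^{-U} dx` with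
`Hess U ≥ R·Id` and a smooth bounded function `g` with values in a compact
subinterval of `(0,∞)`,
`∫ (g ln g − ‖∇g‖²/(2Rg)) dμ ≤ (∫ g dμ) ln (∫ g dμ)`. -/
theorem stmt_4 (n : ℕ) (R : ℝ) (hR : 0 < R)
    (U : EuclideanSpace ℝ (Fin n) → ℝ) (hU : ContDiff ℝ (⊤ : ℕ∞) U)
    (hHess : ∀ x v : EuclideanSpace ℝ (Fin n), R * ‖v‖ ^ 2 ≤ fderiv ℝ (fderiv ℝ U) x v v)
    (μ : Measure (EuclideanSpace ℝ (Fin n)))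
    (hμ : μ = volume.withDensity (fun x => ENNReal.ofReal (Real.exp (-U x))))
    (hprob : IsProbabilityMeasure μ)
    (g : EuclideanSpace ℝ (Fin n) → ℝ)
    (hg : ContDiff ℝ (⊤ : ℕ∞) g)
    (a b : ℝ) (ha : 0 < a) (hrange : ∀ x, g x ∈ Set.Icc a b)
    (hgd : ∀ i : ℕ, ∃ C : ℝ, ∀ x, ‖iteratedFDeriv ℝ i g x‖ ≤ C) :
    ∫ x, (g x * Real.log (g x) - ‖fderiv ℝ g x‖ ^ 2 / (2 * R * g x)) ∂μ
      ≤ (∫ x, g x ∂μ) * Real.log (∫ x, g x ∂μ) := by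
  have hU2 : ContDiff ℝ 2 U := contDiff_infty.1 hU 2
  have hg2 : ContDiff ℝ 2 g := contDiff_infty.1 hg 2
  have hgc : Continuous g := hg2.continuous
  have hdc : Continuous (fderiv ℝ g) := hg2.continuous_fderiv (by norm_num)
  obtain ⟨D, hD⟩ := hgd 1
  obtain ⟨C, hC⟩ := hgd 2
  replace hD : ∀ x, ‖fderiv ℝ g x‖ ≤ D := fun x => by simpa using hD x
  replace hC : ∀ x, ‖fderiv ℝ (fderiv ℝ g) x‖ ≤ C := fun x => by
    rw [← norm_iteratedFDeriv_one (𝕜 := ℝ), norm_iteratedFDeriv_fderiv]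
    exact hC x
  have hpos : ∀ x, 0 < g x := fun x => ha.trans_le (hrange x).1
  have hne : ∀ x, g x ≠ 0 := fun x => (hpos x).ne'
  have hb : 0 < b := (hpos 0).trans_le (hrange 0).2
  have hbdd : ∀ {f : EuclideanSpace ℝ (Fin n) → ℝ} (M : ℝ), Continuous f → (∀ x, |f x| ≤ M) →
      Integrable f μ := fun M hf hM =>
    Integrable.of_bound hf.aestronglyMeasurable M (ae_of_all _ hM)
  have hlogc : Continuous fun x => log (g x) := hgc.log hne
  set L := max |log a| |log b| with hL
  have hlogb : ∀ x, |log (g x)| ≤ L := fun x =>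
    abs_le_max_abs_abs (log_le_log ha (hrange x).1) (log_le_log (hpos x) (hrange x).2)
  have hgb : ∀ x, |g x| ≤ b := fun x => by
    rw [abs_of_pos (hpos x)]
    exact (hrange x).2
  set q : EuclideanSpace ℝ (Fin n) → ℝ := fun x => (‖fderiv ℝ g x‖ / g x) ^ 2 with hq
  have hqc : Continuous q := (hdc.norm.div₀ hgc hne).pow 2
  set Q := (D / a) ^ 2 with hQ
  have hq0 : ∀ x, 0 ≤ q x := fun x => sq_nonneg _
  have hD0 : 0 ≤ D := (norm_nonneg _).trans (hD 0)
  have hqQ : ∀ x, q x ≤ Q := fun x => by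
    have h1 := hpos x
    have h2 := (hrange x).1
    have h3 := hD x
    simp only [hq, hQ]
    gcongr
  have hgi : Integrable g μ := hbdd b hgc hgb
  have hgli : Integrable (fun x => g x * log (g x)) μ := by
    refine hbdd (b * L) (hgc.mul hlogc) fun x => ?_
    rw [abs_mul]
    exact mul_le_mul (hgb x) (hlogb x) (abs_nonneg _) hb.le
  have hgqi : Integrable (fun x => g x * q x) μ := by
    refine hbdd (b * Q) (hgc.mul hqc) fun x => ?_
    rw [abs_mul, abs_of_nonneg (hq0 x)]
    exact mul_le_mul (hgb x) (hqQ x) (hq0 x) hb.le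
  have hgq2i : Integrable (fun x => g x * q x ^ 2) μ := by
    refine hbdd (b * Q ^ 2) (hgc.mul (hqc.pow 2)) fun x => ?_
    rw [abs_mul, abs_of_nonneg (sq_nonneg (q x))]
    exact mul_le_mul (hgb x) (pow_le_pow_left₀ (hq0 x) (hqQ x) 2) (sq_nonneg _) hb.le
  set Z := ∫ x, g x ∂μ with hZ
  set Ent := ∫ x, g x * log (g x) ∂μ with hEnt
  set J := ∫ x, g x * q x ∂μ with hJ
  set J₂ := ∫ x, g x * q x ^ 2 ∂μ with hJ₂
  have hZpos : 0 < Z := by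
    have : ∫ _, a ∂μ ≤ Z := integral_mono (integrable_const a) hgi fun x => (hrange x).1
    simp only [integral_const, probReal_univ, one_smul] at this
    linarith
  have hgoal : ∫ x, (g x * log (g x) - ‖fderiv ℝ g x‖ ^ 2 / (2 * R * g x)) ∂μ
      = Ent - J / (2 * R) := by
    have : ∀ x, g x * log (g x) - ‖fderiv ℝ g x‖ ^ 2 / (2 * R * g x)
        = g x * log (g x) - g x * q x / (2 * R) := fun x => by
      have := hne x
      simp only [hq]
      field_simp
    simp only [this]
    rw [integral_sub hgli (hgqi.div_const _), integral_div]
  set B : ℝ → ℝ := fun s => R * (1 - s) - 2 * (C / a) * s with hBdef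
  set c : ℝ → ℝ := fun s => s / (2 * B s) with hcdef
  have hBd : HasDerivAt (fun s => 2 * B s) (2 * (-R - 2 * (C / a))) 0 := by
    have := ((((hasDerivAt_id (0 : ℝ)).const_sub 1).const_mul R).sub
      ((hasDerivAt_id (0 : ℝ)).const_mul (2 * (C / a)))).const_mul 2
    refine this.congr_deriv ?_
    ring
  have hB0 : B 0 = R := by simp [hBdef]
  have hcd : HasDerivAt c (1 / (2 * R)) 0 := by
    refine ((hasDerivAt_id (0 : ℝ)).div hBd (by rw [hB0]; positivity)).congr_deriv ?_
    simp only [hB0, id]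
    field_simp
    ring
  have hc0 : c 0 = 0 := by simp [hcdef]
  have hineq : ∀ s : ℝ, 0 < s → s < 1 → 0 < B s → c s * Q ≤ 1 → 0 ≤ Z + s / (1 - s) * Ent →
      (Z + s / (1 - s) * Ent) ^ (1 - s) ≤ Z + c s * J + c s ^ 2 * J₂ := by
    intro s hs hs1 hBs hcQ hbase
    have ht : 0 < 1 - s := by linarith
    have hcs : 0 ≤ c s := by simp only [hcdef]; positivity
    have hFi : Integrable (fun x => exp (log (g x) / (1 - s))) μ := by
      refine hbdd (exp (L / (1 - s))) (by fun_prop) fun x => ?_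
      rw [abs_of_pos (exp_pos _)]
      have := (abs_le.1 (hlogb x)).2
      gcongr
    have hHi : Integrable (fun x => exp (log (g x) + c s * q x)) μ := by
      refine hbdd (exp (L + c s * Q)) (by fun_prop) fun x => ?_
      rw [abs_of_pos (exp_pos _)]
      have := (abs_le.1 (hlogb x)).2
      have := hqQ x
      gcongr
    have hPL := integral_exp_rpow_le_of_le_hessian hU2 hHess hμ ht hs (by ring)
      (F := fun x => log (g x) / (1 - s)) (H := fun x => log (g x) + c s * q x)
      (by fun_prop) (by fun_prop) hFi hHi fun x y => by
        rw [mul_div_cancel₀ _ ht.ne']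
        exact log_le_log_add_of_norm_fderiv_fderiv_le hg2 ha (fun x => (hrange x).1) hC hs
          (by ring) hBs x y
    have hlower : Z + s / (1 - s) * Ent ≤ ∫ x, exp (log (g x) / (1 - s)) ∂μ := by
      rw [hZ, hEnt, ← integral_const_mul, ← integral_add hgi (hgli.const_mul _)]
      refine integral_mono (hgi.add (hgli.const_mul _)) hFi fun x => ?_
      have e : log (g x) / (1 - s) = log (g x) + s / (1 - s) * log (g x) := by
        field_simp
        ring
      simp only [e, exp_add, exp_log (hpos x)]
      have := mul_le_mul_of_nonneg_left (add_one_le_exp (s / (1 - s) * log (g x))) (hpos x).le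
      linarith
    have hupper : ∫ x, exp (log (g x) + c s * q x) ∂μ ≤ Z + c s * J + c s ^ 2 * J₂ := by
      rw [hZ, hJ, hJ₂, ← integral_const_mul, ← integral_const_mul,
        ← integral_add hgi (hgqi.const_mul _),
        ← integral_add (f := fun x => g x + c s * (g x * q x)) (hgi.add (hgqi.const_mul _)) (hgq2i.const_mul _)]
      refine integral_mono hHi ((hgi.add (hgqi.const_mul _)).add (hgq2i.const_mul _)) fun x => ?_
      simp only [exp_add, exp_log (hpos x)]
      have h0 : 0 ≤ c s * q x := mul_nonneg hcs (hq0 x)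
      have h1 : c s * q x ≤ 1 := (mul_le_mul_of_nonneg_left (hqQ x) hcs).trans hcQ
      have h2 := (abs_le.1 (abs_exp_sub_one_sub_id_le (abs_le.2 ⟨by linarith, h1⟩))).2
      have := mul_le_mul_of_nonneg_left h2 (hpos x).le
      linarith
    exact (rpow_le_rpow hbase hlower ht.le).trans (hPL.trans hupper)
  have hbased : HasDerivAt (fun s => Z + s / (1 - s) * Ent) Ent 0 := by
    have := ((((hasDerivAt_id (0 : ℝ)).div ((hasDerivAt_id (0 : ℝ)).const_sub 1)
      (by simp)).mul_const Ent).const_add Z)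
    refine this.congr_deriv ?_
    simp
  have hφ : HasDerivAt (fun s => Z + c s * J + c s ^ 2 * J₂ - (Z + s / (1 - s) * Ent) ^ (1 - s))
      (J / (2 * R) - (Ent - Z * log Z)) 0 := by
    have := (((hcd.mul_const J).const_add Z).add ((hcd.pow 2).mul_const J₂)).sub
      (hbased.rpow ((hasDerivAt_id (0 : ℝ)).const_sub 1) (by simpa using hZpos))
    refine this.congr_deriv ?_
    simp [hc0]
    ring
  have hfinal := hφ.nonneg_of_eventually_nonneg_right (by simp [hc0]) (by
    have hB1 : ∀ᶠ s in nhds (0 : ℝ), 0 < 2 * B s :=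
      hBd.continuousAt.eventually_const_lt (by simp only [hB0]; positivity)
    have hc1 : ∀ᶠ s in nhds (0 : ℝ), c s * Q < 1 :=
      (hcd.mul_const Q).continuousAt.eventually_lt_const (by simp [hc0])
    have hb1 : ∀ᶠ s in nhds (0 : ℝ), 0 < Z + s / (1 - s) * Ent :=
      hbased.continuousAt.eventually_const_lt (by simpa using hZpos)
    filter_upwards [self_mem_nhdsWithin, hB1.filter_mono nhdsWithin_le_nhds,
      hc1.filter_mono nhdsWithin_le_nhds, hb1.filter_mono nhdsWithin_le_nhds,
      (eventually_lt_nhds zero_lt_one).filter_mono nhdsWithin_le_nhds] with s h1 h2 h3 h4 h5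
    rw [zero_add]
    exact sub_nonneg.2 (hineq s h1 h5 (by linarith) h3.le h4.le))
  rw [hgoal]
  linarith
end
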